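/- There exists an integer s₀ such that for all integers s ≥ s₀ and q ≥ 100·s²/log s, and every ε > 0, there exist δ > 0 and a positive integer N such that the following holds: for every integer n ≥ N and every integer m with |m − ((s−1)/(2s))·n²| ≤ δ·n², if G is a graph with n vertices and m edges which is extremal for q (i.e., P_G(q) ≥ P_H(q) for every graph H with n vertices and m edges), then G is ε·n²-close to the Turán graph T_s(n). -/

import Mathlib

open SimpleGraph

/-- Number of proper `q`-colorings of a graph on `Fin n`. -/
noncomputable def numColorings (q : ℕ) {n : ℕ} (G : SimpleGraph (Fin n)) : ℕ :=
  Nat.card { f : Fin n → Fin q // ∀ v w, G.Adj v w → f v ≠ f w }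

/-- Number of edges of a graph on `Fin n`. -/
noncomputable def numEdges {n : ℕ} (G : SimpleGraph (Fin n)) : ℕ :=
  Nat.card G.edgeSet

/-- `G` is `d`-close to `H`: some isomorphic copy `G'` of `G` differs from `H`
in at most `d` edges (edit distance at most `d`). -/
def EditClose {n : ℕ} (d : ℝ) (G H : SimpleGraph (Fin n)) : Prop :=
  ∃ G' : SimpleGraph (Fin n), Nonempty (G ≃g G') ∧
    (Nat.card ↥(symmDiff G'.edgeSet H.edgeSet) : ℝ) ≤ d

namespace TuranColoring

open Finset

/-- The defect in `log r ≤ 2 (√r - 1)`. -/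
noncomputable def sqrtGap (r : ℝ) : ℝ := 2 * (√r - 1) - Real.log r

theorem log_le_half_sub_inv {y : ℝ} (hy : 1 ≤ y) : Real.log y ≤ (y - y⁻¹) / 2 := by
  have h := Real.self_le_sinh_iff.2 (Real.log_nonneg hy)
  rwa [Real.sinh_log (by linarith)] at h

theorem log_le_of_le_one {y : ℝ} (h0 : 0 < y) (h1 : y ≤ 1) :
    Real.log y ≤ -(2 * (1 - y) / (1 + y)) := by
  have h := Real.le_log_one_add_of_nonneg (x := y⁻¹ - 1) (by
    have := (one_le_inv₀ h0).2 h1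
    linarith)
  have e : 1 + (y⁻¹ - 1) = y⁻¹ := by ring
  rw [e, Real.log_inv] at h
  have e2 : 2 * (y⁻¹ - 1) / (y⁻¹ - 1 + 2) = 2 * (1 - y) / (1 + y) := by
    rw [div_eq_div_iff (by have := inv_pos.2 h0; linarith) (by linarith)]
    field_simp
    ring
  rw [e2] at h
  linarith

theorem log_eq_two_mul_log_sqrt {r : ℝ} (hr : 0 < r) : Real.log r = 2 * Real.log (√r) := by
  rw [Real.log_sqrt hr.le]; ring

theorem sqrtGap_ge_of_one_le {r : ℝ} (hr : 1 ≤ r) : (√r - 1) ^ 2 / √r ≤ sqrtGap r := by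
  have hy : 1 ≤ √r := Real.one_le_sqrt.2 hr
  have h := log_le_half_sub_inv hy
  rw [sqrtGap, log_eq_two_mul_log_sqrt (by linarith)]
  have e : (√r - 1) ^ 2 / √r = √r - 2 + (√r)⁻¹ := by
    field_simp
    ring
  rw [e]; linarith

theorem sqrtGap_ge_of_le_one {r : ℝ} (h0 : 0 < r) (hr : r ≤ 1) :
    2 * (1 - √r) ^ 2 / (1 + √r) ≤ sqrtGap r := by
  have hy : √r ≤ 1 := Real.sqrt_le_one.2 hr
  have hy0 : 0 < √r := Real.sqrt_pos.2 h0
  have h := log_le_of_le_one hy0 hy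
  rw [sqrtGap, log_eq_two_mul_log_sqrt h0]
  have e : 2 * (1 - √r) ^ 2 / (1 + √r) = 2 * (√r - 1) + 2 * (2 * (1 - √r) / (1 + √r)) := by
    field_simp
    ring
  rw [e]; linarith

theorem sqrtGap_nonneg {r : ℝ} (hr : 0 < r) : 0 ≤ sqrtGap r := by
  rw [sqrtGap, log_eq_two_mul_log_sqrt hr]
  have := Real.log_le_sub_one_of_pos (Real.sqrt_pos.2 hr)
  linarith

theorem sqrtGap_ge_of_far {r : ℝ} (h0 : 0 < r) (hr : r ≤ 0.9 ∨ 1.09 ≤ r) :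
    1 / 1000 ≤ sqrtGap r := by
  rcases hr with hr | hr
  · refine le_trans ?_ (sqrtGap_ge_of_le_one h0 (by linarith))
    have hy : √r ≤ 0.95 := Real.sqrt_le_iff.2 ⟨by norm_num, by norm_num; linarith⟩
    have := Real.sqrt_nonneg r
    rw [div_le_div_iff₀ (by norm_num) (by linarith)]
    nlinarith
  · refine le_trans ?_ (sqrtGap_ge_of_one_le (by linarith))
    have hy : 1.044 ≤ √r := Real.le_sqrt_of_sq_le (by norm_num; linarith)
    rw [div_le_div_iff₀ (by norm_num) (by linarith)]
    nlinarith

theorem sub_one_mul_log_le {r : ℝ} (h0 : 0 < r) (hr : r ≤ 3) :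
    (r - 1) * Real.log r ≤ 10 * sqrtGap r := by
  have hs : √r * √r = r := Real.mul_self_sqrt h0.le
  have hy0 : 0 < √r := Real.sqrt_pos.2 h0
  rcases le_total 1 r with h | h
  · have hy : 1 ≤ √r := Real.one_le_sqrt.2 h
    have hy2 : √r ≤ 2 := Real.sqrt_le_iff.2 ⟨by norm_num, by norm_num; linarith⟩
    have h1 := sqrtGap_ge_of_one_le h
    have h2 := log_le_half_sub_inv hy
    have h3 : Real.log r ≤ √r - (√r)⁻¹ := by rw [log_eq_two_mul_log_sqrt h0]; linarith
    have h4 : (r - 1) * Real.log r ≤ (r - 1) * (√r - (√r)⁻¹) :=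
      mul_le_mul_of_nonneg_left h3 (by linarith)
    have h5 : (r - 1) * (√r - (√r)⁻¹) ≤ 10 * ((√r - 1) ^ 2 / √r) := by
      have e : (r - 1) * (√r - (√r)⁻¹) = (√r - 1) ^ 2 * (√r + 1) ^ 2 / √r := by
        rw [← hs]
        simp only [Real.sqrt_mul_self hy0.le]
        field_simp
        ring
      rw [e, mul_div_assoc', div_le_div_iff_of_pos_right hy0]
      nlinarith [sq_nonneg (√r - 1)]
    linarith
  · have hy : √r ≤ 1 := Real.sqrt_le_one.2 h
    have h2 := log_le_of_le_one hy0 hy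
    rw [sqrtGap, log_eq_two_mul_log_sqrt h0]
    set g := Real.log (√r)
    set y := √r
    have h3 : g * (1 + y) ≤ -(2 * (1 - y)) := by
      have : g ≤ (-(2 * (1 - y))) / (1 + y) := by rw [neg_div]; exact h2
      rwa [le_div_iff₀ (by linarith)] at this
    rw [← hs]
    have h5 : (18 + 2 * y ^ 2) * (g * (1 + y)) ≤ (18 + 2 * y ^ 2) * (-(2 * (1 - y))) :=
      mul_le_mul_of_nonneg_left h3 (by positivity)
    have h7 : 20 * (1 - y) * (1 + y) + (18 + 2 * y ^ 2) * (g * (1 + y)) ≤ 0 := by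
      have : 0 ≤ (1 - y) * ((1 - y) * (4 - y)) :=
        mul_nonneg (by linarith) (mul_nonneg (by linarith) (by linarith))
      nlinarith
    have h8 : 20 * (1 - y) + (18 + 2 * y ^ 2) * g ≤ 0 := by
      by_contra hc
      push Not at hc
      have := mul_pos hc (by linarith : 0 < 1 + y)
      nlinarith
    nlinarith

theorem sq_log_le_of_one_le {r : ℝ} (hr : 1 ≤ r) : Real.log r ^ 2 ≤ 4 * sqrtGap r := by
  have hy : 1 ≤ √r := Real.one_le_sqrt.2 hr
  have h := Real.quadratic_le_exp_of_nonneg (Real.log_nonneg hy)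
  rw [Real.exp_log (by linarith)] at h
  rw [sqrtGap, log_eq_two_mul_log_sqrt (by linarith)]
  nlinarith

theorem sq_log_le {r : ℝ} (hr : 0.4 ≤ r) : Real.log r ^ 2 ≤ 6 * sqrtGap r := by
  have h0 : 0 < r := lt_of_lt_of_le (by norm_num) hr
  rcases le_total 1 r with h | h
  · have := sq_log_le_of_one_le h
    have := sqrtGap_nonneg h0
    linarith
  · have hy : √r ≤ 1 := Real.sqrt_le_one.2 h
    have hy0 : 0 < √r := Real.sqrt_pos.2 h0
    have hy6 : 0.63 ≤ √r := Real.le_sqrt_of_sq_le (by norm_num; linarith)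
    have h1 := sqrtGap_ge_of_le_one h0 h
    have h2 := log_le_half_sub_inv (y := (√r)⁻¹) ((one_le_inv₀ hy0).2 hy)
    rw [Real.log_inv, inv_inv] at h2
    rw [log_eq_two_mul_log_sqrt h0]
    set y := √r
    have hneg : Real.log y ≤ 0 := Real.log_nonpos hy0.le hy
    have h3 : (-Real.log y) ^ 2 ≤ ((y⁻¹ - y) / 2) ^ 2 := by
      apply pow_le_pow_left₀ (by linarith) h2
    have h4 : 4 * ((y⁻¹ - y) / 2) ^ 2 ≤ 6 * (2 * (1 - y) ^ 2 / (1 + y)) := by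
      have e : 4 * ((y⁻¹ - y) / 2) ^ 2 = (1 - y) ^ 2 * (1 + y) ^ 2 / y ^ 2 := by
        field_simp
        ring
      rw [e, mul_div_assoc', div_le_div_iff₀ (by positivity) (by linarith)]
      have h5 : (1 + y) ^ 3 ≤ 12 * y ^ 2 := by
        nlinarith [mul_nonneg (sub_nonneg.2 hy) (sub_nonneg.2 hy6),
          mul_nonneg (mul_nonneg (sub_nonneg.2 hy) (sub_nonneg.2 hy6)) hy0.le]
      have := mul_le_mul_of_nonneg_left h5 (sq_nonneg (1 - y))
      nlinarith
    nlinarith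

/-- The chord of `log` between consecutive integers lies above `log` at all integers. -/
theorem log_le_chord {K : ℕ} (hK : 1 ≤ K) {a : ℕ} (ha : 1 ≤ a) :
    Real.log a ≤ Real.log K + Real.log (1 + 1 / K) * ((a : ℝ) - K) := by
  have step : ∀ j : ℕ, 1 ≤ j → Real.log ((j + 1 : ℕ) : ℝ) = Real.log j + Real.log (1 + 1 / j) := by
    intro j hj
    have : (0 : ℝ) < j := by exact_mod_cast hj
    rw [← Real.log_mul (by positivity) (by positivity)]
    congr 1
    push_cast
    field_simp
  have anti : ∀ i j : ℕ, 1 ≤ i → i ≤ j → Real.log (1 + 1 / j) ≤ Real.log (1 + 1 / i) := by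
    intro i j hi hij
    have h1 : (0 : ℝ) < i := by exact_mod_cast hi
    have h2 : (i : ℝ) ≤ j := by exact_mod_cast hij
    apply Real.log_le_log (by positivity)
    gcongr
  rcases le_total K a with h | h
  · induction a, h using Nat.le_induction with
    | base => simp
    | succ j hj ih =>
      have := ih (hK.trans hj)
      rw [step j (hK.trans hj)]
      have h2 := anti K j hK hj
      push_cast
      nlinarith
  · induction h using Nat.decreasingInduction with
    | self => simp
    | of_succ j hj ih =>
      have := ih (by omega)
      rw [step j ha] at this
      have h2 := anti j K ha (by omega)
      push_cast at this
      nlinarith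

theorem log_one_add_inv_bounds {K : ℝ} (hK : 1 ≤ K) :
    1 / K - 1 / (2 * K ^ 2) ≤ Real.log (1 + 1 / K) ∧ Real.log (1 + 1 / K) ≤ 1 / K := by
  have h0 : 0 < K := by linarith
  constructor
  · have h := Real.le_log_one_add_of_nonneg (x := 1 / K) (by positivity)
    refine le_trans ?_ h
    have e : 2 * (1 / K) / (1 / K + 2) = 2 / (1 + 2 * K) := by field_simp
    have e2 : 1 / K - 1 / (2 * K ^ 2) = (2 * K - 1) / (2 * K ^ 2) := by field_simp
    rw [e, e2, div_le_div_iff₀ (by positivity) (by positivity)]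
    nlinarith
  · have := Real.log_le_sub_one_of_pos (x := 1 + 1 / K) (by positivity)
    linarith

/-- Far from `K`, the chord is above `log` by a linear amount. -/
theorem log_add_linear_le_chord {K : ℝ} (hK : 100 ≤ K) {a : ℝ} (ha : 3 * K ≤ a) :
    Real.log a + 0.07 * (a / K) ≤ Real.log K + Real.log (1 + 1 / K) * (a - K) := by
  have h0 : 0 < K := by linarith
  obtain ⟨hl, -⟩ := log_one_add_inv_bounds (K := K) (by linarith)
  have hr : 3 ≤ a / K := by rwa [le_div_iff₀ h0]
  have e1 : Real.log a = Real.log K + (Real.log 3 + Real.log (a / K / 3)) := by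
    rw [← Real.log_mul (by norm_num) (by positivity), ← Real.log_mul (by positivity) (by positivity)]
    congr 1
    field_simp
  have h3 : Real.log 3 ≤ 4 / 3 := by
    have := log_le_half_sub_inv (y := 3) (by norm_num)
    norm_num at this ⊢
    linarith
  have h4 := Real.log_le_sub_one_of_pos (x := a / K / 3) (by positivity)
  have h5 : 0.99 * (a / K - 1) ≤ Real.log (1 + 1 / K) * (a - K) := by
    have e : (0.99 : ℝ) * (a / K - 1) = 0.99 / K * (a - K) := by field_simp
    rw [e]
    apply mul_le_mul_of_nonneg_right _ (by linarith)
    refine le_trans ?_ hl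
    have : 1 / K - 1 / (2 * K ^ 2) = (1 - 1 / (2 * K)) / K := by field_simp
    rw [this]
    apply div_le_div_of_nonneg_right _ h0.le
    have : 1 / (2 * K) ≤ 1 / 200 := by gcongr; linarith
    linarith
  rw [e1]
  linarith

section Weights

variable {q : ℕ}

/-- Indicator that two color sets intersect. -/
noncomputable def hit (A B : Finset (Fin q)) : ℝ := if Disjoint A B then 0 else 1

/-- Weight of the sets intersecting `A`. -/
noncomputable def meetWeight (α : Finset (Fin q) → ℝ) (A : Finset (Fin q)) : ℝ :=
  ∑ B, α B * hit A B

/-- Weight of the sets containing the color `i`. -/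
noncomputable def colorWeight (α : Finset (Fin q) → ℝ) (i : Fin q) : ℝ :=
  ∑ A, if i ∈ A then α A else 0

/-- Average of `log |A|`. -/
noncomputable def logMean (α : Finset (Fin q) → ℝ) : ℝ := ∑ A, α A * Real.log (#A : ℝ)

/-- Probability weights on nonempty color sets. -/
structure IsWeight (α : Finset (Fin q) → ℝ) : Prop where
  nonneg : ∀ A, 0 ≤ α A
  empty : α ∅ = 0
  sum_eq : ∑ A, α A = 1

theorem hit_nonneg (A B : Finset (Fin q)) : 0 ≤ hit A B := by
  unfold hit; split_ifs <;> norm_num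

theorem hit_le_one (A B : Finset (Fin q)) : hit A B ≤ 1 := by
  unfold hit; split_ifs <;> norm_num

theorem hit_comm (A B : Finset (Fin q)) : hit A B = hit B A := by
  simp [hit, disjoint_comm]

theorem hit_eq_one {A B : Finset (Fin q)} {i : Fin q} (hA : i ∈ A) (hB : i ∈ B) :
    hit A B = 1 := by
  unfold hit
  rw [if_neg]
  exact fun h => Finset.disjoint_left.1 h hA hB

theorem hit_eq_one_of_not_disjoint {A B : Finset (Fin q)} (h : ¬ Disjoint A B) :
    hit A B = 1 := if_neg h

theorem hit_eq_zero {A B : Finset (Fin q)} (h : Disjoint A B) : hit A B = 0 := if_pos h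

theorem IsWeight.avg_le {α : Finset (Fin q) → ℝ} (h : IsWeight α) {f g : Finset (Fin q) → ℝ}
    (hfg : ∀ A, 0 < α A → f A ≤ g A) : ∑ A, α A * f A ≤ ∑ A, α A * g A := by
  refine sum_le_sum fun A _ => ?_
  rcases (h.nonneg A).eq_or_lt with h0 | h0
  · simp [← h0]
  · exact mul_le_mul_of_nonneg_left (hfg A h0) h0.le

theorem IsWeight.card_pos {α : Finset (Fin q) → ℝ} (h : IsWeight α) {A : Finset (Fin q)}
    (hA : 0 < α A) : 0 < #A := by
  rw [Finset.card_pos, Finset.nonempty_iff_ne_empty]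
  rintro rfl
  rw [h.empty] at hA
  exact lt_irrefl _ hA

theorem IsWeight.avg_nonneg {α : Finset (Fin q) → ℝ} (h : IsWeight α) {f : Finset (Fin q) → ℝ}
    (hf : ∀ A, 0 < α A → 0 ≤ f A) : 0 ≤ ∑ A, α A * f A := by
  have := h.avg_le (f := fun _ => 0) hf
  simpa using this

theorem IsWeight.markov {α : Finset (Fin q) → ℝ} (h : IsWeight α) {f : Finset (Fin q) → ℝ}
    (hf : ∀ A, 0 < α A → 0 ≤ f A) (P : Finset (Fin q) → Prop) [DecidablePred P] (c : ℝ)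
    (hc : ∀ A, 0 < α A → P A → c ≤ f A) : c * ∑ A with P A, α A ≤ ∑ A, α A * f A := by
  rw [sum_filter, mul_sum]
  refine sum_le_sum fun A _ => ?_
  rcases (h.nonneg A).eq_or_lt with h0 | h0
  · simp [← h0]
  · split_ifs with hP
    · rw [mul_comm]; exact mul_le_mul_of_nonneg_left (hc A h0 hP) h0.le
    · rw [mul_zero]; exact mul_nonneg h0.le (hf A h0)

theorem IsWeight.avg_const {α : Finset (Fin q) → ℝ} (h : IsWeight α) (c : ℝ) :
    ∑ A, α A * c = c := by
  rw [← sum_mul, h.sum_eq, one_mul]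

theorem colorWeight_nonneg {α : Finset (Fin q) → ℝ} (h : IsWeight α) (i : Fin q) :
    0 ≤ colorWeight α i := by
  unfold colorWeight
  refine sum_nonneg fun A _ => ?_
  split_ifs
  · exact h.nonneg A
  · exact le_rfl

theorem sum_colorWeight_mul_fun (f : Finset (Fin q) → ℝ) (g : Fin q → ℝ) :
    ∑ i, colorWeight f i * g i = ∑ A, f A * ∑ i ∈ A, g i := by
  simp only [colorWeight, sum_mul, mul_sum]
  rw [sum_comm]
  refine sum_congr rfl fun A _ => ?_
  rw [← sum_filter_add_sum_filter_not univ (· ∈ A)]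
  rw [sum_eq_zero (s := univ.filter (fun x => ¬ x ∈ A)), add_zero]
  · simp only [filter_mem_eq_inter, univ_inter]
    exact sum_congr rfl fun i hi => by simp [hi]
  · intro i hi
    simp only [mem_filter] at hi
    simp [hi.2]

theorem sum_colorWeight (f : Finset (Fin q) → ℝ) :
    ∑ i, colorWeight f i = ∑ A, f A * #A := by
  have := sum_colorWeight_mul_fun f (fun _ => 1)
  simpa using this

theorem sum_mem_colorWeight (g : Finset (Fin q) → ℝ) (A : Finset (Fin q)) :
    ∑ i ∈ A, colorWeight g i = ∑ B, g B * #(A ∩ B) := by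
  simp only [colorWeight]
  rw [sum_comm]
  refine sum_congr rfl fun B _ => ?_
  rw [← sum_filter, sum_const, nsmul_eq_mul, filter_mem_eq_inter, mul_comm]

theorem sum_colorWeight_mul (f g : Finset (Fin q) → ℝ) :
    ∑ i, colorWeight f i * colorWeight g i = ∑ A, ∑ B, f A * g B * #(A ∩ B) := by
  rw [sum_colorWeight_mul_fun]
  refine sum_congr rfl fun A _ => ?_
  rw [sum_mem_colorWeight, mul_sum]
  exact sum_congr rfl fun B _ => by ring

theorem inter_card_div_le_hit (A B : Finset (Fin q)) : (#(A ∩ B) : ℝ) / #A ≤ hit A B := by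
  by_cases h : Disjoint A B
  · rw [hit_eq_zero h, Finset.disjoint_iff_inter_eq_empty.1 h]; simp
  · rw [hit_eq_one_of_not_disjoint h]
    apply div_le_one_of_le₀ _ (Nat.cast_nonneg _)
    exact_mod_cast card_le_card inter_subset_left

/-- Excess of the intersection weight over the proportional overlap. -/
noncomputable def overlapDefect (α : Finset (Fin q) → ℝ) (A : Finset (Fin q)) : ℝ :=
  ∑ B, α B * (hit A B - (#(A ∩ B) : ℝ) / #A)

theorem overlapDefect_nonneg {α : Finset (Fin q) → ℝ} (h : IsWeight α) (A : Finset (Fin q)) :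
    0 ≤ overlapDefect α A :=
  h.avg_nonneg fun B _ => sub_nonneg.2 (inter_card_div_le_hit A B)

theorem sum_sqrt_weights_le {α : Finset (Fin q) → ℝ} (h : IsWeight α) :
    ∑ i, colorWeight (fun A => α A / √(#A : ℝ)) i ^ 2 ≤
      ∑ A, α A * ∑ B, α B * ((#(A ∩ B) : ℝ) / #A) := by
  have e1 : ∑ i, colorWeight (fun A => α A / √(#A : ℝ)) i ^ 2 =
      ∑ A, ∑ B, α A / √(#A : ℝ) * (α B / √(#B : ℝ)) * #(A ∩ B) := by
    rw [← sum_colorWeight_mul]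
    exact sum_congr rfl fun i _ => sq _
  have e2 : ∑ A, α A * ∑ B, α B * ((#(A ∩ B) : ℝ) / #A) =
      ∑ A, ∑ B, α A * α B * #(A ∩ B) * ((1 / (#A : ℝ) + 1 / #B) / 2) := by
    have e3 : ∑ A, α A * ∑ B, α B * ((#(A ∩ B) : ℝ) / #A) =
      ∑ A, ∑ B, α A * α B * #(A ∩ B) * (1 / (#A : ℝ)) := by
      refine sum_congr rfl fun A _ => ?_
      rw [mul_sum]
      exact sum_congr rfl fun B _ => by ring
    have e4 : ∑ A, ∑ B, α A * α B * #(A ∩ B) * (1 / (#A : ℝ)) =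
        ∑ A, ∑ B, α A * α B * #(A ∩ B) * (1 / (#B : ℝ)) := by
      rw [sum_comm]
      refine sum_congr rfl fun A _ => sum_congr rfl fun B _ => ?_
      rw [inter_comm]; ring
    have e5 : ∑ A, ∑ B, α A * α B * #(A ∩ B) * ((1 / (#A : ℝ) + 1 / #B) / 2) =
        (∑ A, ∑ B, α A * α B * #(A ∩ B) * (1 / (#A : ℝ)) +
          ∑ A, ∑ B, α A * α B * #(A ∩ B) * (1 / (#B : ℝ))) / 2 := by
      rw [← sum_add_distrib, sum_div]
      refine sum_congr rfl fun A _ => ?_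
      rw [← sum_add_distrib, sum_div]
      exact sum_congr rfl fun B _ => by ring
    rw [e3, e5, ← e4]; ring
  rw [e1, e2]
  refine sum_le_sum fun A _ => sum_le_sum fun B _ => ?_
  have e : α A / √(#A : ℝ) * (α B / √(#B : ℝ)) * #(A ∩ B) =
      α A * α B * #(A ∩ B) * ((√(#A : ℝ))⁻¹ * (√(#B : ℝ))⁻¹) := by ring
  rw [e]
  apply mul_le_mul_of_nonneg_left _
    (mul_nonneg (mul_nonneg (h.nonneg A) (h.nonneg B)) (Nat.cast_nonneg _))
  have h1 : (√(#A : ℝ))⁻¹ ^ 2 = 1 / #A := by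
    rw [inv_pow, Real.sq_sqrt (Nat.cast_nonneg _), one_div]
  have h2 : (√(#B : ℝ))⁻¹ ^ 2 = 1 / #B := by
    rw [inv_pow, Real.sq_sqrt (Nat.cast_nonneg _), one_div]
  rw [← h1, ← h2]
  nlinarith [sq_nonneg ((√(#A : ℝ))⁻¹ - (√(#B : ℝ))⁻¹)]

theorem avg_overlapDefect_add_sqrtGap_le {α : Finset (Fin q) → ℝ} (h : IsWeight α) {s : ℕ}
    (hs : 0 < s) (hq : 0 < q) (hI : ∑ A, α A * meetWeight α A ≤ 1 / s) :
    s * ∑ A, α A * overlapDefect α A + ∑ A, α A * sqrtGap (#A / ((q : ℝ) / s)) ≤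
      Real.log ((q : ℝ) / s) - logMean α := by
  have hs' : (0 : ℝ) < s := by exact_mod_cast hs
  have hq' : (0 : ℝ) < q := by exact_mod_cast hq
  set k : ℝ := (q : ℝ) / s with hk
  have hk0 : 0 < k := by positivity
  have e1 : ∑ A, α A * overlapDefect α A =
      ∑ A, α A * meetWeight α A - ∑ A, α A * ∑ B, α B * ((#(A ∩ B) : ℝ) / #A) := by
    rw [← sum_sub_distrib]
    refine sum_congr rfl fun A _ => ?_
    rw [overlapDefect, meetWeight, ← mul_sub, ← sum_sub_distrib]
    congr 1
    exact sum_congr rfl fun B _ => by ring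
  set u := colorWeight (fun A => α A / √(#A : ℝ))
  have e2 : ∑ i, u i = ∑ A, α A * √(#A : ℝ) := by
    rw [sum_colorWeight]
    refine sum_congr rfl fun A _ => ?_
    rw [div_mul_eq_mul_div, mul_div_assoc, Real.div_sqrt]
  have hc : (s : ℝ) * √k = √(s * q) := by
    rw [hk, ← Real.sqrt_sq hs'.le, ← Real.sqrt_mul (by positivity)]
    congr 1
    rw [Real.sqrt_sq hs'.le]
    field_simp
  have e3 : 2 * (∑ i, u i) * (1 / (s * √k)) - 1 / s ≤ ∑ i, u i ^ 2 := by
    have h1 : ∀ i ∈ (univ : Finset (Fin q)),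
        2 * u i * (1 / (s * √k)) - (1 / (s * √k)) ^ 2 ≤ u i ^ 2 := fun i _ => by
      nlinarith [sq_nonneg (u i - 1 / (s * √k))]
    have h2 := sum_le_sum h1
    rw [sum_sub_distrib, ← sum_mul, ← mul_sum, sum_const, card_univ, Fintype.card_fin,
      nsmul_eq_mul] at h2
    have h3 : (q : ℝ) * (1 / (s * √k)) ^ 2 = 1 / s := by
      rw [div_pow, mul_pow, Real.sq_sqrt hk0.le, hk]
      field_simp
    rwa [h3] at h2
  have e4 : ∑ A, α A * sqrtGap (#A / k) =
      2 * (∑ A, α A * √(#A : ℝ)) / √k - 2 - logMean α + Real.log k := by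
    have : ∑ A, α A * sqrtGap (#A / k) = ∑ A, (2 / √k * (α A * √(#A : ℝ)) - α A * 2 -
        α A * Real.log (#A : ℝ) + α A * Real.log k) := by
      refine sum_congr rfl fun A _ => ?_
      rcases (h.nonneg A).eq_or_lt with h0 | h0
      · simp [← h0]
      · have ha : (0 : ℝ) < #A := by exact_mod_cast h.card_pos h0
        rw [sqrtGap, Real.sqrt_div ha.le, Real.log_div ha.ne' hk0.ne']
        ring
    rw [this, sum_add_distrib, sum_sub_distrib, sum_sub_distrib, ← mul_sum, h.avg_const,
      h.avg_const, logMean]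
    ring
  have e5 := sum_sqrt_weights_le h
  rw [e4, e1]
  have e6 : ∑ A, α A * meetWeight α A - ∑ A, α A * ∑ B, α B * ((#(A ∩ B) : ℝ) / #A) ≤
      1 / s - (2 * (∑ A, α A * √(#A : ℝ)) * (1 / (s * √k)) - 1 / s) := by
    rw [← e2]; linarith
  have e7 := mul_le_mul_of_nonneg_left e6 hs'.le
  have e8 : (s : ℝ) * (1 / s - (2 * (∑ A, α A * √(#A : ℝ)) * (1 / (s * √k)) - 1 / s)) =
      2 - 2 * (∑ A, α A * √(#A : ℝ)) / √k := by
    have : 0 < √k := Real.sqrt_pos.2 hk0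
    field_simp
    ring
  rw [e8] at e7
  linarith

end Weights

section Critical

variable {q s K : ℕ} {α : Finset (Fin q) → ℝ} {η : ℝ}

/-- Average of `log` over the part sizes of a balanced partition of `q` colors in `s` parts. -/
noncomputable def balancedLog (q s K : ℕ) : ℝ :=
  Real.log K + Real.log (1 + 1 / K) * ((q : ℝ) / s - K)

/-- The range of parameters in which the argument runs; `K` is the integer part of `q / s`. -/
structure Params (q s K : ℕ) : Prop where
  two_le : 2 ≤ s
  large : 10 ^ 20 ≤ K
  mul_le : K * s ≤ q
  lt_mul : q < (K + 1) * s
  le_log : 49 * (s : ℝ) ≤ K * Real.log K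
  log_le : 10 ^ 5 * Real.log K ≤ √(K : ℝ)

namespace Params

theorem s_pos (p : Params q s K) : (0 : ℝ) < s := by
  have := p.two_le
  exact_mod_cast (by omega : 0 < s)

theorem K_large (p : Params q s K) : (10 : ℝ) ^ 20 ≤ K := by exact_mod_cast p.large

theorem K_ge (p : Params q s K) : (1000000 : ℝ) ≤ K := le_trans (by norm_num) p.K_large

theorem K_pos (p : Params q s K) : (0 : ℝ) < K := lt_of_lt_of_le (by norm_num) p.K_large

theorem K_le_ratio (p : Params q s K) : (K : ℝ) ≤ (q : ℝ) / s := by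
  rw [le_div_iff₀ p.s_pos]; exact_mod_cast p.mul_le

theorem ratio_lt (p : Params q s K) : (q : ℝ) / s < K + 1 := by
  rw [div_lt_iff₀ p.s_pos]; exact_mod_cast p.lt_mul

theorem ratio_pos (p : Params q s K) : (0 : ℝ) < (q : ℝ) / s := p.K_pos.trans_le p.K_le_ratio

theorem q_pos (p : Params q s K) : 0 < q := by
  by_contra h
  have := p.ratio_pos
  simp [Nat.eq_zero_of_not_pos h] at this

theorem ratio_le (p : Params q s K) : (q : ℝ) / s ≤ 1.0001 * K := by
  have := p.ratio_lt
  have := p.K_ge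
  linarith

theorem sqrt_large (p : Params q s K) : (10 : ℝ) ^ 10 ≤ √(K : ℝ) := by
  apply Real.le_sqrt_of_sq_le
  have := p.K_large
  norm_num at this ⊢
  exact this

theorem s_mul_le (p : Params q s K) : 49 * 10 ^ 5 * (s : ℝ) ≤ K * √(K : ℝ) := by
  have h1 := p.le_log
  have h2 := mul_le_mul_of_nonneg_left p.log_le p.K_pos.le
  nlinarith

theorem s_mul_eps_le (p : Params q s K) : (s : ℝ) * (1 / (2 * (K : ℝ) ^ 2)) ≤ 1 / 10 ^ 16 := by
  have h1 := p.s_mul_le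
  have h2 := p.sqrt_large
  have h3 : √(K : ℝ) * √(K : ℝ) = K := Real.mul_self_sqrt p.K_pos.le
  have h4 := p.K_pos
  rw [mul_one_div, div_le_div_iff₀ (by positivity) (by positivity)]
  have h5 : (K : ℝ) * √(K : ℝ) * 10 ^ 10 ≤ K ^ 2 := by
    have := mul_le_mul_of_nonneg_left h2 (by positivity : 0 ≤ (K : ℝ) * √(K : ℝ))
    nlinarith
  nlinarith

theorem eps_pos (p : Params q s K) : (0 : ℝ) < 1 / (2 * (K : ℝ) ^ 2) := by
  have := p.K_pos
  positivity

theorem eps_le (p : Params q s K) : (1 / (2 * (K : ℝ) ^ 2)) ≤ 1 / 10 ^ 16 := by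
  refine le_trans ?_ p.s_mul_eps_le
  have h1 : (1 : ℝ) ≤ s := by exact_mod_cast (by have := p.two_le; omega : 1 ≤ s)
  have h2 := p.eps_pos
  nlinarith

theorem one_le_K (p : Params q s K) : (1 : ℝ) ≤ K := le_trans (by norm_num) p.K_large

theorem slope_nonneg (p : Params q s K) : 0 ≤ Real.log (1 + 1 / (K : ℝ)) := by
  apply Real.log_nonneg
  have := p.K_pos
  have : 0 < 1 / (K : ℝ) := by positivity
  linarith

theorem log_le_balancedLog (p : Params q s K) : Real.log K ≤ balancedLog q s K := by
  have := mul_nonneg p.slope_nonneg (sub_nonneg.2 p.K_le_ratio)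
  rw [balancedLog]; linarith

theorem log_ratio_le (p : Params q s K) :
    Real.log ((q : ℝ) / s) ≤ balancedLog q s K + 1 / (2 * (K : ℝ) ^ 2) := by
  have h0 := p.K_pos
  have h1 := p.K_le_ratio
  have h2 := p.ratio_lt
  have h3 := (log_one_add_inv_bounds p.one_le_K).1
  have h4 := Real.log_le_sub_one_of_pos (x := (q : ℝ) / s / K) (div_pos p.ratio_pos h0)
  rw [Real.log_div p.ratio_pos.ne' h0.ne'] at h4
  have h5 : (q : ℝ) / s / K - 1 = 1 / K * ((q : ℝ) / s - K) := by field_simp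
  have h6 := mul_le_mul_of_nonneg_right h3 (sub_nonneg.2 h1)
  have h7 : 1 / (2 * (K : ℝ) ^ 2) * ((q : ℝ) / s - K) ≤ 1 / (2 * (K : ℝ) ^ 2) := by
    have := p.eps_pos
    nlinarith
  rw [balancedLog]
  nlinarith

theorem log_large (p : Params q s K) : 46 ≤ Real.log K := by
  have h1 : Real.log ((10 : ℝ) ^ 20) ≤ Real.log K :=
    Real.log_le_log (by positivity) p.K_large
  have h2 : Real.log ((10 : ℝ) ^ 20) = 20 * Real.log 10 := by
    rw [Real.log_pow]; norm_num
  have h3 : (2.3 : ℝ) ≤ Real.log 10 := by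
    have h4 : Real.log 10 = 3 * Real.log 2 + Real.log (1 + 1 / 4) := by
      rw [← Real.log_rpow (by norm_num), ← Real.log_mul (by positivity) (by norm_num)]
      norm_num
    have h5 := Real.log_two_gt_d9
    have h6 := Real.le_log_one_add_of_nonneg (x := 1 / 4) (by norm_num)
    norm_num at h6
    norm_num at h4
    rw [h4]
    norm_num at h5 ⊢
    linarith
  linarith

end Params

/-- First-order conditions at a maximum of `logMean` under the intersection constraint. -/
structure Critical (q s K : ℕ) (α : Finset (Fin q) → ℝ) (η : ℝ) : Prop extends
    Params q s K, IsWeight α where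
  self : ∑ A, α A * meetWeight α A = 1 / s
  obj : balancedLog q s K ≤ logMean α
  mult_nonneg : 0 ≤ η
  cond : ∀ A, A ≠ ∅ → η * (Real.log (#A : ℝ) - logMean α) ≤ s * meetWeight α A - 1

namespace Critical

variable (h : Critical q s K α η)
include h

theorem avg_gap_le : s * ∑ A, α A * overlapDefect α A +
    ∑ A, α A * sqrtGap (#A / ((q : ℝ) / s)) ≤ 1 / (2 * (K : ℝ) ^ 2) := by
  have h1 := avg_overlapDefect_add_sqrtGap_le h.toIsWeight (by have := h.two_le; omega) h.q_pos
    h.self.le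
  have h2 := h.log_ratio_le
  have h3 := h.obj
  linarith

theorem card_real_pos {A : Finset (Fin q)} (hA : 0 < α A) : (0 : ℝ) < #A := by
  exact_mod_cast h.card_pos hA

theorem avg_gap_nonneg : 0 ≤ ∑ A, α A * sqrtGap (#A / ((q : ℝ) / s)) :=
  h.avg_nonneg fun _ hA => sqrtGap_nonneg (div_pos (h.card_real_pos hA) h.ratio_pos)

theorem avg_defect_nonneg : 0 ≤ ∑ A, α A * overlapDefect α A :=
  h.avg_nonneg fun A _ => overlapDefect_nonneg h.toIsWeight A

theorem avg_sqrtGap_le :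
    ∑ A, α A * sqrtGap (#A / ((q : ℝ) / s)) ≤ 1 / (2 * (K : ℝ) ^ 2) := by
  have h1 := h.avg_gap_le
  have h2 := mul_nonneg h.s_pos.le h.avg_defect_nonneg
  linarith

theorem avg_defect_le : s * ∑ A, α A * overlapDefect α A ≤ 1 / (2 * (K : ℝ) ^ 2) := by
  have h1 := h.avg_gap_le
  have h2 := h.avg_gap_nonneg
  linarith

theorem logMean_le : logMean α ≤ Real.log ((q : ℝ) / s) := by
  have h1 := avg_overlapDefect_add_sqrtGap_le h.toIsWeight (by have := h.two_le; omega) h.q_pos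
    h.self.le
  have h2 := mul_nonneg h.s_pos.le h.avg_defect_nonneg
  have h3 := h.avg_gap_nonneg
  linarith

theorem le_logMean : Real.log ((q : ℝ) / s) - 1 / (2 * (K : ℝ) ^ 2) ≤ logMean α := by
  have := h.log_ratio_le
  have := h.obj
  linarith

theorem log_le_logMean : Real.log K ≤ logMean α := h.log_le_balancedLog.trans h.obj

theorem ne_empty {A : Finset (Fin q)} (hA : 0 < α A) : A ≠ ∅ := by
  rintro rfl
  rw [h.empty] at hA
  exact lt_irrefl _ hA

theorem eq_of_pos {A : Finset (Fin q)} (hA : 0 < α A) :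
    s * meetWeight α A = 1 + η * (Real.log (#A : ℝ) - logMean α) := by
  have h1 : ∑ A, α A * ((s * meetWeight α A - 1) - η * (Real.log (#A : ℝ) - logMean α)) = 0 := by
    have : ∀ A, α A * ((s * meetWeight α A - 1) - η * (Real.log (#A : ℝ) - logMean α)) =
        s * (α A * meetWeight α A) - α A * 1 - η * (α A * Real.log (#A : ℝ)) +
          η * (α A * logMean α) := fun A => by ring
    simp_rw [this]
    rw [sum_add_distrib, sum_sub_distrib, sum_sub_distrib, ← mul_sum, ← mul_sum, ← mul_sum,
      h.avg_const, h.avg_const, h.self, ← logMean]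
    have := h.s_pos
    field_simp
    ring
  have h2 : ∀ A ∈ (univ : Finset (Finset (Fin q))),
      0 ≤ α A * ((s * meetWeight α A - 1) - η * (Real.log (#A : ℝ) - logMean α)) := by
    intro B _
    rcases (h.nonneg B).eq_or_lt with h0 | h0
    · simp [← h0]
    · exact mul_nonneg h0.le (sub_nonneg.2 (h.cond B (h.ne_empty h0)))
  have h3 := (sum_eq_zero_iff_of_nonneg h2).1 h1 A (mem_univ A)
  rcases mul_eq_zero.1 h3 with h4 | h4
  · exact absurd h4 hA.ne'
  · linarith

theorem mass_far_le : ∑ A with (¬ (0.9 * ((q : ℝ) / s) < #A ∧ (#A : ℝ) < 1.09 * ((q : ℝ) / s))), α A ≤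
    1000 * (1 / (2 * (K : ℝ) ^ 2)) := by
  have h1 := h.markov (f := fun A => sqrtGap (#A / ((q : ℝ) / s)))
    (fun _ hA => sqrtGap_nonneg (div_pos (h.card_real_pos hA) h.ratio_pos))
    (fun A => ¬ (0.9 * ((q : ℝ) / s) < #A ∧ (#A : ℝ) < 1.09 * ((q : ℝ) / s))) (1 / 1000)
    (fun A hA hfar => by
      apply sqrtGap_ge_of_far (div_pos (h.card_real_pos hA) h.ratio_pos)
      rw [not_and_or, not_lt, not_lt] at hfar
      rw [div_le_iff₀ h.ratio_pos, le_div_iff₀ h.ratio_pos]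
      exact hfar)
  have h2 := h.avg_sqrtGap_le
  linarith

theorem mass_le_of_far (P : Finset (Fin q) → Prop) [DecidablePred P]
    (hP : ∀ A, P A → ¬ (0.9 * ((q : ℝ) / s) < #A ∧ (#A : ℝ) < 1.09 * ((q : ℝ) / s))) :
    ∑ A with P A, α A ≤ 1000 * (1 / (2 * (K : ℝ) ^ 2)) := by
  refine le_trans ?_ h.mass_far_le
  refine sum_le_sum_of_subset_of_nonneg ?_ fun A _ _ => h.nonneg A
  intro A hA
  simp only [mem_filter, mem_univ, true_and] at hA ⊢
  exact hP A hA

theorem meetWeight_union_le (A B : Finset (Fin q)) :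
    meetWeight α (A ∪ B) ≤ meetWeight α A + meetWeight α B := by
  rw [meetWeight, meetWeight, meetWeight, ← sum_add_distrib]
  refine sum_le_sum fun C _ => ?_
  rw [← mul_add]
  refine mul_le_mul_of_nonneg_left ?_ (h.nonneg C)
  have h1 := hit_nonneg A C
  have h2 := hit_nonneg B C
  by_cases hA : Disjoint A C
  · by_cases hB : Disjoint B C
    · rw [hit_eq_zero (disjoint_union_left.2 ⟨hA, hB⟩)]; linarith
    · rw [hit_eq_one_of_not_disjoint hB]
      linarith [hit_le_one (A ∪ B) C]
  · rw [hit_eq_one_of_not_disjoint hA]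
    linarith [hit_le_one (A ∪ B) C]

theorem exists_disjoint_pair : ∃ A B, 0 < α A ∧ 0 < α B ∧ Disjoint A B ∧
    (#A : ℝ) < 1.09 * ((q : ℝ) / s) ∧ (#B : ℝ) < 1.09 * ((q : ℝ) / s) := by
  by_contra hc
  push Not at hc
  set P : Finset (Fin q) → Prop :=
    fun A => 0.9 * ((q : ℝ) / s) < #A ∧ (#A : ℝ) < 1.09 * ((q : ℝ) / s)
  have h1 := h.mass_far_le
  have h2 := h.eps_le
  have h3 : ∑ A with P A, α A + ∑ A with ¬ P A, α A = 1 := by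
    rw [sum_filter_add_sum_filter_not, h.sum_eq]
  have h4 : 0.9 ≤ ∑ A with P A, α A := by
    norm_num at h2
    have : ∑ A with ¬ P A, α A ≤ 1000 * (1 / (2 * (K : ℝ) ^ 2)) := h1
    norm_num at this ⊢
    linarith
  have h5 : ∀ A, 0 < α A → (if P A then (0.9 : ℝ) else 0) ≤ meetWeight α A := by
    intro A hA
    split_ifs with hPA
    · refine h4.trans ?_
      rw [meetWeight, sum_filter]
      refine sum_le_sum fun B _ => ?_
      split_ifs with hPB
      · rcases (h.nonneg B).eq_or_lt with h0 | h0
        · simp [← h0]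
        · rw [hit_eq_one_of_not_disjoint, mul_one]
          intro hd
          have := hc A B hA h0 hd hPA.2
          linarith [hPB.2]
      · exact mul_nonneg (h.nonneg B) (hit_nonneg _ _)
    · exact sum_nonneg fun B _ => mul_nonneg (h.nonneg B) (hit_nonneg _ _)
  have h6 := h.avg_le h5
  rw [h.self] at h6
  have h7 : ∑ A, α A * (if P A then (0.9 : ℝ) else 0) = (∑ A with P A, α A) * 0.9 := by
    rw [sum_mul, sum_filter]
    exact sum_congr rfl fun A _ => by split_ifs <;> simp
  rw [h7] at h6
  have h8 : (1 : ℝ) / s ≤ 1 / 2 := by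
    have : (2 : ℝ) ≤ s := by exact_mod_cast h.two_le
    gcongr
  linarith

theorem mult_le_two : η ≤ 2 := by
  obtain ⟨A, B, hA, hB, hd, ha, hb⟩ := h.exists_disjoint_pair
  have hU : A ∪ B ≠ ∅ := by
    rw [← Finset.nonempty_iff_ne_empty]
    exact (Finset.nonempty_iff_ne_empty.2 (h.ne_empty hA)).mono subset_union_left
  have h1 := h.cond (A ∪ B) hU
  have h2 := mul_le_mul_of_nonneg_left (h.meetWeight_union_le A B) h.s_pos.le
  rw [mul_add, h.eq_of_pos hA, h.eq_of_pos hB, ] at h2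
  rw [card_union_of_disjoint hd] at h1
  have h3 : η * (Real.log ((#A + #B : ℕ) : ℝ) + logMean α - Real.log #A - Real.log #B) ≤ 1 := by
    linarith
  have hk := h.ratio_pos
  have hA' := h.card_real_pos hA
  have hB' := h.card_real_pos hB
  have h4 : Real.log (2 / 1.09 / ((q : ℝ) / s)) ≤
      Real.log ((#A + #B : ℕ) : ℝ) - Real.log #A - Real.log #B := by
    rw [← Real.log_div (by push_cast; positivity) (by positivity),
      ← Real.log_div (by push_cast; positivity) (by positivity)]
    apply Real.log_le_log (by positivity)
    push_cast
    rw [div_div, div_div, div_le_div_iff₀ (by positivity) (by positivity)]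
    have := mul_le_mul_of_nonneg_left ha.le hB'.le
    have := mul_le_mul_of_nonneg_left hb.le hA'.le
    nlinarith
  rw [Real.log_div (by norm_num) hk.ne'] at h4
  have h5 := h.le_logMean
  have h6 := h.eps_le
  have h7 : (0.58 : ℝ) ≤ Real.log (2 / 1.09) := by
    have := Real.le_log_one_add_of_nonneg (x := 2 / 1.09 - 1) (by norm_num)
    norm_num at this ⊢
    linarith
  have h8 : 0.5 ≤ Real.log ((#A + #B : ℕ) : ℝ) + logMean α - Real.log #A - Real.log #B := by
    linarith
  have := mul_le_mul_of_nonneg_left h8 h.mult_nonneg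
  linarith

theorem card_le_mul_meetWeight (A : Finset (Fin q)) :
    ∑ i ∈ A, colorWeight α i ≤ #A * meetWeight α A := by
  rw [sum_mem_colorWeight, meetWeight, mul_sum]
  refine sum_le_sum fun B _ => ?_
  have h1 : (#(A ∩ B) : ℝ) ≤ #A * hit A B := by
    rcases A.eq_empty_or_nonempty with rfl | hne
    · simp
    · have h2 := inter_card_div_le_hit A B
      have h3 : (0 : ℝ) < #A := by exact_mod_cast Finset.card_pos.2 hne
      rw [div_le_iff₀ h3] at h2
      linarith
  have := mul_le_mul_of_nonneg_left h1 (h.nonneg B)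
  linarith

end Critical

/-- The excess of intersection weight over color weight, collected at a color, over sets that
are not too large. -/
noncomputable def colorExcess (s : ℕ) (α : Finset (Fin q) → ℝ) (i : Fin q) : ℝ :=
  ∑ A, if i ∈ A ∧ (#A : ℝ) ≤ 3 * ((q : ℝ) / s) then
    α A * (s * meetWeight α A - s * colorWeight α i) else 0

theorem colorWeight_le_meetWeight (h : IsWeight α) {A : Finset (Fin q)} {i : Fin q}
    (hi : i ∈ A) : colorWeight α i ≤ meetWeight α A := by
  rw [colorWeight, meetWeight]
  refine sum_le_sum fun B _ => ?_
  split_ifs with hB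
  · rw [hit_eq_one hi hB, mul_one]
  · exact mul_nonneg (h.nonneg B) (hit_nonneg _ _)

namespace Critical

variable (h : Critical q s K α η)
include h

theorem colorExcess_nonneg (i : Fin q) : 0 ≤ colorExcess s α i := by
  refine sum_nonneg fun A _ => ?_
  split_ifs with hA
  · have := mul_le_mul_of_nonneg_left (colorWeight_le_meetWeight h.toIsWeight hA.1) h.s_pos.le
    exact mul_nonneg (h.nonneg A) (sub_nonneg.2 this)
  · exact le_rfl

omit h in
theorem sum_colorExcess : ∑ i, colorExcess s α i =
    ∑ A, α A * (if (#A : ℝ) ≤ 3 * ((q : ℝ) / s) then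
      #A * (s * meetWeight α A - 1) - ∑ i ∈ A, (s * colorWeight α i - 1) else 0) := by
  simp only [colorExcess]
  rw [sum_comm]
  refine sum_congr rfl fun A _ => ?_
  by_cases hA : (#A : ℝ) ≤ 3 * ((q : ℝ) / s)
  · simp only [hA, and_true, if_true]
    rw [← sum_filter, filter_mem_eq_inter, univ_inter, ← mul_sum, sum_sub_distrib,
      sum_sub_distrib, sum_const, sum_const, nsmul_eq_mul, nsmul_eq_mul]
    ring
  · simp [hA]

theorem chord_avg_le :
    K * ∑ A, α A * (Real.log K + Real.log (1 + 1 / (K : ℝ)) * (#A - K) - Real.log (#A : ℝ)) ≤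
      ∑ A, α A * #A - (q : ℝ) / s := by
  set ℓ := Real.log (1 + 1 / (K : ℝ)) with hℓ
  set S := ∑ A, α A * (Real.log K + ℓ * (#A - K) - Real.log (#A : ℝ)) with hS
  have h1 : S = Real.log K + ℓ * (∑ A, α A * #A - K) - logMean α := by
    have : ∀ A, α A * (Real.log K + ℓ * (#A - K) - Real.log (#A : ℝ)) =
      α A * (Real.log K - ℓ * K) + ℓ * (α A * #A) - α A * Real.log (#A : ℝ) := fun A => by ring
    rw [hS]
    simp_rw [this]
    rw [sum_sub_distrib, sum_add_distrib, ← mul_sum, h.avg_const, logMean]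
    ring
  have h2 : 0 ≤ S := h.avg_nonneg fun A hA => by
    have := log_le_chord (K := K) (by exact_mod_cast h.one_le_K) (h.card_pos hA)
    linarith
  have h3 := h.obj
  rw [balancedLog, ← hℓ] at h3
  have h4 : S ≤ ℓ * (∑ A, α A * #A - (q : ℝ) / s) := by rw [h1]; nlinarith
  have h5 : ℓ ≤ 1 / K := (log_one_add_inv_bounds h.one_le_K).2
  have h6 : 0 < ℓ := by
    apply Real.log_pos
    have := h.K_pos
    have : 0 < 1 / (K : ℝ) := by positivity
    linarith
  have h7 : 0 ≤ ∑ A, α A * #A - (q : ℝ) / s := by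
    by_contra hc
    push Not at hc
    have := mul_neg_of_pos_of_neg h6 hc
    linarith
  have h8 := mul_le_mul_of_nonneg_right h5 h7
  have h9 := mul_le_mul_of_nonneg_left (h4.trans h8) h.K_pos.le
  have h10 : (K : ℝ) * (1 / K * (∑ A, α A * #A - (q : ℝ) / s)) = ∑ A, α A * #A - (q : ℝ) / s := by
    have := h.K_pos
    field_simp
  linarith

theorem deviation_le : (∑ i, (s * colorWeight α i - 1) ^ 2) / (2 * s) + ∑ i, colorExcess s α i ≤
    6.1 * η / K := by
  have hs := h.s_pos
  have hk := h.ratio_pos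
  have hK := h.K_pos
  have hD := h.eps_pos
  set k := (q : ℝ) / s with hkdef
  set D := 1 / (2 * (K : ℝ) ^ 2) with hDdef
  set Q := ∑ i, (s * colorWeight α i - 1) ^ 2 with hQ
  set Ξ : Finset (Fin q) → ℝ := fun A => ∑ i ∈ A, (s * colorWeight α i - 1) with hΞ
  set ψ : Finset (Fin q) → ℝ :=
    fun A => Real.log K + Real.log (1 + 1 / (K : ℝ)) * (#A - K) - Real.log (#A : ℝ) with hψ
  have hQ0 : 0 ≤ Q := sum_nonneg fun i _ => sq_nonneg _
  have e1 : ∑ A, α A * Ξ A = ∑ A, α A * #A - k + Q / s := by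
    rw [hΞ, ← sum_colorWeight_mul_fun, ← sum_colorWeight, hkdef, hQ, sum_div]
    have : (q : ℝ) / s = ∑ i : Fin q, 1 / (s : ℝ) := by
      rw [sum_const, card_univ, Fintype.card_fin, nsmul_eq_mul]; ring
    rw [this, ← sum_sub_distrib, ← sum_add_distrib]
    refine sum_congr rfl fun i _ => ?_
    field_simp
    ring
  have e2 : ∑ A, α A * (Ξ A - k * (s * meetWeight α A - 1)) = ∑ A, α A * Ξ A := by
    have : ∀ A, α A * (Ξ A - k * (s * meetWeight α A - 1)) =
      α A * Ξ A - k * s * (α A * meetWeight α A) + α A * k := fun A => by ring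
    simp_rw [this]
    rw [sum_add_distrib, sum_sub_distrib, ← mul_sum, h.avg_const, h.self]
    field_simp
    ring
  have pt : ∀ A, 0 < α A → Ξ A - k * (s * meetWeight α A - 1) ≤
      η * (10 * k * sqrtGap (#A / k) + 2 * k * D) + K * ψ A +
      (Q / (2 * s * (1000 * D)) * (if 3 * k < (#A : ℝ) then 1 else 0) -
      (if (#A : ℝ) ≤ 3 * k then #A * (s * meetWeight α A - 1) - Ξ A else 0)) := by
    intro A hA
    have ha := h.card_real_pos hA
    have hgap : 0 ≤ sqrtGap (#A / k) := sqrtGap_nonneg (div_pos ha hk)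
    have hψ0 : 0 ≤ ψ A := by
      have := log_le_chord (K := K) (by exact_mod_cast h.one_le_K) (h.card_pos hA)
      simp only [hψ]; linarith
    have hd : Ξ A ≤ #A * (s * meetWeight α A - 1) := by
      have h1 := mul_le_mul_of_nonneg_left (h.card_le_mul_meetWeight A) hs.le
      simp only [hΞ]
      rw [sum_sub_distrib, ← mul_sum, sum_const, nsmul_eq_mul]
      linarith
    by_cases hN : (#A : ℝ) ≤ 3 * k
    · rw [if_pos hN, if_neg (not_lt.2 hN)]
      rw [h.eq_of_pos hA]
      have h1 : (#A - k) * (Real.log #A - logMean α) ≤ 10 * k * sqrtGap (#A / k) + 2 * k * D := by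
        have h2 := sub_one_mul_log_le (div_pos ha hk) (by rwa [div_le_iff₀ hk])
        rw [Real.log_div ha.ne' hk.ne'] at h2
        have h3 : (#A - k) * (Real.log #A - Real.log k) ≤ 10 * k * sqrtGap (#A / k) := by
          have h4 := mul_le_mul_of_nonneg_left h2 hk.le
          have h5 : k * ((#A / k - 1) * (Real.log #A - Real.log k)) =
              (#A - k) * (Real.log #A - Real.log k) := by field_simp
          linarith
        have h4 := h.logMean_le
        have h5 := h.le_logMean
        have h6 : (#A - k) * (Real.log k - logMean α) ≤ 2 * k * D := by
          have h7 : 0 ≤ Real.log k - logMean α := by linarith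
          have h8 : Real.log k - logMean α ≤ D := by linarith
          calc (#A - k) * (Real.log k - logMean α) ≤ (2 * k) * (Real.log k - logMean α) :=
                mul_le_mul_of_nonneg_right (by linarith) h7
            _ ≤ _ := mul_le_mul_of_nonneg_left h8 (by positivity)
        nlinarith
      have h9 := mul_le_mul_of_nonneg_left h1 h.mult_nonneg
      have h10 := mul_nonneg hK.le hψ0
      linarith
    · rw [if_neg hN, if_pos (not_le.1 hN)]
      push Not at hN
      have h1 : Ξ A - k * (s * meetWeight α A - 1) ≤ √(#A * Q) := by
        have h2 : Ξ A ≤ √(#A * Q) := by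
          apply Real.le_sqrt_of_sq_le
          calc Ξ A ^ 2 ≤ #A * ∑ i ∈ A, (s * colorWeight α i - 1) ^ 2 := sq_sum_le_card_mul_sum_sq
            _ ≤ #A * Q := by
              apply mul_le_mul_of_nonneg_left _ ha.le
              exact sum_le_sum_of_subset_of_nonneg (subset_univ _) fun _ _ _ => sq_nonneg _
        rcases le_total 0 (s * meetWeight α A - 1) with h3 | h3
        · nlinarith
        · have h4 : Ξ A - k * (s * meetWeight α A - 1) ≤ 0 := by nlinarith
          exact h4.trans (Real.sqrt_nonneg _)
      have h2 : √(#A * Q) ≤ Q / (2 * s * (1000 * D)) + s * (1000 * D) / 2 * #A := by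
        apply Real.sqrt_le_iff.2
        refine ⟨by positivity, ?_⟩
        have h3 : #A * Q = 4 * (Q / (2 * s * (1000 * D))) * (s * (1000 * D) / 2 * #A) := by
          field_simp
          norm_num
        rw [h3]
        nlinarith [sq_nonneg (Q / (2 * s * (1000 * D)) - s * (1000 * D) / 2 * #A)]
      have h3 : s * (1000 * D) / 2 * #A ≤ K * ψ A := by
        have h4 := log_add_linear_le_chord (K := K) (by have := h.K_ge; linarith)
          (a := #A) (by have := h.K_le_ratio; linarith)
        have h5 : 0.07 * (#A / K) ≤ ψ A := by simp only [hψ]; linarith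
        have h6 := mul_le_mul_of_nonneg_left h5 hK.le
        have h7 : (K : ℝ) * (0.07 * (#A / K)) = 0.07 * #A := by field_simp
        have h8 := h.s_mul_eps_le
        have h9 : s * (1000 * D) / 2 ≤ 0.07 := by
          rw [← hDdef] at h8
          linarith
        have h10 := mul_le_mul_of_nonneg_right h9 ha.le
        linarith
      have h4 : 0 ≤ η * (10 * k * sqrtGap (#A / k) + 2 * k * D) :=
        mul_nonneg h.mult_nonneg (by positivity)
      linarith
  have h1 := h.avg_le pt
  rw [e2, e1] at h1
  have e3 : ∑ A, α A * (η * (10 * k * sqrtGap (#A / k) + 2 * k * D) + K * ψ A +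
      (Q / (2 * s * (1000 * D)) * (if 3 * k < (#A : ℝ) then 1 else 0) -
      (if (#A : ℝ) ≤ 3 * k then #A * (s * meetWeight α A - 1) - Ξ A else 0))) =
      η * (10 * k * (∑ A, α A * sqrtGap (#A / k)) + 2 * k * D) + K * ∑ A, α A * ψ A +
      (Q / (2 * s * (1000 * D)) * (∑ A with 3 * k < (#A : ℝ), α A) - ∑ i, colorExcess s α i) := by
    rw [sum_colorExcess]
    have : ∀ A, α A * (η * (10 * k * sqrtGap (#A / k) + 2 * k * D) + K * ψ A +
      (Q / (2 * s * (1000 * D)) * (if 3 * k < (#A : ℝ) then 1 else 0) -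
      (if (#A : ℝ) ≤ 3 * k then #A * (s * meetWeight α A - 1) - Ξ A else 0))) =
      η * (10 * k) * (α A * sqrtGap (#A / k)) + α A * (η * (2 * k * D)) + K * (α A * ψ A) +
      (Q / (2 * s * (1000 * D)) * (if 3 * k < (#A : ℝ) then α A else 0) -
      α A * (if (#A : ℝ) ≤ 3 * k then #A * (s * meetWeight α A - 1) - Ξ A else 0)) := fun A => by
        split_ifs <;> ring
    simp_rw [this]
    rw [sum_add_distrib, sum_add_distrib, sum_add_distrib, sum_sub_distrib, ← mul_sum, ← mul_sum,
      ← mul_sum, h.avg_const, sum_filter]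
    ring
  rw [e3] at h1
  have h2 := h.chord_avg_le
  have h3 : Q / (2 * s * (1000 * D)) * (∑ A with 3 * k < (#A : ℝ), α A) ≤ Q / (2 * s) := by
    have h4 := h.mass_le_of_far (fun A => 3 * k < (#A : ℝ)) (fun A hA hc => by
      have := hc.2
      norm_num at this
      linarith)
    have h5 := mul_le_mul_of_nonneg_left h4 (by positivity : 0 ≤ Q / (2 * s * (1000 * D)))
    have h6 : Q / (2 * s * (1000 * D)) * (1000 * D) = Q / (2 * s) := by field_simp
    linarith
  have h4 : η * (10 * k * (∑ A, α A * sqrtGap (#A / k)) + 2 * k * D) ≤ 6.1 * η / K := by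
    have h5 := h.avg_sqrtGap_le
    rw [← hkdef, ← hDdef] at h5
    have h6 : 10 * k * (∑ A, α A * sqrtGap (#A / k)) + 2 * k * D ≤ 12 * k * D := by
      have := mul_le_mul_of_nonneg_left h5 (by positivity : 0 ≤ 10 * k)
      linarith
    have h7 : 12 * k * D ≤ 6.1 / K := by
      have h8 := h.ratio_le
      have e : 12 * k * D = 6 * k / K ^ 2 := by rw [hDdef]; field_simp; norm_num
      rw [e, div_le_div_iff₀ (by positivity) hK]
      nlinarith
    have h8 := mul_le_mul_of_nonneg_left (h6.trans h7) h.mult_nonneg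
    have h9 : η * (6.1 / K) = 6.1 * η / K := by ring
    linarith
  have h5 : Q / s = Q / (2 * s) + Q / (2 * s) := by field_simp; norm_num
  have h2' : K * ∑ A, α A * ψ A ≤ ∑ A, α A * #A - k := h2
  linarith

end Critical

end Critical

section Colors

variable {q s K : ℕ} {α : Finset (Fin q) → ℝ} {η : ℝ}

/-- Weight of the sets containing both colors. -/
noncomputable def pairWeight (α : Finset (Fin q) → ℝ) (i j : Fin q) : ℝ :=
  ∑ A, if i ∈ A ∧ j ∈ A then α A else 0

theorem pairWeight_self (i : Fin q) : pairWeight α i i = colorWeight α i := by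
  simp [pairWeight, colorWeight]

theorem pairWeight_comm (i j : Fin q) : pairWeight α i j = pairWeight α j i := by
  simp only [pairWeight, and_comm]

theorem pairWeight_le (h : IsWeight α) (i j : Fin q) : pairWeight α i j ≤ colorWeight α j := by
  refine sum_le_sum fun A _ => ?_
  have := h.nonneg A
  split_ifs <;> first | linarith | (exfalso; tauto)

theorem add_sub_pairWeight_le_meetWeight (h : IsWeight α) {A : Finset (Fin q)} {i j : Fin q}
    (hi : i ∈ A) (hj : j ∈ A) :
    colorWeight α i + colorWeight α j - pairWeight α i j ≤ meetWeight α A := by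
  rw [colorWeight, colorWeight, pairWeight, meetWeight, ← sum_add_distrib, ← sum_sub_distrib]
  refine sum_le_sum fun B _ => ?_
  have h0 := h.nonneg B
  by_cases h1 : i ∈ B
  · rw [hit_eq_one hi h1]
    by_cases h2 : j ∈ B <;> simp [h1, h2]
  · by_cases h2 : j ∈ B
    · rw [hit_eq_one hj h2]; simp [h1, h2]
    · simpa [h1, h2] using mul_nonneg h0 (hit_nonneg A B)

theorem pairWeight_triangle (h : IsWeight α) (i j r t : Fin q) :
    pairWeight α i j ≤ pairWeight α r t + (colorWeight α i - pairWeight α i r) +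
      (colorWeight α j - pairWeight α j t) := by
  simp only [colorWeight, pairWeight]
  rw [← sum_sub_distrib, ← sum_sub_distrib, ← sum_add_distrib, ← sum_add_distrib]
  refine sum_le_sum fun B _ => ?_
  have h0 := h.nonneg B
  by_cases h1 : i ∈ B <;> by_cases h2 : j ∈ B <;> by_cases h3 : r ∈ B <;> by_cases h4 : t ∈ B <;>
    simp [h1, h2, h3, h4, h0]

/-- Colors of nearly typical weight and small excess. -/
def GoodColor (s : ℕ) (α : Finset (Fin q) → ℝ) (i : Fin q) : Prop :=
  |s * colorWeight α i - 1| ≤ 0.01 ∧ s * colorExcess s α i ≤ 0.01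

namespace Critical

variable (h : Critical q s K α η)
include h

theorem colorExcess_ge (i : Fin q) (P : Finset (Fin q) → Prop) [DecidablePred P] {c : ℝ}
    (hc : 0 ≤ c) (hP : ∀ B, 0 < α B → i ∈ B → P B → 0.9 * ((q : ℝ) / s) < #B →
      c ≤ s * meetWeight α B - s * colorWeight α i) :
    c * ((∑ B with i ∈ B ∧ P B, α B) - 1000 * (1 / (2 * (K : ℝ) ^ 2))) ≤ colorExcess s α i := by
  set near : Finset (Fin q) → Prop :=
    fun A => 0.9 * ((q : ℝ) / s) < #A ∧ (#A : ℝ) < 1.09 * ((q : ℝ) / s)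
  have h1 : (∑ B with i ∈ B ∧ P B, α B) - 1000 * (1 / (2 * (K : ℝ) ^ 2)) ≤
      ∑ B with (i ∈ B ∧ P B) ∧ near B, α B := by
    have h2 := h.mass_far_le
    have h3 : (∑ B with i ∈ B ∧ P B, α B) ≤
        ∑ B with (i ∈ B ∧ P B) ∧ near B, α B + ∑ B with ¬ near B, α B := by
      rw [sum_filter, sum_filter, sum_filter, ← sum_add_distrib]
      refine sum_le_sum fun B _ => ?_
      have := h.nonneg B
      by_cases h4 : i ∈ B ∧ P B <;> by_cases h5 : near B <;> simp [h4, h5, this]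
    have h2' : ∑ B with ¬ near B, α B ≤ 1000 * (1 / (2 * (K : ℝ) ^ 2)) := h2
    linarith
  refine (mul_le_mul_of_nonneg_left h1 hc).trans ?_
  rw [sum_filter, mul_sum, colorExcess]
  refine sum_le_sum fun B _ => ?_
  have h0 := h.nonneg B
  have hsub : i ∈ B → 0 ≤ α B * (s * meetWeight α B - s * colorWeight α i) := fun hi =>
    mul_nonneg h0 (sub_nonneg.2 (mul_le_mul_of_nonneg_left
      (colorWeight_le_meetWeight h.toIsWeight hi) h.s_pos.le))
  by_cases h2 : (i ∈ B ∧ P B) ∧ near B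
  · have h3 : i ∈ B ∧ (#B : ℝ) ≤ 3 * ((q : ℝ) / s) := by
      refine ⟨h2.1.1, ?_⟩
      have := h2.2.2
      have := h.ratio_pos
      linarith
    rw [if_pos h2, if_pos h3]
    rcases h0.eq_or_lt with h4 | h4
    · simp [← h4]
    · rw [mul_comm]
      exact mul_le_mul_of_nonneg_left (hP B h4 h2.1.1 h2.1.2 h2.2.1) h0
  · rw [if_neg h2, mul_zero]
    split_ifs with h3
    · exact hsub h3.1
    · exact le_rfl

theorem mass_error_le : (s : ℝ) * (1000 * (1 / (2 * (K : ℝ) ^ 2))) ≤ 0.001 := by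
  have := h.s_mul_eps_le
  linarith

omit h in
theorem sum_colorWeight_eq (i : Fin q) : (∑ B with i ∈ B ∧ True, α B) = colorWeight α i := by
  simp [colorWeight, sum_filter]

theorem sq_deviation_le (i : Fin q) :
    (s * colorWeight α i - 1) ^ 2 / (2 * s) + colorExcess s α i ≤ 6.1 * η / K := by
  refine le_trans ?_ h.deviation_le
  have hs := h.s_pos
  gcongr
  · exact single_le_sum (f := fun j => (s * colorWeight α j - 1) ^ 2)
      (fun j _ => sq_nonneg _) (mem_univ i)
  · exact single_le_sum (f := fun j => colorExcess s α j)
      (fun j _ => h.colorExcess_nonneg j) (mem_univ i)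

theorem sqrt_le_card (hη : 0 < η) {A : Finset (Fin q)} (hA : 0 < α A) : √(K : ℝ) ≤ #A := by
  by_contra hc
  push Not at hc
  have hs := h.s_pos
  have hK := h.K_pos
  have ha := h.card_real_pos hA
  have hlogK := h.log_large
  have h1 : Real.log #A ≤ Real.log K / 2 := by
    rw [← Real.log_sqrt hK.le]
    exact Real.log_le_log ha hc.le
  obtain ⟨i, hi⟩ := Finset.card_pos.1 (h.card_pos hA)
  have h2 := mul_le_mul_of_nonneg_left (colorWeight_le_meetWeight h.toIsWeight hi) hs.le
  rw [h.eq_of_pos hA] at h2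
  have h3 := h.log_le_logMean
  set p := 1 - s * colorWeight α i with hp
  have hp1 : p ≤ 1 := by
    have := mul_nonneg hs.le (colorWeight_nonneg h.toIsWeight i)
    linarith
  have hp2 : η * (Real.log K / 2) ≤ p := by
    have : η * (Real.log K / 2) ≤ η * (logMean α - Real.log #A) :=
      mul_le_mul_of_nonneg_left (by linarith) hη.le
    linarith
  have hp0 : 23 * η ≤ p := by nlinarith
  have h4 := h.colorExcess_ge i (fun _ => True) (c := 0.9 * p) (by linarith) (by
    intro B hB hiB _ hnear
    rw [h.eq_of_pos hB]
    have h5 : Real.log ((q : ℝ) / s) - 0.12 ≤ Real.log #B := by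
      have h6 : Real.log (0.9 * ((q : ℝ) / s)) ≤ Real.log #B :=
        Real.log_le_log (mul_pos (by norm_num) h.ratio_pos) hnear.le
      rw [Real.log_mul (by norm_num) h.ratio_pos.ne'] at h6
      have h7 := Real.one_sub_inv_le_log_of_pos (x := 0.9) (by norm_num)
      norm_num at h7 h6 ⊢
      linarith
    have h8 := h.logMean_le
    have h9 : η * (-0.12) ≤ η * (Real.log #B - logMean α) :=
      mul_le_mul_of_nonneg_left (by linarith) hη.le
    linarith)
  rw [sum_colorWeight_eq] at h4
  have h5 := h.sq_deviation_le i
  have h6 := h.mass_error_le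
  have h7 := mul_le_mul_of_nonneg_left h5 hs.le
  have h8 := mul_le_mul_of_nonneg_left h4 hs.le
  have e1 : (s : ℝ) * ((s * colorWeight α i - 1) ^ 2 / (2 * s) + colorExcess s α i) =
      p ^ 2 / 2 + s * colorExcess s α i := by
    rw [hp]; field_simp; ring
  have e2 : (s : ℝ) * (0.9 * p * (colorWeight α i - 1000 * (1 / (2 * (K : ℝ) ^ 2)))) =
      0.9 * p * ((1 - p) - s * (1000 * (1 / (2 * (K : ℝ) ^ 2)))) := by
    rw [hp]; ring
  rw [e1] at h7
  rw [e2] at h8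
  have h9 : 0.9 * p * ((1 - p) - 0.001) ≤
      0.9 * p * ((1 - p) - s * (1000 * (1 / (2 * (K : ℝ) ^ 2)))) :=
    mul_le_mul_of_nonneg_left (by linarith) (by linarith)
  have h10 : 0.4 * p ≤ s * (6.1 * η / K) := by nlinarith
  have h11 : s * (6.1 * η / K) * K = 6.1 * η * s := by field_simp
  have h12 := h.le_log
  have h13 : 0.4 * p * K ≤ 6.1 * η * s := by
    rw [← h11]; exact mul_le_mul_of_nonneg_right h10 hK.le
  have h14 : 0.4 * (η * (Real.log K / 2)) * K ≤ 0.4 * p * K :=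
    mul_le_mul_of_nonneg_right (by linarith) hK.le
  have h15 := mul_le_mul_of_nonneg_left h12 hη.le
  have h16 : 0 < η * K * Real.log K := by positivity
  nlinarith

open Classical in
theorem card_bad_le : (#(univ.filter fun i => ¬ GoodColor s α i) : ℝ) ≤ √(K : ℝ) / 4 := by
  have hs := h.s_pos
  have hK := h.K_pos
  have h1 : (#(univ.filter fun i => ¬ GoodColor s α i) : ℝ) ≤
      ∑ i, (10 ^ 4 * (s * colorWeight α i - 1) ^ 2 + 100 * (s * colorExcess s α i)) := by
    rw [card_eq_sum_ones, sum_filter, Nat.cast_sum]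
    refine sum_le_sum fun i _ => ?_
    have h2 := mul_nonneg hs.le (h.colorExcess_nonneg i)
    by_cases hg : GoodColor s α i
    · rw [if_neg (not_not.2 hg), Nat.cast_zero]
      positivity
    · rw [if_pos hg, Nat.cast_one]
      rw [GoodColor, not_and_or, not_le, not_le] at hg
      rcases hg with hg | hg
      · have : (0.01 : ℝ) ^ 2 ≤ |s * colorWeight α i - 1| ^ 2 :=
          pow_le_pow_left₀ (by norm_num) hg.le 2
        rw [sq_abs] at this
        norm_num at this ⊢
        linarith
      · have := sq_nonneg (s * colorWeight α i - 1)
        norm_num at hg ⊢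
        linarith
  rw [sum_add_distrib, ← mul_sum, ← mul_sum, ← mul_sum] at h1
  have h2 := mul_le_mul_of_nonneg_left h.deviation_le hs.le
  set Q := ∑ i, (s * colorWeight α i - 1) ^ 2
  set T := ∑ i, colorExcess s α i
  have hQ : 0 ≤ Q := sum_nonneg fun i _ => sq_nonneg _
  have hT : 0 ≤ T := sum_nonneg fun i _ => h.colorExcess_nonneg i
  have e : (s : ℝ) * (Q / (2 * s) + T) = Q / 2 + s * T := by field_simp
  rw [e] at h2
  have h3 : 49 * ((s : ℝ) * (6.1 * η / K)) ≤ 12.2 * Real.log K := by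
    have h4 : 49 * ((s : ℝ) * (6.1 * η / K)) = 6.1 * η * (49 * s) / K := by ring
    rw [h4, div_le_iff₀ hK]
    have h5 := h.mult_le_two
    have h6 := h.le_log
    have h7 := h.mult_nonneg
    have h8 : 6.1 * η * (49 * s) ≤ 12.2 * (49 * s) :=
      mul_le_mul_of_nonneg_right (by linarith) (by positivity)
    linarith
  have h4 := h.log_le
  have h5 := mul_nonneg hs.le hT
  norm_num at h1 h4 ⊢
  linarith

open Classical in
theorem card_le_good_add {A : Finset (Fin q)} :
    (#A : ℝ) ≤ #(A.filter (GoodColor s α)) + √(K : ℝ) / 4 := by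
  have h1 := h.card_bad_le
  have h2 : #A ≤ #(A.filter (GoodColor s α)) + #(univ.filter fun i => ¬ GoodColor s α i) := by
    rw [← card_filter_add_card_filter_not (s := A) (GoodColor s α)]
    gcongr
    exact subset_univ A
  have h3 : (#A : ℝ) ≤ #(A.filter (GoodColor s α)) + #(univ.filter fun i => ¬ GoodColor s α i) := by
    exact_mod_cast h2
  linarith

theorem exists_good (hη : 0 < η) {A : Finset (Fin q)} (hA : 0 < α A) :
    ∃ i ∈ A, GoodColor s α i := by
  classical
  have h1 := h.card_le_good_add (A := A)
  have h2 := h.sqrt_le_card hη hA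
  have h3 := h.sqrt_large
  have h4 : (0 : ℝ) < #(A.filter (GoodColor s α)) := by
    have : (0 : ℝ) < 10 ^ 10 := by norm_num
    linarith
  obtain ⟨i, hi⟩ := Finset.card_pos.1 (by exact_mod_cast h4)
  exact ⟨i, (mem_filter.1 hi).1, (mem_filter.1 hi).2⟩

omit h in
theorem _root_.TuranColoring.GoodColor.le {i : Fin q} (hi : GoodColor s α i) :
    s * colorWeight α i ≤ 1.01 := by
  have := (abs_le.1 hi.1).2
  linarith

omit h in
theorem _root_.TuranColoring.GoodColor.ge {i : Fin q} (hi : GoodColor s α i) :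
    0.99 ≤ s * colorWeight α i := by
  have := (abs_le.1 hi.1).1
  linarith

theorem meetWeight_ge (hη : 0 < η) {A : Finset (Fin q)} (hA : 0 < α A) :
    0.99 ≤ s * meetWeight α A := by
  obtain ⟨i, hi, hg⟩ := h.exists_good hη hA
  exact hg.ge.trans (mul_le_mul_of_nonneg_left
    (colorWeight_le_meetWeight h.toIsWeight hi) h.s_pos.le)

theorem pairWeight_dichotomy {i j : Fin q} (hi : GoodColor s α i) (hj : GoodColor s α j) :
    s * pairWeight α i j ≤ 0.03 ∨ 0.95 ≤ s * pairWeight α i j := by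
  by_contra hc
  push Not at hc
  have hs := h.s_pos
  have h1 := h.colorExcess_ge i (fun B => j ∈ B) (c := s * (colorWeight α j - pairWeight α i j))
    (mul_nonneg hs.le (sub_nonneg.2 (pairWeight_le h.toIsWeight i j))) (by
    intro B hB hiB hjB _
    have := mul_le_mul_of_nonneg_left
      (add_sub_pairWeight_le_meetWeight h.toIsWeight hiB hjB) hs.le
    linarith)
  rw [sum_filter, ← pairWeight] at h1
  have h2 := mul_le_mul_of_nonneg_left h1 hs.le
  have h3 := hi.2
  have h4 := hj.ge
  have h5 := h.mass_error_le
  set Y := s * pairWeight α i j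
  have e : (s : ℝ) * (s * (colorWeight α j - pairWeight α i j) *
      (pairWeight α i j - 1000 * (1 / (2 * (K : ℝ) ^ 2)))) =
      (s * colorWeight α j - Y) * (Y - s * (1000 * (1 / (2 * (K : ℝ) ^ 2)))) := by
    simp only [Y]; ring
  rw [e] at h2
  have h6 : (0.99 - Y) * (Y - 0.001) ≤
      (s * colorWeight α j - Y) * (Y - s * (1000 * (1 / (2 * (K : ℝ) ^ 2)))) := by
    apply mul_le_mul <;> linarith
  nlinarith [mul_pos (sub_pos.2 hc.1) (sub_pos.2 hc.2)]

/-- A set of representatives of the color classes. -/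
structure _root_.TuranColoring.Representatives (s : ℕ) (α : Finset (Fin q) → ℝ)
    (R : Finset (Fin q)) : Prop where
  good : ∀ r ∈ R, GoodColor s α r
  sep : ∀ r ∈ R, ∀ t ∈ R, r ≠ t → s * pairWeight α r t ≤ 0.03
  dom : ∀ i, GoodColor s α i → ∃ r ∈ R, 0.95 ≤ s * pairWeight α i r

theorem exists_representatives : ∃ R, Representatives s α R := by
  classical
  set F : Finset (Finset (Fin q)) := univ.filter fun R =>
    (∀ r ∈ R, GoodColor s α r) ∧ ∀ r ∈ R, ∀ t ∈ R, r ≠ t → s * pairWeight α r t ≤ 0.03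
  have hF : F.Nonempty := ⟨∅, by simp [F]⟩
  obtain ⟨R, hR, hmax⟩ := exists_max_image F Finset.card hF
  simp only [F, mem_filter, mem_univ, true_and] at hR hmax
  refine ⟨R, hR.1, hR.2, fun i hi => ?_⟩
  by_contra hc
  push Not at hc
  have hiR : i ∉ R := fun hm => by
    have := hc i hm
    rw [pairWeight_self] at this
    linarith [hi.ge]
  have hlow : ∀ r ∈ R, s * pairWeight α i r ≤ 0.03 := fun r hr =>
    (h.pairWeight_dichotomy hi (hR.1 r hr)).resolve_right (not_le.2 (hc r hr))
  have := hmax (insert i R) (by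
    refine ⟨?_, ?_⟩
    · intro r hr
      rcases mem_insert.1 hr with rfl | hr
      · exact hi
      · exact hR.1 r hr
    · intro r hr t ht hne
      rcases mem_insert.1 hr with hr' | hr' <;> rcases mem_insert.1 ht with ht' | ht'
      · exact absurd (hr'.trans ht'.symm) hne
      · rw [hr']; exact hlow t ht'
      · rw [ht', pairWeight_comm]; exact hlow r hr'
      · exact hR.2 r hr' t ht' hne)
  rw [card_insert_of_notMem hiR] at this
  omega

theorem representative_unique {R : Finset (Fin q)} (hR : Representatives s α R)
    {A : Finset (Fin q)} (hA : s * meetWeight α A < 1.5) {i j r t : Fin q} (hiA : i ∈ A)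
    (hjA : j ∈ A) (hi : GoodColor s α i) (hj : GoodColor s α j) (hr : r ∈ R) (ht : t ∈ R)
    (hir : 0.95 ≤ s * pairWeight α i r) (hjt : 0.95 ≤ s * pairWeight α j t) : r = t := by
  by_contra hne
  have h1 := hR.sep r hr t ht hne
  have hs := h.s_pos.le
  have h2 := mul_le_mul_of_nonneg_left (pairWeight_triangle h.toIsWeight i j r t) hs
  have h3 := mul_le_mul_of_nonneg_left
    (add_sub_pairWeight_le_meetWeight h.toIsWeight hiA hjA) hs
  have := hi.ge
  have := hj.ge
  have := hi.le
  have := hj.le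
  rw [mul_add, mul_add, mul_sub, mul_sub] at h2
  rw [mul_sub, mul_add] at h3
  linarith

theorem sum_pairWeight_le (G : Finset (Fin q)) (r : Fin q) : ∑ i ∈ G, pairWeight α i r ≤
    colorWeight α r * (1.09 * ((q : ℝ) / s)) + #G * (1000 * (1 / (2 * (K : ℝ) ^ 2))) := by
  set near : Finset (Fin q) → Prop :=
    fun A => 0.9 * ((q : ℝ) / s) < #A ∧ (#A : ℝ) < 1.09 * ((q : ℝ) / s)
  have e1 : ∀ i, pairWeight α i r = colorWeight (fun C => if r ∈ C then α C else 0) i := by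
    intro i
    refine sum_congr rfl fun A _ => ?_
    by_cases h1 : i ∈ A <;> by_cases h2 : r ∈ A <;> simp [h1, h2]
  simp_rw [e1]
  rw [sum_mem_colorWeight]
  have h1 : ∑ B, (if r ∈ B then α B else 0) * (#(G ∩ B) : ℝ) ≤
      ∑ B, ((if r ∈ B then α B else 0) * (1.09 * ((q : ℝ) / s)) +
        (if ¬ near B then α B else 0) * #G) := by
    refine sum_le_sum fun B _ => ?_
    have h0 := h.nonneg B
    have hk := h.ratio_pos
    have hG : (#(G ∩ B) : ℝ) ≤ #G := by exact_mod_cast card_le_card inter_subset_left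
    have hB : (#(G ∩ B) : ℝ) ≤ #B := by exact_mod_cast card_le_card inter_subset_right
    by_cases hr : r ∈ B
    · by_cases hn : near B
      · simp only [hr, hn, if_true, not_true, if_false, zero_mul, add_zero]
        exact mul_le_mul_of_nonneg_left (hB.trans hn.2.le) h0
      · simp only [hr, hn, if_true, not_false_eq_true]
        have := mul_le_mul_of_nonneg_left hG h0
        have : 0 ≤ α B * (1.09 * ((q : ℝ) / s)) := by positivity
        linarith
    · simp only [hr, if_false, zero_mul, zero_add]
      split_ifs <;> positivity
  rw [sum_add_distrib, ← sum_mul, ← sum_mul, ← colorWeight, ← sum_filter] at h1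
  have h2 : ∑ B with ¬ near B, α B ≤ 1000 * (1 / (2 * (K : ℝ) ^ 2)) := h.mass_far_le
  have h3 := mul_le_mul_of_nonneg_right h2 (Nat.cast_nonneg #G : (0 : ℝ) ≤ #G)
  linarith

theorem not_disjoint_of_card_le (hη : 0 < η) {r : Fin q} (hr : GoodColor s α r)
    {A B : Finset (Fin q)} (hB : 0 < α B)
    (hAB : ∀ i ∈ A ∪ B, GoodColor s α i → 0.95 ≤ s * pairWeight α i r)
    (hle : #B ≤ #A) : ¬ Disjoint A B := by
  classical
  intro hd
  have hs := h.s_pos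
  have hK := h.K_pos
  have hk := h.ratio_pos
  have hkK := h.K_le_ratio
  set k := (q : ℝ) / s with hkdef
  have hb := h.card_real_pos hB
  have hle' : (#B : ℝ) ≤ #A := by exact_mod_cast hle
  have hsqrt : √(K : ℝ) ≤ 0.01 * k := by
    have h1 : √(K : ℝ) * √(K : ℝ) = K := Real.mul_self_sqrt hK.le
    have h2 := h.sqrt_large
    have h3 : (1000 : ℝ) ≤ √(K : ℝ) := le_trans (by norm_num) h2
    nlinarith
  have hsmall : (#B : ℝ) ≤ 0.595 * k := by
    set G := (A ∪ B).filter (GoodColor s α)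
    have h1 := h.sum_pairWeight_le G r
    have h2 : #G • (0.95 : ℝ) ≤ ∑ i ∈ G, s * pairWeight α i r :=
      card_nsmul_le_sum _ _ _ fun i hi => hAB i (mem_filter.1 hi).1 (mem_filter.1 hi).2
    rw [← mul_sum, nsmul_eq_mul] at h2
    have h3 := mul_le_mul_of_nonneg_left h1 hs.le
    have h4 : (s : ℝ) * (colorWeight α r * (1.09 * k) + #G * (1000 * (1 / (2 * (K : ℝ) ^ 2)))) =
        (s * colorWeight α r) * (1.09 * k) + #G * (s * (1000 * (1 / (2 * (K : ℝ) ^ 2)))) := by ring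
    rw [h4] at h3
    have h5 : (s * colorWeight α r) * (1.09 * k) ≤ 1.01 * (1.09 * k) :=
      mul_le_mul_of_nonneg_right hr.le (by positivity)
    have h6 : (#G : ℝ) * (s * (1000 * (1 / (2 * (K : ℝ) ^ 2)))) ≤ (#G : ℝ) * 0.001 :=
      mul_le_mul_of_nonneg_left h.mass_error_le (Nat.cast_nonneg _)
    have h7 := h.card_le_good_add (A := A ∪ B)
    rw [card_union_of_disjoint hd] at h7
    push_cast at h7
    have h8 : (#A : ℝ) + #B ≤ #G + √(K : ℝ) / 4 := h7
    linarith
  set G := B.filter (GoodColor s α)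
  have hT : ∀ i ∈ G, 0.39 * η ≤ s * colorExcess s α i := by
    intro i hi
    obtain ⟨hiB, hgi⟩ := mem_filter.1 hi
    have h1 := h.colorExcess_ge i (fun _ => True) (c := 0.4 * η) (by positivity) (by
      intro C hC hiC _ hnear
      have h2 := mul_le_mul_of_nonneg_left (colorWeight_le_meetWeight h.toIsWeight hiB) hs.le
      rw [h.eq_of_pos hB] at h2
      rw [h.eq_of_pos hC]
      have h3 : Real.log #B + 0.4 ≤ Real.log #C := by
        have h4 : (0.4 : ℝ) ≤ Real.log (1 + 0.5) := by
          have := Real.le_log_one_add_of_nonneg (x := 0.5) (by norm_num)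
          norm_num at this ⊢
          linarith
        have h5 : Real.log (#B * (1 + 0.5)) ≤ Real.log #C :=
          Real.log_le_log (by positivity) (by linarith)
        rw [Real.log_mul hb.ne' (by norm_num)] at h5
        linarith
      have h6 := mul_le_mul_of_nonneg_left h3 hη.le
      linarith)
    rw [sum_colorWeight_eq] at h1
    have h2 := mul_le_mul_of_nonneg_left h1 hs.le
    have h3 := h.mass_error_le
    have h4 := hgi.ge
    have e : (s : ℝ) * (0.4 * η * (colorWeight α i - 1000 * (1 / (2 * (K : ℝ) ^ 2)))) =
      0.4 * η * (s * colorWeight α i - s * (1000 * (1 / (2 * (K : ℝ) ^ 2)))) := by ring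
    rw [e] at h2
    have h5 : 0.4 * η * 0.98 ≤
        0.4 * η * (s * colorWeight α i - s * (1000 * (1 / (2 * (K : ℝ) ^ 2)))) :=
      mul_le_mul_of_nonneg_left (by linarith) (by positivity)
    linarith
  have h1 : #G • (0.39 * η) ≤ ∑ i ∈ G, s * colorExcess s α i := card_nsmul_le_sum _ _ _ hT
  rw [← mul_sum, nsmul_eq_mul] at h1
  have h2 : ∑ i ∈ G, colorExcess s α i ≤ ∑ i, colorExcess s α i :=
    sum_le_sum_of_subset_of_nonneg (subset_univ _) fun i _ _ => h.colorExcess_nonneg i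
  have h3 : ∑ i, colorExcess s α i ≤ 6.1 * η / K := by
    have h4 := h.deviation_le
    have : (0 : ℝ) ≤ (∑ i, (s * colorWeight α i - 1) ^ 2) / (2 * s) :=
      div_nonneg (sum_nonneg fun _ _ => sq_nonneg _) (by positivity)
    linarith
  have h4 := mul_le_mul_of_nonneg_left (h2.trans h3) hs.le
  have h5 : 0.75 * √(K : ℝ) ≤ #G := by
    have h6 := h.card_le_good_add (A := B)
    have h7 := h.sqrt_le_card hη hB
    have h8 : (#B : ℝ) ≤ #G + √(K : ℝ) / 4 := h6
    linarith
  have h6 : 0.75 * √(K : ℝ) * (0.39 * η) ≤ #G * (0.39 * η) :=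
    mul_le_mul_of_nonneg_right h5 (by positivity)
  have h7 : 0.75 * √(K : ℝ) * (0.39 * η) ≤ s * (6.1 * η / K) := by linarith
  have h8 : s * (6.1 * η / K) * K = 6.1 * η * s := by field_simp
  have h9 := mul_le_mul_of_nonneg_right h7 hK.le
  rw [h8] at h9
  have h10 := mul_le_mul_of_nonneg_left h.s_mul_le hη.le
  have h11 : 0 < η * s := by positivity
  norm_num at h10
  nlinarith

end Critical

end Colors

section Classes

variable {q s K : ℕ} {α : Finset (Fin q) → ℝ} {η : ℝ}

/-- Weight concentrated equally on `s` pairwise disjoint color sets. -/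
def IsTuranWeight (s : ℕ) (α : Finset (Fin q) → ℝ) : Prop :=
  ∃ C : Fin s → Finset (Fin q), (∀ i j, i ≠ j → Disjoint (C i) (C j)) ∧ ∀ j, α (C j) = 1 / s

/-- Sum of chord bounds over disjoint color sets. -/
theorem Params.sum_log_le (p : Params q s K) {ι : Type*} (R : Finset ι) (hR : #R = s)
    (C : ι → Finset (Fin q)) (hne : ∀ r ∈ R, (C r).Nonempty)
    (hd : ∀ r ∈ R, ∀ t ∈ R, r ≠ t → Disjoint (C r) (C t)) :
    ∑ r ∈ R, 1 / s * Real.log #(C r) ≤ balancedLog q s K := by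
  classical
  have hs := p.s_pos
  have h1 : ∑ r ∈ R, 1 / s * Real.log #(C r) ≤
      ∑ r ∈ R, 1 / s * (Real.log K + Real.log (1 + 1 / K) * ((#(C r) : ℝ) - K)) := by
    refine sum_le_sum fun r hr => mul_le_mul_of_nonneg_left ?_ (by positivity)
    exact log_le_chord (by exact_mod_cast p.one_le_K) (Finset.card_pos.2 (hne r hr))
  refine h1.trans ?_
  rw [← mul_sum, sum_add_distrib, ← mul_sum, sum_sub_distrib, sum_const, sum_const, hR,
    nsmul_eq_mul, nsmul_eq_mul, balancedLog]
  have h2 : ∑ r ∈ R, (#(C r) : ℝ) ≤ q := by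
    have h3 : #(R.biUnion C) = ∑ r ∈ R, #(C r) := card_biUnion hd
    have h4 : #(R.biUnion C) ≤ q := (card_le_univ _).trans_eq (Fintype.card_fin q)
    rw [h3] at h4
    exact_mod_cast h4
  have h5 := mul_le_mul_of_nonneg_left h2 p.slope_nonneg
  have e : 1 / (s : ℝ) * (s * Real.log K + Real.log (1 + 1 / K) *
      (∑ r ∈ R, (#(C r) : ℝ) - s * K)) = Real.log K + (Real.log (1 + 1 / K) *
      (∑ r ∈ R, (#(C r) : ℝ))) / s - Real.log (1 + 1 / K) * K := by
    field_simp
    ring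
  have h6 : (Real.log (1 + 1 / K) * (∑ r ∈ R, (#(C r) : ℝ))) / s ≤
      Real.log (1 + 1 / K) * q / s := by gcongr
  rw [e]
  have e2 : Real.log (1 + 1 / K) * ((q : ℝ) / s - K) =
    Real.log (1 + 1 / K) * q / s - Real.log (1 + 1 / K) * K := by ring
  linarith

theorem IsWeight.nonempty_of_pos (h : IsWeight α) {A : Finset (Fin q)} (hA : 0 < α A) :
    A.Nonempty := Finset.card_pos.1 (h.card_pos hA)

theorem Params.logMean_le_of_isTuranWeight (p : Params q s K) (h : IsWeight α)
    (hT : IsTuranWeight s α) : logMean α ≤ balancedLog q s K := by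
  classical
  obtain ⟨C, hd, hC⟩ := hT
  have hs := p.s_pos
  have hpos : ∀ j, 0 < α (C j) := fun j => by rw [hC]; positivity
  have hinj : Function.Injective C := by
    intro i j hij
    by_contra hne
    have h1 := hd i j hne
    rw [hij, disjoint_self] at h1
    have := h.nonempty_of_pos (hpos j)
    rw [h1] at this
    exact Finset.not_nonempty_empty this
  have h2 : ∑ A ∈ univ.image C, α A = 1 := by
    rw [sum_image hinj.injOn]
    simp_rw [hC]
    rw [sum_const, card_univ, Fintype.card_fin, nsmul_eq_mul]
    field_simp
  have h3 : ∀ A, A ∉ univ.image C → α A = 0 := by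
    have h4 : ∑ A ∈ (univ.image C)ᶜ, α A = 0 := by
      have := sum_add_sum_compl (univ.image C) α
      rw [h2, h.sum_eq] at this
      linarith
    intro A hA
    exact (sum_eq_zero_iff_of_nonneg fun A _ => h.nonneg A).1 h4 A (mem_compl.2 hA)
  have h5 : logMean α = ∑ j, 1 / s * Real.log #(C j) := by
    rw [logMean, ← sum_subset (subset_univ (univ.image C)), sum_image hinj.injOn]
    · simp_rw [hC]
    · intro A _ hA
      rw [h3 A hA, zero_mul]
  rw [h5]
  exact p.sum_log_le univ (by simp) C (fun r _ => h.nonempty_of_pos (hpos r))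
    fun r _ t _ hrt => hd r t hrt

/-- Sets in the support whose intersection weight is not too large. -/
def Light (s : ℕ) (α : Finset (Fin q) → ℝ) (A : Finset (Fin q)) : Prop :=
  0 < α A ∧ s * meetWeight α A < 1.5

open Classical in
/-- The light sets. -/
noncomputable def lights (s : ℕ) (α : Finset (Fin q) → ℝ) : Finset (Finset (Fin q)) :=
  univ.filter (Light s α)

theorem mem_lights {A : Finset (Fin q)} : A ∈ lights s α ↔ Light s α A := by
  simp [lights]

/-- A partition of the light sets into intersecting classes with small overlap across classes. -/
structure ClassPartition (s : ℕ) (α : Finset (Fin q) → ℝ) (R : Finset (Fin q))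
    (c : Finset (Fin q) → Fin q) : Prop where
  mem : ∀ A ∈ lights s α, c A ∈ R
  meet : ∀ A ∈ lights s α, ∀ B ∈ lights s α, c A = c B → ¬ Disjoint A B
  cross : ∀ A ∈ lights s α, ∀ B ∈ lights s α, c A ≠ c B → 4 * (#(A ∩ B) : ℝ) ≤ #A
  mass : ∀ r ∈ R, 0.9 ≤ s * ∑ A ∈ lights s α with c A = r, α A

theorem inv_le_quadratic {y : ℝ} (hy : 0.9 ≤ y) : 1 / y ≤ 2 - y + 1.2 * (y - 1) ^ 2 := by
  rw [div_le_iff₀ (by linarith)]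
  nlinarith [mul_nonneg (sub_nonneg.2 hy) (sq_nonneg (y - 1)), sq_nonneg (y - 1)]

namespace Critical

variable (h : Critical q s K α η)
include h

theorem heavy_le {A : Finset (Fin q)} (hA : 0 < α A) (hw : 1.5 ≤ s * meetWeight α A) :
    s * meetWeight α A ≤ 150 * sqrtGap (#A / ((q : ℝ) / s)) := by
  have ha := h.card_real_pos hA
  have hk := h.ratio_pos
  rw [h.eq_of_pos hA] at hw ⊢
  have h1 := h.mult_le_two
  have h2 := h.mult_nonneg
  have h3 := h.le_logMean
  have h4 := h.eps_le
  set u := Real.log #A - logMean α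
  set v := Real.log (#A / ((q : ℝ) / s)) with hv
  have huv : u ≤ v + 1 / (2 * (K : ℝ) ^ 2) := by
    rw [hv, Real.log_div ha.ne' hk.ne']
    simp only [u]; linarith
  have hu : 0.25 ≤ u := by
    by_contra hc
    push Not at hc
    rcases le_total u 0 with h0 | h0
    · have := mul_nonpos_of_nonneg_of_nonpos h2 h0
      norm_num at hw
      linarith
    · have := mul_le_mul_of_nonneg_right h1 h0
      norm_num at hw hc
      linarith
  have hv2 : 0.2 ≤ v := by linarith
  have hr : 1 ≤ #A / ((q : ℝ) / s) := by
    by_contra hc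
    push Not at hc
    have := Real.log_nonpos (by positivity) hc.le
    linarith
  have h5 := sq_log_le_of_one_le hr
  rw [← hv] at h5
  nlinarith

theorem sq_meetWeight_le (hη : 0 < η) {A : Finset (Fin q)} (hA : 0 < α A) :
    (s * meetWeight α A - 1) ^ 2 ≤
      48 * sqrtGap (#A / ((q : ℝ) / s)) + 8 * (1 / (2 * (K : ℝ) ^ 2)) ^ 2 := by
  have ha := h.card_real_pos hA
  have hk := h.ratio_pos
  have h0 := h.meetWeight_ge hη hA
  rw [h.eq_of_pos hA] at h0 ⊢
  have h1 := h.mult_le_two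
  have h3 := h.le_logMean
  have h3' := h.logMean_le
  set D := 1 / (2 * (K : ℝ) ^ 2)
  set u := Real.log #A - logMean α with hu
  set v := Real.log (#A / ((q : ℝ) / s)) with hv
  have hσ : u = v + (Real.log ((q : ℝ) / s) - logMean α) := by
    rw [hv, Real.log_div ha.ne' hk.ne', hu]; ring
  set σ := Real.log ((q : ℝ) / s) - logMean α
  have hσ0 : 0 ≤ σ := by simp only [σ]; linarith
  have hσD : σ ≤ D := by simp only [σ]; linarith
  have hD := h.eps_le
  have e : (1 + η * u - 1) ^ 2 = (η * u) ^ 2 := by ring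
  rw [e]
  rcases le_or_gt 0.4 (#A / ((q : ℝ) / s)) with hr | hr
  · have h5 := sq_log_le hr
    rw [← hv] at h5
    have h6 : η ^ 2 ≤ 4 := by nlinarith
    have h7 : (η * u) ^ 2 ≤ 4 * u ^ 2 := by
      rw [mul_pow]; exact mul_le_mul_of_nonneg_right h6 (sq_nonneg u)
    have h8 : u ^ 2 ≤ 2 * v ^ 2 + 2 * σ ^ 2 := by rw [hσ]; nlinarith [sq_nonneg (v - σ)]
    have h9 : σ ^ 2 ≤ D ^ 2 := pow_le_pow_left₀ hσ0 hσD 2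
    linarith
  · have h5 := sqrtGap_ge_of_far (div_pos ha hk) (Or.inl (by linarith : #A / ((q : ℝ) / s) ≤ 0.9))
    have h6 : v ≤ -0.6 := by
      have := Real.log_le_sub_one_of_pos (div_pos ha hk)
      rw [← hv] at this
      linarith
    have h7 : u ≤ 0 := by rw [hσ]; linarith
    have h8 : η * u ≤ 0 := mul_nonpos_of_nonneg_of_nonpos hη.le h7
    have h9 : (η * u) ^ 2 ≤ 0.01 ^ 2 := by nlinarith
    have h10 := sq_nonneg D
    norm_num at h9 ⊢
    linarith

theorem exists_classPartition (hη : 0 < η) :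
    ∃ R c, ClassPartition s α R c := by
  classical
  obtain ⟨R, hR⟩ := h.exists_representatives
  have hs := h.s_pos
  have key : ∀ A, ∃ r, A ∈ lights s α →
      r ∈ R ∧ ∀ i ∈ A, GoodColor s α i → 0.95 ≤ s * pairWeight α i r := by
    intro A
    by_cases hA : A ∈ lights s α
    · have hA' := mem_lights.1 hA
      obtain ⟨i, hi, hg⟩ := h.exists_good hη hA'.1
      obtain ⟨r, hr, hir⟩ := hR.dom i hg
      refine ⟨r, fun _ => ⟨hr, fun j hj hgj => ?_⟩⟩
      obtain ⟨t, ht, hjt⟩ := hR.dom j hgj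
      rw [h.representative_unique hR hA'.2 hi hj hg hgj hr ht hir hjt]
      exact hjt
    · exact ⟨⟨0, h.q_pos⟩, fun hc => absurd hc hA⟩
  choose c hc using key
  have hmeet : ∀ A ∈ lights s α, ∀ B ∈ lights s α, c A = c B → #B ≤ #A → ¬ Disjoint A B := by
    intro A hA B hB hAB hle
    refine h.not_disjoint_of_card_le hη (hR.good _ (hc A hA).1) (mem_lights.1 hB).1 ?_ hle
    intro i hi hg
    rcases mem_union.1 hi with hi | hi
    · exact (hc A hA).2 i hi hg
    · rw [hAB]; exact (hc B hB).2 i hi hg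
  refine ⟨R, c, fun A hA => (hc A hA).1, ?_, ?_, ?_⟩
  · intro A hA B hB hAB
    rcases le_total #B #A with hle | hle
    · exact hmeet A hA B hB hAB hle
    · rw [disjoint_comm]
      exact hmeet B hB A hA hAB.symm hle
  · intro A hA B hB hne
    have hA' := mem_lights.1 hA
    have hB' := mem_lights.1 hB
    have h1 := h.card_le_good_add (A := A ∩ B)
    have h2 : (A ∩ B).filter (GoodColor s α) = ∅ := by
      rw [filter_eq_empty_iff]
      intro i hi hg
      obtain ⟨hiA, hiB⟩ := mem_inter.1 hi
      exact hne (h.representative_unique hR hA'.2 hiA hiA hg hg (hc A hA).1 (hc B hB).1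
        ((hc A hA).2 i hiA hg) ((hc B hB).2 i hiB hg))
    rw [h2, card_empty] at h1
    have h3 := h.sqrt_le_card hη hA'.1
    push_cast at h1
    linarith
  · intro r hr
    have hg := hR.good r hr
    have hself : 0.95 ≤ s * pairWeight α r r := by
      rw [pairWeight_self]; linarith [hg.ge]
    have h1 : s * colorWeight α r ≤ s * (∑ A ∈ lights s α with c A = r, α A) +
        s * ∑ A, α A * (150 * sqrtGap (#A / ((q : ℝ) / s))) := by
      rw [← mul_add]
      refine mul_le_mul_of_nonneg_left ?_ hs.le
      rw [colorWeight, sum_filter, lights, sum_filter, ← sum_add_distrib]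
      refine sum_le_sum fun A _ => ?_
      rcases (h.nonneg A).eq_or_lt with h0 | h0
      · simp [← h0]
      have hgap : 0 ≤ sqrtGap (#A / ((q : ℝ) / s)) :=
        sqrtGap_nonneg (div_pos (h.card_real_pos h0) h.ratio_pos)
      have hg0 : 0 ≤ α A * (150 * sqrtGap (#A / ((q : ℝ) / s))) := by positivity
      by_cases hrA : r ∈ A
      · rw [if_pos hrA]
        by_cases hl : Light s α A
        · have hcA := hc A (mem_lights.2 hl)
          have : c A = r := (h.representative_unique hR hl.2 hrA hrA hg hg hcA.1 hr
            (hcA.2 r hrA hg) hself)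
          rw [if_pos hl, if_pos this]
          linarith
        · rw [if_neg hl, zero_add]
          have hw : 1.5 ≤ s * meetWeight α A := by
            by_contra hcon
            exact hl ⟨h0, not_le.1 hcon⟩
          have h2 := h.heavy_le h0 hw
          have h3 : 1 ≤ 150 * sqrtGap (#A / ((q : ℝ) / s)) := by
            norm_num at hw
            linarith
          have h4 := mul_le_mul_of_nonneg_left h3 h0.le
          linarith
      · rw [if_neg hrA]
        split_ifs <;> positivity
    have h2 := h.avg_sqrtGap_le
    have h3 : ∑ A, α A * (150 * sqrtGap (#A / ((q : ℝ) / s))) ≤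
        150 * (1 / (2 * (K : ℝ) ^ 2)) := by
      refine le_trans (le_of_eq ?_) (mul_le_mul_of_nonneg_left h2 (by norm_num))
      rw [mul_sum]
      exact sum_congr rfl fun A _ => by ring
    have h4 := mul_le_mul_of_nonneg_left h3 hs.le
    have h5 := h.s_mul_eps_le
    have h6 := hg.ge
    linarith

end Critical

end Classes

section ClassCount

variable {q s K : ℕ} {α : Finset (Fin q) → ℝ} {η : ℝ}

open Classical in
/-- Total weight of the light sets in the class `r`. -/
noncomputable def classMass (s : ℕ) (α : Finset (Fin q) → ℝ) (c : Finset (Fin q) → Fin q)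
    (r : Fin q) : ℝ := ∑ A ∈ lights s α with c A = r, α A

open Classical in
/-- Weight of the light sets of other classes which intersect `A`. -/
noncomputable def crossWeight (s : ℕ) (α : Finset (Fin q) → ℝ) (c : Finset (Fin q) → Fin q)
    (A : Finset (Fin q)) : ℝ := ∑ B ∈ lights s α with c B ≠ c A, α B * hit A B

open Classical in
/-- Weight of the sets which are not light and intersect `A`. -/
noncomputable def heavyWeight (s : ℕ) (α : Finset (Fin q) → ℝ) (A : Finset (Fin q)) : ℝ :=
  ∑ B ∈ (lights s α)ᶜ, α B * hit A B

theorem crossWeight_nonneg (h : IsWeight α) (c : Finset (Fin q) → Fin q) (A : Finset (Fin q)) :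
    0 ≤ crossWeight s α c A :=
  sum_nonneg fun B _ => mul_nonneg (h.nonneg B) (hit_nonneg A B)

theorem heavyWeight_nonneg (h : IsWeight α) (A : Finset (Fin q)) : 0 ≤ heavyWeight s α A :=
  sum_nonneg fun B _ => mul_nonneg (h.nonneg B) (hit_nonneg A B)

theorem meetWeight_nonneg (h : IsWeight α) (A : Finset (Fin q)) : 0 ≤ meetWeight α A :=
  sum_nonneg fun B _ => mul_nonneg (h.nonneg B) (hit_nonneg A B)

theorem ClassPartition.meetWeight_eq {R : Finset (Fin q)} {c : Finset (Fin q) → Fin q}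
    (hP : ClassPartition s α R c) {A : Finset (Fin q)} (hA : A ∈ lights s α) :
    meetWeight α A = classMass s α c (c A) + crossWeight s α c A + heavyWeight s α A := by
  classical
  rw [meetWeight, heavyWeight, crossWeight, classMass, ← sum_add_sum_compl (lights s α),
    ← sum_filter_add_sum_filter_not (lights s α) (fun B => c B = c A)]
  congr 2
  · refine sum_congr rfl fun B hB => ?_
    obtain ⟨hB, hc⟩ := mem_filter.1 hB
    rw [hit_eq_one_of_not_disjoint (hP.meet A hA B hB hc.symm), mul_one]

theorem ClassPartition.crossWeight_le {R : Finset (Fin q)} {c : Finset (Fin q) → Fin q}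
    (hP : ClassPartition s α R c) (h : IsWeight α) {A : Finset (Fin q)} (hA : A ∈ lights s α) :
    crossWeight s α c A ≤ 2 * overlapDefect α A := by
  classical
  have ha : (0 : ℝ) < #A := by exact_mod_cast h.card_pos (mem_lights.1 hA).1
  have hn : ∀ B, 0 ≤ α B * (hit A B - (#(A ∩ B) : ℝ) / #A) := fun B =>
    mul_nonneg (h.nonneg B) (sub_nonneg.2 (inter_card_div_le_hit A B))
  calc crossWeight s α c A
      ≤ ∑ B ∈ lights s α with c B ≠ c A, 2 * (α B * (hit A B - (#(A ∩ B) : ℝ) / #A)) := by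
        refine sum_le_sum fun B hB => ?_
        obtain ⟨hB, hc⟩ := mem_filter.1 hB
        have h1 := hP.cross A hA B hB hc.symm
        have h2 : (#(A ∩ B) : ℝ) / #A ≤ 1 / 4 := by
          rw [div_le_iff₀ ha]; linarith
        by_cases hd : Disjoint A B
        · rw [hit_eq_zero hd, Finset.disjoint_iff_inter_eq_empty.1 hd]; simp
        · rw [hit_eq_one_of_not_disjoint hd]
          nlinarith [h.nonneg B]
    _ ≤ ∑ B, 2 * (α B * (hit A B - (#(A ∩ B) : ℝ) / #A)) :=
        sum_le_sum_of_subset_of_nonneg (subset_univ _) fun B _ _ =>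
          mul_nonneg (by norm_num) (hn B)
    _ = 2 * overlapDefect α A := by rw [overlapDefect, mul_sum]

open Classical in
theorem sum_heavyWeight_eq (s : ℕ) (α : Finset (Fin q) → ℝ) :
    ∑ A ∈ lights s α, α A * heavyWeight s α A =
      (∑ B ∈ (lights s α)ᶜ, α B * (meetWeight α B - heavyWeight s α B)) := by
  classical
  simp only [heavyWeight, mul_sum]
  rw [sum_comm]
  refine sum_congr rfl fun B _ => ?_
  rw [meetWeight, ← sum_add_sum_compl (lights s α), add_sub_cancel_right, mul_sum]
  refine sum_congr rfl fun A _ => ?_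
  rw [hit_comm]; ring

namespace Critical

open Classical in
theorem sum_heavy_le (h : Critical q s K α η) :
    (∑ A ∈ (lights s α)ᶜ, α A * (s * meetWeight α A)) ≤
      150 * (1 / (2 * (K : ℝ) ^ 2)) := by
  classical
  have hg : ∀ A, 0 ≤ α A * (150 * sqrtGap (#A / ((q : ℝ) / s))) := by
    intro A
    rcases (h.nonneg A).eq_or_lt with h0 | h0
    · simp [← h0]
    · have := sqrtGap_nonneg (div_pos (h.card_real_pos h0) h.ratio_pos)
      positivity
  calc ∑ A ∈ (lights s α)ᶜ, α A * (s * meetWeight α A)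
      ≤ ∑ A ∈ (lights s α)ᶜ, α A * (150 * sqrtGap (#A / ((q : ℝ) / s))) := by
        refine sum_le_sum fun A hA => ?_
        rcases (h.nonneg A).eq_or_lt with h0 | h0
        · simp [← h0]
        · refine mul_le_mul_of_nonneg_left (h.heavy_le h0 ?_) h0.le
          by_contra hcon
          exact mem_compl.1 hA (mem_lights.2 ⟨h0, not_le.1 hcon⟩)
    _ ≤ ∑ A, α A * (150 * sqrtGap (#A / ((q : ℝ) / s))) :=
        sum_le_sum_of_subset_of_nonneg (subset_univ _) fun A _ _ => hg A
    _ = 150 * ∑ A, α A * sqrtGap (#A / ((q : ℝ) / s)) := by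
        rw [mul_sum]; exact sum_congr rfl fun A _ => by ring
    _ ≤ _ := mul_le_mul_of_nonneg_left h.avg_sqrtGap_le (by norm_num)

open Classical in
theorem sum_light_add_heavy (f : Finset (Fin q) → ℝ) :
    ∑ A ∈ lights s α, α A * f A = ∑ A, α A * f A -
      (∑ A ∈ (lights s α)ᶜ, α A * f A) := by
  classical
  rw [← sum_add_sum_compl (lights s α)]; ring

theorem sum_classMass_mul {R : Finset (Fin q)} {c : Finset (Fin q) → Fin q}
    (hP : ClassPartition s α R c) (g : Fin q → ℝ) :
    ∑ r ∈ R, classMass s α c r * g r = ∑ A ∈ lights s α, α A * g (c A) := by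
  classical
  rw [← sum_fiberwise_of_maps_to hP.mem]
  refine sum_congr rfl fun r _ => ?_
  rw [classMass, sum_mul]
  refine sum_congr rfl fun A hA => ?_
  rw [(mem_filter.1 hA).2]

theorem card_classes_le (h : Critical q s K α η) (hη : 0 < η) {R : Finset (Fin q)}
    {c : Finset (Fin q) → Fin q} (hP : ClassPartition s α R c) : #R ≤ s := by
  classical
  have hs := h.s_pos
  have hD0 := h.eps_pos
  have hD1 := h.eps_le
  have hsD := h.s_mul_eps_le
  have hH := h.sum_heavy_le
  have hO := h.avg_defect_le
  have hG := h.avg_sqrtGap_le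
  have hI := h.self
  set D := 1 / (2 * (K : ℝ) ^ 2)
  have hm : ∀ r ∈ R, 0.9 ≤ s * classMass s α c r := hP.mass
  have hmpos : ∀ r ∈ R, 0 < classMass s α c r := fun r hr => by
    have := hm r hr
    by_contra hc
    have := mul_nonpos_of_nonneg_of_nonpos hs.le (not_lt.1 hc)
    norm_num at *
    linarith
  have h1 : (#R : ℝ) = s * ∑ A ∈ lights s α, α A * (1 / (s * classMass s α c (c A))) := by
    rw [← sum_classMass_mul hP (fun r => 1 / (s * classMass s α c r)), mul_sum]
    rw [card_eq_sum_ones, Nat.cast_sum]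
    refine sum_congr rfl fun r hr => ?_
    have := hmpos r hr
    push_cast
    field_simp
  have h2 : ∑ A ∈ lights s α, α A * (1 / (s * classMass s α c (c A))) ≤
      ∑ A ∈ lights s α, (α A * (2 - s * meetWeight α A) + 6 * (s * (α A * overlapDefect α A))
        + 3 * (s * (α A * heavyWeight s α A)) +
        2.4 * (α A * (s * meetWeight α A - 1) ^ 2)) := by
    refine sum_le_sum fun A hA => ?_
    have hA' := mem_lights.1 hA
    have e := hP.meetWeight_eq hA
    have hy := hm _ (hP.mem A hA)
    have hcr := hP.crossWeight_le h.toIsWeight hA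
    have hc0 := crossWeight_nonneg (s := s) h.toIsWeight c A
    have hv0 := heavyWeight_nonneg (s := s) h.toIsWeight A
    have hw : s * meetWeight α A < 1.5 := hA'.2
    have hq := inv_le_quadratic hy
    set y := s * classMass s α c (c A) with hyd
    set w := s * meetWeight α A with hwd
    set z := s * (crossWeight s α c A + heavyWeight s α A) with hzd
    have ez : y = w - z := by
      rw [hyd, hwd, hzd, e]; ring
    have hz0 : 0 ≤ z := mul_nonneg hs.le (add_nonneg hc0 hv0)
    have hz1 : z ≤ 0.6 := by norm_num at *; linarith
    have hz2 : z ≤ 2 * (s * overlapDefect α A) + s * heavyWeight s α A := by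
      have := mul_le_mul_of_nonneg_left hcr hs.le
      rw [hzd]; linarith
    have hz3 : z ^ 2 ≤ 0.6 * z := by nlinarith
    have h3 : 1 / y ≤ (2 - w) + 3 * z + 2.4 * (w - 1) ^ 2 := by
      refine hq.trans ?_
      rw [ez]
      have : (w - z - 1) ^ 2 ≤ 2 * (w - 1) ^ 2 + 2 * z ^ 2 := by nlinarith [sq_nonneg (w - 1 + z)]
      linarith
    have h4 : 1 / y ≤ (2 - w) + 6 * (s * overlapDefect α A) + 3 * (s * heavyWeight s α A) +
        2.4 * (w - 1) ^ 2 := by linarith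
    refine (mul_le_mul_of_nonneg_left h4 hA'.1.le).trans (le_of_eq (by ring))
  rw [sum_add_distrib, sum_add_distrib, sum_add_distrib, ← mul_sum, ← mul_sum, ← mul_sum,
    ← mul_sum, ← mul_sum] at h2
  have hS1 : ∑ A ∈ lights s α, α A * (2 - s * meetWeight α A) ≤ 1 + 150 * D := by
    rw [sum_light_add_heavy]
    have e1 : ∑ A, α A * (2 - s * meetWeight α A) = 1 := by
      have : ∀ A, α A * (2 - s * meetWeight α A) = α A * 2 - s * (α A * meetWeight α A) :=
        fun A => by ring
      simp_rw [this]
      rw [sum_sub_distrib, h.avg_const, ← mul_sum, hI]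
      field_simp
      norm_num
    have e2 : -∑ A ∈ (lights s α)ᶜ, α A * (2 - s * meetWeight α A) ≤
        ∑ A ∈ (lights s α)ᶜ, α A * (s * meetWeight α A) := by
      rw [← sum_neg_distrib]
      exact sum_le_sum fun A _ => by have := h.nonneg A; linarith
    linarith
  have hS2 : s * ∑ A ∈ lights s α, α A * overlapDefect α A ≤ D := by
    refine le_trans (mul_le_mul_of_nonneg_left ?_ hs.le) hO
    exact sum_le_sum_of_subset_of_nonneg (subset_univ _) fun A _ _ =>
      mul_nonneg (h.nonneg A) (overlapDefect_nonneg h.toIsWeight A)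
  have hS3 : s * ∑ A ∈ lights s α, α A * heavyWeight s α A ≤ 150 * D := by
    rw [sum_heavyWeight_eq]
    refine le_trans ?_ hH
    rw [mul_sum]
    refine sum_le_sum fun A _ => ?_
    have h5 := mul_nonneg (mul_nonneg hs.le (h.nonneg A))
      (heavyWeight_nonneg (s := s) h.toIsWeight A)
    linarith
  have hS4 : ∑ A ∈ lights s α, α A * (s * meetWeight α A - 1) ^ 2 ≤ 48 * D + 8 * D ^ 2 := by
    calc ∑ A ∈ lights s α, α A * (s * meetWeight α A - 1) ^ 2
        ≤ ∑ A, α A * (s * meetWeight α A - 1) ^ 2 :=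
          sum_le_sum_of_subset_of_nonneg (subset_univ _) fun A _ _ =>
            mul_nonneg (h.nonneg A) (sq_nonneg _)
      _ ≤ ∑ A, α A * (48 * sqrtGap (#A / ((q : ℝ) / s)) + 8 * D ^ 2) :=
          h.avg_le fun A hA => h.sq_meetWeight_le hη hA
      _ = 48 * ∑ A, α A * sqrtGap (#A / ((q : ℝ) / s)) + 8 * D ^ 2 := by
          simp_rw [mul_add]
          rw [sum_add_distrib, h.avg_const, mul_sum]
          congr 1
          exact sum_congr rfl fun A _ => by ring
      _ ≤ _ := by linarith
  have hD2 : D ^ 2 ≤ D := by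
    have : D ≤ 1 := hD1.trans (by norm_num)
    nlinarith
  have hT : ∑ A ∈ lights s α, α A * (1 / (s * classMass s α c (c A))) ≤ 1 + 1000 * D := by
    linarith
  have hF : (#R : ℝ) < s + 1 := by
    rw [h1]
    have := mul_le_mul_of_nonneg_left hT hs.le
    linarith
  have : #R < s + 1 := by exact_mod_cast hF
  omega

open Classical in
/-- Mass of the sets which are not light. -/
theorem heavy_mass_le (h : Critical q s K α η) :
    1.5 * (∑ A ∈ (lights s α)ᶜ, α A) ≤
      (∑ A ∈ (lights s α)ᶜ, α A * (s * meetWeight α A)) := by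
  classical
  rw [mul_sum]
  refine sum_le_sum fun A hA => ?_
  rcases (h.nonneg A).eq_or_lt with h0 | h0
  · simp [← h0]
  · rw [mul_comm]
    refine mul_le_mul_of_nonneg_left ?_ h0.le
    by_contra hcon
    exact mem_compl.1 hA (mem_lights.2 ⟨h0, not_le.1 hcon⟩)

theorem classes_eq (h : Critical q s K α η) (hη : 0 < η) {R : Finset (Fin q)}
    {c : Finset (Fin q) → Fin q} (hP : ClassPartition s α R c) :
    #R = s ∧ (∀ r ∈ R, classMass s α c r = 1 / s) ∧ (∀ A, 0 < α A → A ∈ lights s α) ∧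
      ∀ A ∈ lights s α, crossWeight s α c A = 0 := by
  classical
  have hs := h.s_pos
  have hRs := h.card_classes_le hη hP
  have hH := h.sum_heavy_le
  have hHm := h.heavy_mass_le
  have hsD := h.s_mul_eps_le
  have hD0 := h.eps_pos
  have hI := h.self
  set D := 1 / (2 * (K : ℝ) ^ 2)
  set ω := ∑ A ∈ (lights s α)ᶜ, α A with hω
  set Hv := ∑ A ∈ (lights s α)ᶜ, α A * meetWeight α A with hHv
  have eH : ∑ A ∈ (lights s α)ᶜ, α A * (s * meetWeight α A) = s * Hv := by
    rw [hHv, mul_sum]; exact sum_congr rfl fun A _ => by ring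
  rw [eH] at hH hHm
  have hω0 : 0 ≤ ω := sum_nonneg fun A _ => h.nonneg A
  set X := ∑ A ∈ lights s α, α A * crossWeight s α c A with hX
  have hX0 : 0 ≤ X := sum_nonneg fun A _ =>
    mul_nonneg (h.nonneg A) (crossWeight_nonneg h.toIsWeight c A)
  have hsum : ∑ r ∈ R, classMass s α c r = 1 - ω := by
    have e1 := sum_classMass_mul hP (fun _ => (1 : ℝ))
    simp only [mul_one] at e1
    rw [e1, hω, ← h.sum_eq, ← sum_add_sum_compl (lights s α)]
    ring
  have hHV : Hv - ω ^ 2 ≤ ∑ A ∈ lights s α, α A * heavyWeight s α A := by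
    rw [sum_heavyWeight_eq, hHv, sq]
    nth_rewrite 1 [hω]
    rw [sum_mul, ← sum_sub_distrib]
    refine sum_le_sum fun A _ => ?_
    have h1 : heavyWeight s α A ≤ ω := by
      refine sum_le_sum fun B _ => ?_
      have := mul_le_mul_of_nonneg_left (hit_le_one A B) (h.nonneg B)
      linarith
    have := mul_le_mul_of_nonneg_left h1 (h.nonneg A)
    linarith
  have hI2 : ∑ r ∈ R, classMass s α c r ^ 2 + X +
      ∑ A ∈ lights s α, α A * heavyWeight s α A + Hv = 1 / s := by
    rw [← hI, ← sum_add_sum_compl (lights s α)]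
    congr 1
    have e1 := sum_classMass_mul hP (fun r => classMass s α c r)
    simp_rw [← sq] at e1
    rw [e1, hX, ← sum_add_distrib, ← sum_add_distrib]
    refine sum_congr rfl fun A hA => ?_
    rw [hP.meetWeight_eq hA]; ring
  have hcs : (1 - ω) ^ 2 ≤ s * ∑ r ∈ R, classMass s α c r ^ 2 := by
    rw [← hsum]
    refine sq_sum_le_card_mul_sum_sq.trans ?_
    exact mul_le_mul_of_nonneg_right (by exact_mod_cast hRs) (sum_nonneg fun _ _ => sq_nonneg _)
  have hI3 : s * ∑ r ∈ R, classMass s α c r ^ 2 + s * X +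
      s * ∑ A ∈ lights s α, α A * heavyWeight s α A + s * Hv = 1 := by
    rw [← mul_add, ← mul_add, ← mul_add, hI2]
    field_simp
  have hHV' := mul_le_mul_of_nonneg_left hHV hs.le
  have hsX := mul_nonneg hs.le hX0
  have hsω : s * ω ≤ 1 / 2 := by
    have h1 : ω ≤ 150 * D := by linarith
    have := mul_le_mul_of_nonneg_left h1 hs.le
    linarith
  have hωω := mul_le_mul_of_nonneg_right hsω hω0
  have hkey : ω + s * X ≤ s * ω * ω - ω ^ 2 := by
    rw [mul_sub] at hHV'
    linarith
  have hω1 : ω = 0 := by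
    have := sq_nonneg ω
    linarith
  have hX1 : X = 0 := by
    have h1 : s * X ≤ 0 := by rw [hω1] at hkey; linarith
    have h2 : s * X = 0 := le_antisymm h1 hsX
    exact (mul_eq_zero.1 h2).resolve_left hs.ne'
  have hHv0 : 0 ≤ s * Hv := mul_nonneg hs.le (sum_nonneg fun A _ =>
    mul_nonneg (h.nonneg A) (meetWeight_nonneg h.toIsWeight A))
  have hh0 : 0 ≤ s * ∑ A ∈ lights s α, α A * heavyWeight s α A := mul_nonneg hs.le
    (sum_nonneg fun A _ => mul_nonneg (h.nonneg A) (heavyWeight_nonneg h.toIsWeight A))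
  have hsq : s * ∑ r ∈ R, classMass s α c r ^ 2 ≤ 1 := by linarith
  rw [hω1, sub_zero] at hsum hcs
  have hRe : #R = s := by
    have h1 := sq_sum_le_card_mul_sum_sq (s := R) (f := classMass s α c)
    rw [hsum] at h1
    have h2 : (s : ℝ) * 1 ^ 2 ≤ s * (#R * ∑ r ∈ R, classMass s α c r ^ 2) :=
      mul_le_mul_of_nonneg_left h1 hs.le
    have h3 : (#R : ℝ) * (s * ∑ r ∈ R, classMass s α c r ^ 2) ≤ #R * 1 :=
      mul_le_mul_of_nonneg_left hsq (Nat.cast_nonneg _)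
    have h4 : (s : ℝ) ≤ #R := by linarith
    have h5 : s ≤ #R := by exact_mod_cast h4
    omega
  refine ⟨hRe, ?_, ?_, ?_⟩
  · have h1 : ∑ r ∈ R, (classMass s α c r - 1 / s) ^ 2 ≤ 0 := by
      have e1 : ∑ r ∈ R, (classMass s α c r - 1 / s) ^ 2 =
          ∑ r ∈ R, classMass s α c r ^ 2 - 1 / s := by
        have : ∀ r, (classMass s α c r - 1 / s) ^ 2 =
          classMass s α c r ^ 2 - 2 / s * classMass s α c r + (1 / s) ^ 2 := fun r => by ring
        simp_rw [this]
        rw [sum_add_distrib, sum_sub_distrib, ← mul_sum, hsum, sum_const, hRe, nsmul_eq_mul]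
        field_simp
        ring
      rw [e1]
      have : ∑ r ∈ R, classMass s α c r ^ 2 ≤ 1 / s := by
        rw [le_div_iff₀ hs]; linarith
      linarith
    have h2 := (sum_eq_zero_iff_of_nonneg (fun r _ => sq_nonneg _)).1
      (le_antisymm h1 (sum_nonneg fun r _ => sq_nonneg _))
    intro r hr
    have := h2 r hr
    rw [sq_eq_zero_iff] at this
    linarith
  · intro A hA
    by_contra hc
    have := (sum_eq_zero_iff_of_nonneg (fun A _ => h.nonneg A)).1 hω1 A (mem_compl.2 hc)
    linarith
  · intro A hA
    have := (sum_eq_zero_iff_of_nonneg (fun A _ =>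
      mul_nonneg (h.nonneg A) (crossWeight_nonneg h.toIsWeight c A))).1 hX1 A hA
    exact (mul_eq_zero.1 this).resolve_left (mem_lights.1 hA).1.ne'

theorem isTuranWeight_of_pos (h : Critical q s K α η) (hη : 0 < η) : IsTuranWeight s α := by
  classical
  obtain ⟨R, c, hP⟩ := h.exists_classPartition hη
  obtain ⟨hR, hm, hall, hcross⟩ := h.classes_eq hη hP
  have hs := h.s_pos
  set C : Fin q → Finset (Fin q) := fun r => ((lights s α).filter fun A => c A = r).biUnion id
  have hsub : ∀ A ∈ lights s α, A ⊆ C (c A) := fun A hA i hi =>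
    mem_biUnion.2 ⟨A, mem_filter.2 ⟨hA, rfl⟩, hi⟩
  have hex : ∀ r ∈ R, ∃ A ∈ lights s α, c A = r := by
    intro r hr
    have h1 : classMass s α c r ≠ 0 := by rw [hm r hr]; positivity
    obtain ⟨A, hA, -⟩ := exists_ne_zero_of_sum_ne_zero h1
    exact ⟨A, mem_filter.1 hA⟩
  have hne : ∀ r ∈ R, (C r).Nonempty := by
    intro r hr
    obtain ⟨A, hA, rfl⟩ := hex r hr
    exact (h.nonempty_of_pos (mem_lights.1 hA).1).mono (hsub A hA)
  have hdis : ∀ r ∈ R, ∀ t ∈ R, r ≠ t → Disjoint (C r) (C t) := by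
    intro r _ t _ hrt
    rw [disjoint_biUnion_left]
    intro A hA
    rw [disjoint_biUnion_right]
    intro B hB
    obtain ⟨hA', rfl⟩ := mem_filter.1 hA
    obtain ⟨hB', rfl⟩ := mem_filter.1 hB
    have h1 := (sum_eq_zero_iff_of_nonneg (fun B _ =>
      mul_nonneg (h.nonneg B) (hit_nonneg A B))).1 (hcross A hA') B
        (mem_filter.2 ⟨hB', hrt.symm⟩)
    have h2 := (mul_eq_zero.1 h1).resolve_left (mem_lights.1 hB').1.ne'
    by_contra hd
    rw [id, id] at hd
    rw [hit_eq_one_of_not_disjoint hd] at h2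
    exact one_ne_zero h2
  have h0 : ∀ A, A ∉ lights s α → α A = 0 := fun A hA => by
    rcases (h.nonneg A).eq_or_lt with h0 | h0
    · exact h0.symm
    · exact absurd (hall A h0) hA
  have hlog : logMean α = ∑ A ∈ lights s α, α A * Real.log #A := by
    rw [logMean]
    refine (sum_subset (subset_univ _) fun A _ hA => ?_).symm
    rw [h0 A hA, zero_mul]
  have hle : ∑ A ∈ lights s α, α A * (Real.log #(C (c A)) - Real.log #A) ≤ 0 := by
    have e1 := sum_classMass_mul hP (fun r => Real.log #(C r))
    have e2 := h.sum_log_le R hR C hne hdis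
    have e3 : ∑ r ∈ R, classMass s α c r * Real.log #(C r) =
        ∑ r ∈ R, 1 / s * Real.log #(C r) :=
      sum_congr rfl fun r hr => by rw [hm r hr]
    have e4 := h.obj
    simp_rw [mul_sub]
    rw [sum_sub_distrib, ← hlog]
    linarith
  have hterm : ∀ A ∈ lights s α, 0 ≤ α A * (Real.log #(C (c A)) - Real.log #A) := by
    intro A hA
    refine mul_nonneg (h.nonneg A) (sub_nonneg.2 (Real.log_le_log
      (h.card_real_pos (mem_lights.1 hA).1) ?_))
    exact_mod_cast card_le_card (hsub A hA)
  have heq : ∀ A ∈ lights s α, A = C (c A) := by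
    intro A hA
    have h1 := (sum_eq_zero_iff_of_nonneg hterm).1 (le_antisymm hle (sum_nonneg hterm)) A hA
    have h2 := (mul_eq_zero.1 h1).resolve_left (mem_lights.1 hA).1.ne'
    have hA0 := h.card_real_pos (mem_lights.1 hA).1
    have hC0 : (0 : ℝ) < #(C (c A)) := by
      exact_mod_cast Finset.card_pos.2 (hne _ (hP.mem A hA))
    have h3 : (#(C (c A)) : ℝ) = #A := Real.log_injOn_pos hC0 hA0 (by linarith)
    exact eq_of_subset_of_card_le (hsub A hA) (by exact_mod_cast h3.le)
  have hα : ∀ r ∈ R, α (C r) = 1 / s := by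
    intro r hr
    obtain ⟨A, hA, hcA⟩ := hex r hr
    have h1 : (lights s α).filter (fun A => c A = r) = {C r} := by
      ext B
      rw [mem_filter, mem_singleton]
      constructor
      · rintro ⟨hB, rfl⟩
        exact heq B hB
      · rintro rfl
        rw [← hcA, ← heq A hA]
        exact ⟨hA, rfl⟩
    rw [← hm r hr, classMass, h1, sum_singleton]
  let e : Fin s ≃ R := (Finset.equivFinOfCardEq hR).symm
  refine ⟨fun j => C (e j), fun i j hij => hdis _ (e i).2 _ (e j).2 ?_, fun j => hα _ (e j).2⟩
  intro hc
  exact hij (e.injective (Subtype.ext hc))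

/-- With a vanishing multiplier the support consists of equally weighted disjoint sets. -/
theorem isTuranWeight_of_eq_zero (h : Critical q s K α η) (hη : η = 0) : IsTuranWeight s α := by
  classical
  subst hη
  have hs := h.s_pos
  have hU : ∀ A, 0 < α A → meetWeight α A = 1 / s := by
    intro A hA
    have := h.eq_of_pos hA
    rw [zero_mul, add_zero] at this
    field_simp
    linarith
  have hx : ∀ i, 1 / s ≤ colorWeight α i := by
    intro i
    have h1 := h.cond {i} (singleton_ne_empty i)
    have h2 : meetWeight α {i} = colorWeight α i := by
      rw [meetWeight, colorWeight]
      refine sum_congr rfl fun B _ => ?_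
      by_cases hi : i ∈ B
      · rw [hit_eq_one (mem_singleton_self i) hi, if_pos hi, mul_one]
      · rw [hit_eq_zero (disjoint_singleton_left.2 hi), if_neg hi, mul_zero]
    rw [h2, zero_mul] at h1
    rw [div_le_iff₀ hs]
    linarith
  have hmem : ∀ A, 0 < α A → ∀ i ∈ A, ∀ B, 0 < α B → ¬ Disjoint A B → i ∈ B := by
    intro A hA i hi B hB hAB
    by_contra hiB
    have h1 : colorWeight α i + α B ≤ meetWeight α A := by
      have e1 : α B = ∑ D, if D = B then α D else 0 := by simp
      rw [e1, colorWeight, ← sum_add_distrib, meetWeight]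
      refine sum_le_sum fun D _ => ?_
      by_cases hD : D = B
      · subst hD
        rw [if_neg hiB, if_pos rfl, hit_eq_one_of_not_disjoint hAB]; simp
      · rw [if_neg hD, add_zero]
        split_ifs with hiD
        · rw [hit_eq_one hi hiD, mul_one]
        · exact mul_nonneg (h.nonneg D) (hit_nonneg A D)
    have := hx i
    rw [hU A hA] at h1
    linarith
  have heq : ∀ A, 0 < α A → ∀ B, 0 < α B → ¬ Disjoint A B → A = B := by
    intro A hA B hB hAB
    refine Subset.antisymm (fun i hi => hmem A hA i hi B hB hAB) fun i hi =>
      hmem B hB i hi A hA (by rwa [disjoint_comm])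
  have hval : ∀ A, 0 < α A → α A = 1 / s := by
    intro A hA
    rw [← hU A hA, meetWeight, sum_eq_single A]
    · rw [hit_eq_one_of_not_disjoint, mul_one]
      rw [disjoint_self]
      exact h.ne_empty hA
    · intro B _ hBA
      rcases (h.nonneg B).eq_or_lt with h0 | h0
      · rw [← h0, zero_mul]
      · have : Disjoint A B := by
          by_contra hd
          exact hBA (heq A hA B h0 hd).symm
        rw [hit_eq_zero this, mul_zero]
    · simp
  set S : Finset (Finset (Fin q)) := univ.filter fun A => 0 < α A with hS
  have hcard : #S = s := by
    have h1 : ∑ A ∈ S, α A = 1 := by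
      rw [← h.sum_eq]
      refine sum_subset (subset_univ _) fun A _ hA => ?_
      simp only [hS, mem_filter, mem_univ, true_and, not_lt] at hA
      exact le_antisymm hA (h.nonneg A)
    rw [sum_congr rfl fun A hA => hval A (mem_filter.1 hA).2, sum_const, nsmul_eq_mul] at h1
    have h2 : (#S : ℝ) = s := by field_simp at h1; exact h1
    exact_mod_cast h2
  let e : Fin s ≃ S := (Finset.equivFinOfCardEq hcard).symm
  have he : ∀ j, 0 < α (e j) := fun j => (mem_filter.1 (e j).2).2
  refine ⟨fun j => e j, fun i j hij => ?_, fun j => hval _ (he j)⟩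
  by_contra hd
  exact hij (e.injective (Subtype.ext (heq _ (he i) _ (he j) hd)))

theorem isTuranWeight (h : Critical q s K α η) : IsTuranWeight s α := by
  rcases h.mult_nonneg.eq_or_lt with h0 | h0
  · exact h.isTuranWeight_of_eq_zero h0.symm
  · exact h.isTuranWeight_of_pos h0

end Critical

end ClassCount

section Maximizer

variable {q s K : ℕ} {α : Finset (Fin q) → ℝ} {η : ℝ}

/-- Probability that two random sets intersect. -/
noncomputable def selfMeet (α : Finset (Fin q) → ℝ) : ℝ := ∑ A, α A * meetWeight α A

theorem isCompact_isWeight : IsCompact {α : Finset (Fin q) → ℝ | IsWeight α} := by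
  have hsub : {α : Finset (Fin q) → ℝ | IsWeight α} ⊆ Set.Icc 0 1 := by
    intro α h
    refine ⟨fun A => h.nonneg A, fun A => ?_⟩
    have := single_le_sum (fun A _ => h.nonneg A) (mem_univ A)
    rw [h.sum_eq] at this
    exact this
  have hcl : IsClosed {α : Finset (Fin q) → ℝ | IsWeight α} := by
    have : {α : Finset (Fin q) → ℝ | IsWeight α} =
        {α | ∀ A, 0 ≤ α A} ∩ ({α | α ∅ = 0} ∩ {α | ∑ A, α A = 1}) := by
      ext α
      exact ⟨fun h => ⟨h.nonneg, h.empty, h.sum_eq⟩, fun h => ⟨h.1, h.2.1, h.2.2⟩⟩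
    rw [this]
    refine IsClosed.inter ?_ (IsClosed.inter ?_ ?_)
    · simp only [Set.ofPred_forall]
      exact isClosed_iInter fun A => isClosed_le continuous_const (continuous_apply A)
    · exact isClosed_eq (continuous_apply _) continuous_const
    · exact isClosed_eq (continuous_finsetSum _ fun A _ => continuous_apply A) continuous_const
  exact isCompact_Icc.of_isClosed_subset hcl hsub

theorem continuous_logMean : Continuous (logMean : (Finset (Fin q) → ℝ) → ℝ) := by
  unfold logMean
  fun_prop

theorem continuous_selfMeet : Continuous (selfMeet : (Finset (Fin q) → ℝ) → ℝ) := by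
  unfold selfMeet meetWeight
  fun_prop

/-- Convex combination of weights. -/
theorem IsWeight.mix (h : IsWeight α) {β : Finset (Fin q) → ℝ} (hβ : IsWeight β) {t : ℝ}
    (ht0 : 0 ≤ t) (ht1 : t ≤ 1) : IsWeight fun A => (1 - t) * α A + t * β A where
  nonneg A := add_nonneg (mul_nonneg (by linarith) (h.nonneg A)) (mul_nonneg ht0 (hβ.nonneg A))
  empty := by rw [h.empty, hβ.empty]; ring
  sum_eq := by rw [sum_add_distrib, ← mul_sum, ← mul_sum, h.sum_eq, hβ.sum_eq]; ring

theorem logMean_mix (α β : Finset (Fin q) → ℝ) (t : ℝ) :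
    logMean (fun A => (1 - t) * α A + t * β A) = (1 - t) * logMean α + t * logMean β := by
  simp only [logMean, mul_sum, ← sum_add_distrib]
  exact sum_congr rfl fun A _ => by ring

theorem meetWeight_mix (α β : Finset (Fin q) → ℝ) (t : ℝ) (A : Finset (Fin q)) :
    meetWeight (fun A => (1 - t) * α A + t * β A) A =
      (1 - t) * meetWeight α A + t * meetWeight β A := by
  simp only [meetWeight, mul_sum, ← sum_add_distrib]
  exact sum_congr rfl fun A _ => by ring

theorem sum_mul_meetWeight_comm (α β : Finset (Fin q) → ℝ) :
    ∑ A, α A * meetWeight β A = ∑ A, β A * meetWeight α A := by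
  simp only [meetWeight, mul_sum]
  rw [sum_comm]
  refine sum_congr rfl fun A _ => sum_congr rfl fun B _ => ?_
  rw [hit_comm]; ring

theorem selfMeet_mix (α β : Finset (Fin q) → ℝ) (t : ℝ) :
    selfMeet (fun A => (1 - t) * α A + t * β A) = (1 - t) ^ 2 * selfMeet α +
      2 * t * (1 - t) * ∑ A, β A * meetWeight α A + t ^ 2 * selfMeet β := by
  have e : 2 * t * (1 - t) * ∑ A, β A * meetWeight α A =
      t * (1 - t) * ∑ A, β A * meetWeight α A + t * (1 - t) * ∑ A, α A * meetWeight β A := by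
    rw [sum_mul_meetWeight_comm α β]; ring
  rw [e]
  simp only [selfMeet, meetWeight_mix, mul_sum, ← sum_add_distrib]
  exact sum_congr rfl fun A _ => by ring

theorem meetWeight_le_one (h : IsWeight α) (A : Finset (Fin q)) : meetWeight α A ≤ 1 := by
  rw [← h.sum_eq]
  refine sum_le_sum fun B _ => ?_
  have := mul_le_mul_of_nonneg_left (hit_le_one A B) (h.nonneg B)
  linarith

theorem avg_meetWeight_le_one (h : IsWeight α) {β : Finset (Fin q) → ℝ} (hβ : IsWeight β) :
    ∑ A, β A * meetWeight α A ≤ 1 := by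
  have := hβ.avg_le (f := meetWeight α) (g := fun _ => 1) fun A _ => meetWeight_le_one h A
  rwa [hβ.avg_const] at this

theorem avg_meetWeight_nonneg (h : IsWeight α) {β : Finset (Fin q) → ℝ} (hβ : IsWeight β) :
    0 ≤ ∑ A, β A * meetWeight α A := hβ.avg_nonneg fun A _ => meetWeight_nonneg h A

/-- Maximizers of `logMean` under the intersection constraint. -/
structure Maximizer {q : ℕ} (s : ℕ) (α : Finset (Fin q) → ℝ) : Prop extends IsWeight α where
  meet_le : selfMeet α ≤ 1 / s
  max : ∀ β : Finset (Fin q) → ℝ, IsWeight β → selfMeet β ≤ 1 / s → logMean β ≤ logMean α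

namespace Maximizer

theorem lt_selfMeet_mix (h : Maximizer s α) {β : Finset (Fin q) → ℝ} (hβ : IsWeight β)
    (hlt : logMean α < logMean β) {t : ℝ} (ht0 : 0 < t) (ht1 : t ≤ 1) :
    1 / s < (1 - t) ^ 2 * selfMeet α + 2 * t * (1 - t) * ∑ A, β A * meetWeight α A + t ^ 2 := by
  by_contra hc
  have h1 := h.max _ (h.toIsWeight.mix hβ ht0.le ht1) (by
    rw [selfMeet_mix]
    have : t ^ 2 * selfMeet β ≤ t ^ 2 * 1 :=
      mul_le_mul_of_nonneg_left (avg_meetWeight_le_one hβ hβ) (sq_nonneg t)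
    linarith)
  rw [logMean_mix] at h1
  nlinarith

theorem selfMeet_eq (h : Maximizer s α) {β : Finset (Fin q) → ℝ} (hβ : IsWeight β)
    (hlt : logMean α < logMean β) : selfMeet α = 1 / s := by
  refine le_antisymm h.meet_le (le_of_forall_pos_lt_add fun ε hε => ?_)
  have ht0 : 0 < min 1 (ε / 3) := by positivity
  have h1 := h.lt_selfMeet_mix hβ hlt ht0 (min_le_left _ _)
  have ht1 := min_le_left 1 (ε / 3)
  have ht2 := min_le_right 1 (ε / 3)
  set t := min 1 (ε / 3)
  have hI : 0 ≤ selfMeet α := avg_meetWeight_nonneg h.toIsWeight h.toIsWeight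
  have hB := avg_meetWeight_le_one h.toIsWeight hβ
  have h2 : (1 - t) ^ 2 * selfMeet α ≤ 1 * selfMeet α :=
    mul_le_mul_of_nonneg_right (by nlinarith) hI
  have h3 : 2 * t * (1 - t) * ∑ A, β A * meetWeight α A ≤ 2 * t * (1 - t) * 1 :=
    mul_le_mul_of_nonneg_left hB (by have := sub_nonneg.2 ht1; positivity)
  nlinarith

theorem inv_le_avg (h : Maximizer s α) {β : Finset (Fin q) → ℝ} (hβ : IsWeight β)
    (hlt : logMean α < logMean β) : 1 / s ≤ ∑ A, β A * meetWeight α A := by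
  by_contra hc
  push Not at hc
  have hI := h.selfMeet_eq hβ hlt
  set B := ∑ A, β A * meetWeight α A with hBd
  have hB := avg_meetWeight_nonneg h.toIsWeight hβ
  rw [← hBd] at hB
  have hs1 : (1 / s : ℝ) ≤ 1 := by
    rw [← hI]; exact avg_meetWeight_le_one h.toIsWeight h.toIsWeight
  have ht0 : 0 < 1 / s - B := sub_pos.2 hc
  have ht1 : 1 / s - B ≤ 1 := by linarith
  have h1 := h.lt_selfMeet_mix hβ hlt ht0 ht1
  rw [hI, ← hBd] at h1
  set t := 1 / s - B with ht
  have e : (1 / s : ℝ) = t + B := by rw [ht]; ring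
  rw [e] at h1 hs1
  nlinarith [mul_pos ht0 ht0, mul_nonneg (mul_nonneg ht0.le ht0.le) hB]

theorem pair_condition (h : Maximizer s α) (hs : 0 < s) {P Q : Finset (Fin q)} (hP : P ≠ ∅)
    (hQ : Q ≠ ∅) {a b : ℝ} (ha : 0 ≤ a) (hb : 0 ≤ b)
    (hpos : 0 < a * (Real.log #P - logMean α) + b * (Real.log #Q - logMean α)) :
    0 ≤ a * (s * meetWeight α P - 1) + b * (s * meetWeight α Q - 1) := by
  classical
  have hab : 0 < a + b := by
    rcases ha.eq_or_lt with h0 | h0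
    · rcases hb.eq_or_lt with h1 | h1
      · rw [← h0, ← h1] at hpos; simp at hpos
      · linarith
    · linarith
  have hs' : (0 : ℝ) < s := by exact_mod_cast hs
  set β : Finset (Fin q) → ℝ := fun A =>
    (a / (a + b)) * (if A = P then 1 else 0) + (b / (a + b)) * (if A = Q then 1 else 0)
  have hsum : ∀ f : Finset (Fin q) → ℝ,
      ∑ A, β A * f A = a / (a + b) * f P + b / (a + b) * f Q := by
    intro f
    simp only [β, add_mul, sum_add_distrib, mul_assoc, ite_mul, one_mul, zero_mul]
    rw [← mul_sum, ← mul_sum, sum_ite_eq' univ P, sum_ite_eq' univ Q, if_pos (mem_univ _),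
      if_pos (mem_univ _)]
  have hβ : IsWeight β := by
    refine ⟨fun A => ?_, ?_, ?_⟩
    · simp only [β]
      split_ifs <;> positivity
    · simp only [β]
      rw [if_neg hP.symm, if_neg hQ.symm]; ring
    · have := hsum fun _ => 1
      simp only [mul_one] at this
      rw [this]
      field_simp
  have hlog : logMean β = logMean α +
      (a * (Real.log #P - logMean α) + b * (Real.log #Q - logMean α)) / (a + b) := by
    rw [logMean, hsum]
    field_simp
    ring
  have h1 := h.inv_le_avg hβ (by rw [hlog]; have := div_pos hpos hab; linarith)
  rw [hsum] at h1
  have e : a / (a + b) * meetWeight α P + b / (a + b) * meetWeight α Q =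
    (a * meetWeight α P + b * meetWeight α Q) / (a + b) := by ring
  rw [e, div_le_div_iff₀ hs' hab] at h1
  linarith

theorem exists_critical (h : Maximizer s α) (p : Params q s K)
    (hobj : balancedLog q s K ≤ logMean α) : ∃ η, Critical q s K α η := by
  classical
  have hs := p.s_pos
  have hsN : 0 < s := by exact_mod_cast hs
  have hq := p.q_pos
  have hqR : (0 : ℝ) < q := by exact_mod_cast hq
  have huniv : (univ : Finset (Fin q)) ≠ ∅ := by
    rw [← Finset.nonempty_iff_ne_empty]
    exact ⟨⟨0, hq⟩, mem_univ _⟩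
  have hupos : 0 < Real.log #(univ : Finset (Fin q)) - logMean α := by
    have h1 := avg_overlapDefect_add_sqrtGap_le h.toIsWeight hsN hq h.meet_le
    have h2 := mul_nonneg hs.le (h.avg_nonneg fun A _ => overlapDefect_nonneg h.toIsWeight A)
    have h3 := h.avg_nonneg (f := fun A => sqrtGap (#A / ((q : ℝ) / s))) fun A hA =>
      sqrtGap_nonneg (div_pos (by exact_mod_cast h.card_pos hA) p.ratio_pos)
    rw [card_univ, Fintype.card_fin]
    have h4 : Real.log ((q : ℝ) / s) < Real.log q := by
      refine Real.log_lt_log p.ratio_pos (div_lt_self hqR ?_)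
      have := p.two_le
      exact_mod_cast this
    linarith
  set u : Finset (Fin q) → ℝ := fun A => Real.log #A - logMean α with hu
  set v : Finset (Fin q) → ℝ := fun A => s * meetWeight α A - 1 with hv
  have hpair : ∀ P Q : Finset (Fin q), P ≠ ∅ → Q ≠ ∅ → ∀ a b : ℝ, 0 ≤ a → 0 ≤ b →
      0 < a * u P + b * u Q → 0 ≤ a * v P + b * v Q := fun P Q hP hQ a b ha hb =>
    h.pair_condition hsN hP hQ ha hb
  set S : Finset (Finset (Fin q)) := univ.filter fun A => A ≠ ∅ ∧ 0 < u A with hS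
  have hSne : S.Nonempty := ⟨univ, by simp only [hS, mem_filter, mem_univ, true_and]; exact ⟨huniv, hupos⟩⟩
  obtain ⟨A₀, hA₀, hmin⟩ := exists_min_image S (fun A => v A / u A) hSne
  obtain ⟨-, hA₀ne, hA₀u⟩ := mem_filter.1 hA₀
  have hv0 : ∀ A, A ≠ ∅ → 0 < u A → 0 ≤ v A := by
    intro A hA hAu
    have := hpair A A hA hA 1 0 zero_le_one le_rfl (by linarith)
    linarith
  refine ⟨v A₀ / u A₀, ⟨p, h.toIsWeight, ?_, hobj, div_nonneg (hv0 A₀ hA₀ne hA₀u) hA₀u.le, ?_⟩⟩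
  · have hw : IsWeight (fun A : Finset (Fin q) => if A = univ then (1 : ℝ) else 0) := by
      refine ⟨fun A => by split_ifs <;> norm_num, by rw [if_neg huniv.symm], by simp⟩
    refine h.selfMeet_eq hw ?_
    have : logMean (fun A : Finset (Fin q) => if A = univ then (1 : ℝ) else 0) =
        Real.log #(univ : Finset (Fin q)) := by
      simp [logMean]
    rw [this]
    linarith
  · intro B hB
    change v A₀ / u A₀ * u B ≤ v B
    rcases lt_or_ge 0 (u B) with hBu | hBu
    · have := hmin B (mem_filter.2 ⟨mem_univ _, hB, hBu⟩)
      rwa [le_div_iff₀ hBu] at this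
    · have h1 : 0 ≤ -u B * v A₀ + u A₀ * v B := by
        by_contra hc
        push Not at hc
        have hvA := hv0 A₀ hA₀ne hA₀u
        set d := -(-u B * v A₀ + u A₀ * v B) with hd
        have hd0 : 0 < d := by rw [hd]; linarith
        have hε : 0 < d / (v A₀ + 1) := by positivity
        have h2 := hpair A₀ B hA₀ne hB (-u B + d / (v A₀ + 1)) (u A₀)
          (by linarith) hA₀u.le (by nlinarith)
        have h3 : d / (v A₀ + 1) * v A₀ < d := by
          rw [div_mul_eq_mul_div, div_lt_iff₀ (by linarith)]
          nlinarith
        rw [add_mul] at h2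
        linarith
      rw [div_mul_eq_mul_div, div_le_iff₀ hA₀u]
      linarith

end Maximizer

/-- Uniqueness of the optimal weights. -/
theorem Params.isTuranWeight (p : Params q s K) (h : IsWeight α) (hI : selfMeet α ≤ 1 / s)
    (hL : balancedLog q s K ≤ logMean α) : IsTuranWeight s α := by
  have hcomp : IsCompact ({α : Finset (Fin q) → ℝ | IsWeight α} ∩ {α | selfMeet α ≤ 1 / s}) :=
    isCompact_isWeight.inter_right (isClosed_le continuous_selfMeet continuous_const)
  obtain ⟨β, hβ, hmax⟩ := hcomp.exists_isMaxOn ⟨α, h, hI⟩ continuous_logMean.continuousOn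
  have hM : Maximizer s β := ⟨hβ.1, hβ.2, fun γ h1 h2 => hmax ⟨h1, h2⟩⟩
  have hβL : balancedLog q s K ≤ logMean β := hL.trans (hM.max α h hI)
  obtain ⟨η, hc⟩ := hM.exists_critical p hβL
  have hle := p.logMean_le_of_isTuranWeight hβ.1 hc.isTuranWeight
  have hM' : Maximizer s α := ⟨h, hI, fun γ h1 h2 => (hM.max γ h1 h2).trans (hle.trans hL)⟩
  obtain ⟨η', hc'⟩ := hM'.exists_critical p hL
  exact hc'.isTuranWeight

/-- Stability of the optimal weights. -/
theorem Params.stability (p : Params q s K) {ε : ℝ} (hε : 0 < ε) : ∃ γ > 0,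
    ∀ α : Finset (Fin q) → ℝ, IsWeight α → selfMeet α ≤ 1 / s + γ →
      balancedLog q s K - γ ≤ logMean α →
      ∃ C : Fin s → Finset (Fin q), (∀ i j, i ≠ j → Disjoint (C i) (C j)) ∧
        (∀ j, (C j).Nonempty) ∧ ∀ j, |α (C j) - 1 / s| ≤ ε := by
  by_contra hcon
  push Not at hcon
  have hex : ∀ k : ℕ, ∃ α : Finset (Fin q) → ℝ, IsWeight α ∧ selfMeet α ≤ 1 / s + 1 / (k + 1) ∧
      balancedLog q s K - 1 / (k + 1) ≤ logMean α ∧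
      ∀ C : Fin s → Finset (Fin q), (∀ i j, i ≠ j → Disjoint (C i) (C j)) →
        (∀ j, (C j).Nonempty) → ∃ j, ε < |α (C j) - 1 / s| := fun k =>
    hcon (1 / (k + 1)) (by positivity)
  choose a ha hI hL hC using hex
  obtain ⟨α, hα, φ, hφ, hlim⟩ := isCompact_isWeight.tendsto_subseq ha
  have hz : Filter.Tendsto (fun k : ℕ => (1 : ℝ) / ((φ k : ℕ) + 1)) Filter.atTop (nhds 0) :=
    tendsto_one_div_add_atTop_nhds_zero_nat.comp hφ.tendsto_atTop
  have hI' : selfMeet α ≤ 1 / s := by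
    have h1 := (continuous_selfMeet.tendsto α).comp hlim
    have h2 := hz.const_add (1 / (s : ℝ))
    rw [add_zero] at h2
    exact le_of_tendsto_of_tendsto' h1 h2 fun k => hI (φ k)
  have hL' : balancedLog q s K ≤ logMean α := by
    have h1 := (continuous_logMean.tendsto α).comp hlim
    have h2 := hz.const_sub (balancedLog q s K)
    rw [sub_zero] at h2
    exact le_of_tendsto_of_tendsto' h2 h1 fun k => hL (φ k)
  obtain ⟨C, hd, hCα⟩ := p.isTuranWeight hα hI' hL'
  have hne : ∀ j, (C j).Nonempty := fun j => by
    have := p.s_pos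
    exact hα.nonempty_of_pos (by rw [hCα]; positivity)
  have hev : ∀ᶠ k in Filter.atTop, ∀ j, |a (φ k) (C j) - 1 / s| < ε := by
    rw [Filter.eventually_all]
    intro j
    have h1 : Filter.Tendsto (fun k => a (φ k) (C j)) Filter.atTop (nhds (1 / (s : ℝ))) := by
      rw [← hCα j]
      exact ((continuous_apply (C j)).tendsto α).comp hlim
    simpa [Real.dist_eq] using (Metric.tendsto_nhds.1 h1) ε hε
  obtain ⟨k, hk⟩ := hev.exists
  obtain ⟨j, hj⟩ := hC (φ k) C hd hne
  exact lt_asymm hj (hk j)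

end Maximizer

/-- The numerical hypotheses hold for large `s` and `q ≥ 100 s² / log s`. -/
theorem exists_params : ∃ s₀ : ℕ, ∀ s : ℕ, s₀ ≤ s → ∀ q : ℕ,
    100 * (s : ℝ) ^ 2 / Real.log s ≤ (q : ℝ) → ∃ K, Params q s K := by
  have h1 : ∀ᶠ x : ℝ in Filter.atTop, 10 ^ 5 * Real.log x ≤ √x := by
    have h2 := (isLittleO_log_rpow_atTop (r := 1 / 2) (by norm_num)).def
      (c := 1 / 10 ^ 5) (by norm_num)
    filter_upwards [h2, Filter.eventually_ge_atTop 1] with x hx hx1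
    rw [Real.norm_of_nonneg (Real.log_nonneg hx1),
      Real.norm_of_nonneg (Real.rpow_nonneg (by linarith) _), ← Real.sqrt_eq_rpow] at hx
    linarith
  obtain ⟨X, hX⟩ := Filter.eventually_atTop.1 h1
  obtain ⟨s₀, hs₀⟩ := exists_nat_ge (max X (10 ^ 20))
  refine ⟨s₀ ^ 2, fun s hs q hq => ⟨q / s, ?_⟩⟩
  have hb : (10 : ℝ) ^ 20 ≤ s₀ := (le_max_right _ _).trans hs₀
  have hsR : (s₀ : ℝ) ^ 2 ≤ s := by exact_mod_cast hs
  have hrt : (s₀ : ℝ) ≤ √s := Real.le_sqrt_of_sq_le hsR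
  have hs1 : (10 : ℝ) ^ 20 ≤ s := by nlinarith
  have hs0 : (0 : ℝ) < s := lt_of_lt_of_le (by norm_num) hs1
  have hsN : 0 < s := by exact_mod_cast hs0
  have hlog0 : 0 < Real.log s := Real.log_pos (lt_of_lt_of_le (by norm_num) hs1)
  have hr0 : 0 < √(s : ℝ) := Real.sqrt_pos.2 hs0
  have hrs : √(s : ℝ) * √s = s := Real.mul_self_sqrt hs0.le
  have hlog2 : Real.log s = 2 * Real.log √s := by
    rw [Real.log_sqrt hs0.le]; ring
  have hlogle : Real.log s ≤ 2 * √s := by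
    have := Real.log_le_sub_one_of_pos hr0
    linarith
  have hmod := Nat.lt_div_mul_add hsN (a := q)
  have hK1 : (q : ℝ) < ((q / s : ℕ) : ℝ) * s + s := by exact_mod_cast hmod
  set K := q / s with hK
  rw [div_le_iff₀ hlog0] at hq
  have hK2 : 100 * (s : ℝ) ≤ (K + 1) * Real.log s := by
    have h3 : 100 * (s : ℝ) ^ 2 ≤ (K * s + s) * Real.log s :=
      hq.trans (mul_le_mul_of_nonneg_right hK1.le hlog0.le)
    have h4 : (100 * (s : ℝ)) * s ≤ ((K + 1) * Real.log s) * s := by linarith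
    exact le_of_mul_le_mul_right h4 hs0
  have hlogs : Real.log s ≤ s := by linarith [Real.log_le_sub_one_of_pos hs0]
  have hK3 : 99 * (s : ℝ) ≤ K * Real.log s := by linarith
  have hKr : √(s : ℝ) ≤ K := by
    have h3 : (K : ℝ) * Real.log s ≤ K * (2 * √s) :=
      mul_le_mul_of_nonneg_left hlogle (Nat.cast_nonneg _)
    have h4 : 49 * √(s : ℝ) * √s ≤ K * √s := by linarith
    have := le_of_mul_le_mul_right h4 hr0
    linarith
  have hlK : Real.log s ≤ 2 * Real.log K := by
    rw [hlog2]
    linarith [Real.log_le_log hr0 hKr]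
  have hKl : (s₀ : ℝ) ≤ K := hrt.trans hKr
  refine ⟨?_, ?_, Nat.div_mul_le_self q s, ?_, ?_, ?_⟩
  · have : (2 : ℝ) ≤ s := le_trans (by norm_num) hs1
    exact_mod_cast this
  · have := hb.trans hKl
    exact_mod_cast this
  · rw [add_mul, one_mul]; exact hmod
  · have := mul_le_mul_of_nonneg_left hlK (Nat.cast_nonneg K : (0 : ℝ) ≤ K)
    linarith
  · exact hX _ ((le_max_left _ _).trans (hs₀.trans hKl))

section Containers

variable {n q : ℕ}

open Classical in
/-- Vertices without a neighbor in `S`. -/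
noncomputable def avoiders (G : SimpleGraph (Fin n)) (S : Finset (Fin n)) : Finset (Fin n) :=
  univ.filter fun v => ∀ u ∈ S, ¬ G.Adj u v

open Classical in
/-- The container of the independent sets with fingerprint `S`. -/
noncomputable def container (G : SimpleGraph (Fin n)) (b : ℝ) (S : Finset (Fin n)) :
    Finset (Fin n) :=
  (avoiders G S).filter fun v => (#((avoiders G S).filter fun w => G.Adj v w) : ℝ) ≤ b * n

theorem exists_fingerprint (G : SimpleGraph (Fin n)) {b : ℝ} (hb : 0 < b) {M : ℕ}
    (hM : 1 ≤ M * b) (I : Finset (Fin n)) (hI : ∀ u ∈ I, ∀ v ∈ I, ¬ G.Adj u v) :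
    ∃ S, #S ≤ M ∧ I ⊆ container G b S := by
  classical
  rcases Nat.eq_zero_or_pos n with hn | hn
  · subst hn
    exact ⟨∅, by simp, fun v => v.elim0⟩
  have hn' : (0 : ℝ) < n := by exact_mod_cast hn
  set P := I.powerset.filter fun S => (#(avoiders G S) : ℝ) + #S * (b * n) ≤ n with hP
  have hne : P.Nonempty := ⟨∅, by
    simp only [hP, mem_filter, mem_powerset, empty_subset, true_and, card_empty]
    have : #(avoiders G ∅) ≤ n := (card_le_univ _).trans_eq (Fintype.card_fin n)
    have : (#(avoiders G ∅) : ℝ) ≤ n := by exact_mod_cast this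
    simpa using this⟩
  obtain ⟨S, hS, hmax⟩ := exists_max_image P card hne
  obtain ⟨hSI, hSc⟩ := mem_filter.1 hS
  rw [mem_powerset] at hSI
  refine ⟨S, ?_, ?_⟩
  · have h1 : (#S : ℝ) * b * n ≤ 1 * n := by
      have : (0 : ℝ) ≤ #(avoiders G S) := Nat.cast_nonneg _
      linarith
    have h2 := le_of_mul_le_mul_right h1 hn'
    have h3 : (#S : ℝ) * b ≤ M * b := h2.trans hM
    have h4 := le_of_mul_le_mul_right h3 hb
    exact_mod_cast h4
  · intro v hv
    have hva : v ∈ avoiders G S := by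
      simp only [avoiders, mem_filter, mem_univ, true_and]
      exact fun u hu => hI u (hSI hu) v hv
    refine mem_filter.2 ⟨hva, ?_⟩
    by_contra hc
    push Not at hc
    have hvS : v ∉ S := by
      intro hvS
      have : (avoiders G S).filter (fun w => G.Adj v w) = ∅ := by
        rw [filter_eq_empty_iff]
        intro w hw
        exact (mem_filter.1 hw).2 v hvS
      rw [this, card_empty, Nat.cast_zero] at hc
      have := mul_pos hb hn'
      linarith
    have hsub : avoiders G (insert v S) = (avoiders G S).filter fun w => ¬ G.Adj v w := by
      ext w
      simp only [avoiders, mem_filter, mem_univ, true_and, mem_insert, forall_eq_or_imp]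
      tauto
    have hcard := card_filter_add_card_filter_not (s := avoiders G S) (fun w => G.Adj v w)
    have hcR : (#((avoiders G S).filter fun w => G.Adj v w) : ℝ) +
        #((avoiders G S).filter fun w => ¬ G.Adj v w) = #(avoiders G S) := by
      exact_mod_cast hcard
    have hmem : insert v S ∈ P := by
      refine mem_filter.2 ⟨mem_powerset.2 (insert_subset hv hSI), ?_⟩
      rw [hsub, card_insert_of_notMem hvS]
      push_cast
      linarith
    have := hmax _ hmem
    rw [card_insert_of_notMem hvS] at this
    omega

open Classical in
theorem card_adj_container_le (G : SimpleGraph (Fin n)) (b : ℝ) (hb : 0 ≤ b)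
    (S : Finset (Fin n)) :
    (#(univ.filter fun p : Fin n × Fin n =>
      G.Adj p.1 p.2 ∧ p.1 ∈ container G b S ∧ p.2 ∈ container G b S) : ℝ) ≤ b * n ^ 2 := by
  have h1 : (univ.filter fun p : Fin n × Fin n =>
      G.Adj p.1 p.2 ∧ p.1 ∈ container G b S ∧ p.2 ∈ container G b S) ⊆
      ((container G b S).sigma (fun v => (avoiders G S).filter fun w => G.Adj v w)).map
        (Equiv.sigmaEquivProd (Fin n) (Fin n)).toEmbedding := by
    rintro ⟨u, v⟩ h
    obtain ⟨-, h2, h3, h4⟩ := mem_filter.1 h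
    refine mem_map.2 ⟨⟨u, v⟩, mem_sigma.2 ⟨h3, mem_filter.2 ⟨(mem_filter.1 h4).1, h2⟩⟩, rfl⟩
  have h2 := card_le_card h1
  rw [card_map, card_sigma] at h2
  have h3 : (∑ v ∈ container G b S, #((avoiders G S).filter fun w => G.Adj v w) : ℝ) ≤
      ∑ v ∈ container G b S, b * n :=
    sum_le_sum fun v hv => (mem_filter.1 hv).2
  rw [sum_const, nsmul_eq_mul] at h3
  have h4 : (#(container G b S) : ℝ) ≤ n := by
    exact_mod_cast (card_le_univ _).trans_eq (Fintype.card_fin n)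
  have h5 : (#(container G b S) : ℝ) * (b * n) ≤ n * (b * n) :=
    mul_le_mul_of_nonneg_right h4 (by positivity)
  refine (Nat.cast_le.2 h2).trans ?_
  push_cast
  linarith

/-- The vertices named by a list of fingerprint entries. -/
noncomputable def decodeFingerprint {M : ℕ} (φ : Fin M → Option (Fin n)) : Finset (Fin n) := by
  classical exact univ.filter fun v => ∃ i, φ i = some v

theorem exists_decodeFingerprint_eq {M : ℕ} {S : Finset (Fin n)} (hS : #S ≤ M) :
    ∃ φ : Fin M → Option (Fin n), decodeFingerprint φ = S := by
  classical
  refine ⟨fun i => if h : (i : ℕ) < #S then some (S.equivFin.symm ⟨i, h⟩ : Fin n) else none, ?_⟩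
  ext v
  simp only [decodeFingerprint, mem_filter, mem_univ, true_and]
  constructor
  · rintro ⟨i, hi⟩
    split_ifs at hi with h
    rw [← Option.some_inj.1 hi]
    exact (S.equivFin.symm ⟨i, h⟩).2
  · intro hv
    refine ⟨⟨S.equivFin ⟨v, hv⟩, (S.equivFin ⟨v, hv⟩).2.trans_le hS⟩, ?_⟩
    simp

open Classical in
/-- The number of colorings is controlled by lists of colors which are nearly disjoint on edges. -/
theorem exists_color_lists (G : SimpleGraph (Fin n)) (q : ℕ) {b : ℝ} (hb : 0 < b) {M : ℕ}
    (hM : 1 ≤ M * b) : ∃ F : Fin n → Finset (Fin q),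
      (numColorings q G : ℝ) ≤ ((n : ℝ) + 1) ^ (M * q) * ∏ v, (#(F v) : ℝ) ∧
      (#(univ.filter fun p : Fin n × Fin n =>
        G.Adj p.1 p.2 ∧ ¬ Disjoint (F p.1) (F p.2)) : ℝ) ≤ q * b * n ^ 2 := by
  let L : (Fin q → Fin M → Option (Fin n)) → Fin n → Finset (Fin q) := fun Φ v =>
    univ.filter fun i => v ∈ container G b (decodeFingerprint (Φ i))
  obtain ⟨Φ, -, hΦ⟩ := exists_max_image (univ : Finset (Fin q → Fin M → Option (Fin n)))
    (fun Φ => ∏ v, #(L Φ v)) ⟨fun _ _ => none, mem_univ _⟩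
  refine ⟨L Φ, ?_, ?_⟩
  · have hfp : ∀ f : Fin n → Fin q, ∃ Ψ : Fin q → Fin M → Option (Fin n),
        (∀ v w, G.Adj v w → f v ≠ f w) → ∀ v, f v ∈ L Ψ v := by
      intro f
      by_cases hf : ∀ v w, G.Adj v w → f v ≠ f w
      · have : ∀ i, ∃ ψ : Fin M → Option (Fin n),
            (univ.filter fun v => f v = i) ⊆ container G b (decodeFingerprint ψ) := by
          intro i
          obtain ⟨S, hS, hsub⟩ := exists_fingerprint G hb hM (univ.filter fun v => f v = i) (by
            intro u hu v hv huv
            exact hf u v huv ((mem_filter.1 hu).2.trans (mem_filter.1 hv).2.symm))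
          obtain ⟨ψ, rfl⟩ := exists_decodeFingerprint_eq hS
          exact ⟨ψ, hsub⟩
        choose Ψ hΨ using this
        exact ⟨Ψ, fun _ v => mem_filter.2 ⟨mem_univ _, hΨ _ (mem_filter.2 ⟨mem_univ _, rfl⟩)⟩⟩
      · exact ⟨fun _ _ => none, fun h => absurd h hf⟩
    choose Ψ hΨ using hfp
    have h1 : numColorings q G ≤
        #((univ : Finset (Fin q → Fin M → Option (Fin n))).biUnion fun Φ =>
          Fintype.piFinset (L Φ)) := by
      rw [numColorings, Nat.card_eq_fintype_card, Fintype.card_subtype]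
      refine card_le_card fun f hf => ?_
      refine mem_biUnion.2 ⟨Ψ f, mem_univ _, ?_⟩
      exact Fintype.mem_piFinset.2 (hΨ f (mem_filter.1 hf).2)
    have h2 : numColorings q G ≤ (n + 1) ^ (M * q) * ∏ v, #(L Φ v) := by
      refine h1.trans (card_biUnion_le.trans ?_)
      refine (sum_le_card_nsmul univ _ (∏ v, #(L Φ v)) fun Ψ _ => ?_).trans ?_
      · rw [Fintype.card_piFinset]
        exact hΦ Ψ (mem_univ _)
      · rw [smul_eq_mul, card_univ]
        simp [pow_mul]
    exact_mod_cast h2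
  · have h1 : (univ.filter fun p : Fin n × Fin n =>
        G.Adj p.1 p.2 ∧ ¬ Disjoint (L Φ p.1) (L Φ p.2)) ⊆
        (univ : Finset (Fin q)).biUnion fun i => univ.filter fun p : Fin n × Fin n =>
          G.Adj p.1 p.2 ∧ p.1 ∈ container G b (decodeFingerprint (Φ i)) ∧
            p.2 ∈ container G b (decodeFingerprint (Φ i)) := by
      intro p hp
      obtain ⟨-, hadj, hd⟩ := mem_filter.1 hp
      obtain ⟨i, hi1, hi2⟩ := Finset.not_disjoint_iff.1 hd
      exact mem_biUnion.2 ⟨i, mem_univ _, mem_filter.2 ⟨mem_univ _, hadj,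
        (mem_filter.1 hi1).2, (mem_filter.1 hi2).2⟩⟩
    have h2 := (card_le_card h1).trans card_biUnion_le
    refine (Nat.cast_le.2 h2).trans ?_
    push_cast
    refine (sum_le_sum fun i _ => card_adj_container_le G b hb.le _).trans ?_
    rw [sum_const, card_univ, Fintype.card_fin, nsmul_eq_mul]
    linarith

end Containers

section Pairs

variable {n q : ℕ}

open Classical in
theorem card_adj_pairs (G : SimpleGraph (Fin n)) :
    #(univ.filter fun p : Fin n × Fin n => G.Adj p.1 p.2) = 2 * numEdges G := by
  rw [numEdges, Nat.card_eq_fintype_card, ← edgeFinset_card, ← G.sum_degrees_eq_twice_card_edges,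
    ← univ_product_univ, card_filter, sum_product]
  refine sum_congr rfl fun v _ => ?_
  rw [← card_filter, ← card_neighborFinset_eq_degree]
  congr 1
  ext w
  simp

open Classical in
/-- A graph with few overlapping lists has a subgraph with `m` edges, colorable from the lists. -/
theorem exists_graph_prod_le (f : Fin n → Finset (Fin q)) (hf : ∀ v, (f v).Nonempty) {m : ℕ}
    (hm : 2 * m + #(univ.filter fun p : Fin n × Fin n => ¬ Disjoint (f p.1) (f p.2)) ≤ n ^ 2) :
    ∃ H : SimpleGraph (Fin n), numEdges H = m ∧ ∏ v, #(f v) ≤ numColorings q H := by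
  let D : SimpleGraph (Fin n) :=
    { Adj := fun u v => Disjoint (f u) (f v)
      symm := ⟨fun u v h => h.symm⟩
      loopless := ⟨fun v h => (hf v).ne_empty (disjoint_self.1 h)⟩ }
  have h1 : #(univ.filter fun p : Fin n × Fin n => Disjoint (f p.1) (f p.2)) =
      2 * numEdges D := by
    convert card_adj_pairs D
  have h2 := card_filter_add_card_filter_not (s := (univ : Finset (Fin n × Fin n)))
    (fun p => Disjoint (f p.1) (f p.2))
  rw [card_univ, Fintype.card_prod, Fintype.card_fin, ← pow_two] at h2
  have h4 : m ≤ #D.edgeFinset := by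
    rw [edgeFinset_card, ← Nat.card_eq_fintype_card]
    change m ≤ numEdges D
    omega
  obtain ⟨E, hE, hcard⟩ := exists_subset_card_eq h4
  have hED : (E : Set (Sym2 (Fin n))) ⊆ D.edgeSet := by
    intro e he
    exact mem_edgeFinset.1 (hE he)
  refine ⟨fromEdgeSet E, ?_, ?_⟩
  · rw [numEdges, edgeSet_fromEdgeSet]
    have h5 : (E : Set (Sym2 (Fin n))) \ Sym2.diagSet = E := by
      refine sdiff_eq_left.2 (Set.disjoint_left.2 fun e he hd => ?_)
      exact D.not_isDiag_of_mem_edgeSet (hED he) hd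
    rw [h5]
    simp [hcard]
  · rw [← Fintype.card_piFinset, numColorings, Nat.card_eq_fintype_card, Fintype.card_subtype]
    refine card_le_card fun c hc => mem_filter.2 ⟨mem_univ _, fun v w hvw hcvw => ?_⟩
    rw [Fintype.mem_piFinset] at hc
    have hd : Disjoint (f v) (f w) := by
      have : s(v, w) ∈ D.edgeSet := hED (fromEdgeSet_adj _ |>.1 hvw).1
      exact this
    exact disjoint_left.1 hd (hc v) (hcvw ▸ hc w)

end Pairs

section Residues

variable {n q s K : ℕ}

/-- The indices with residue `j` modulo `s`. -/
def residueClass (n s j : ℕ) : Finset (Fin n) := univ.filter fun v => (v : ℕ) % s = j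

theorem mem_residueClass {j : ℕ} {v : Fin n} : v ∈ residueClass n s j ↔ (v : ℕ) % s = j := by
  simp [residueClass]

theorem card_residueClass (n : ℕ) {s j : ℕ} (hj : j < s) :
    n / s ≤ #(residueClass n s j) ∧ #(residueClass n s j) ≤ n / s + 1 := by
  have h1 : #(residueClass n s j) = n.count (· ≡ j [MOD s]) := by
    rw [Nat.count_eq_card_filter_range]
    refine card_bij (fun v _ => (v : ℕ)) ?_ ?_ ?_
    · intro v hv
      rw [mem_residueClass] at hv
      simp [Nat.ModEq, hv, Nat.mod_eq_of_lt hj]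
    · intro u _ v _ h
      exact Fin.ext h
    · intro v hv
      simp only [mem_filter, mem_range, Nat.ModEq, Nat.mod_eq_of_lt hj] at hv
      exact ⟨⟨v, hv.1⟩, mem_residueClass.2 hv.2, rfl⟩
  rw [h1, Nat.count_modEq_card _ (by omega)]
  split_ifs <;> omega

theorem card_residueClass_le (n : ℕ) {s j : ℕ} (hj : j < s) :
    (#(residueClass n s j) : ℝ) ≤ (n : ℝ) / s + 1 := by
  have h1 : (#(residueClass n s j) : ℝ) ≤ ((n / s : ℕ) : ℝ) + 1 := by
    exact_mod_cast (card_residueClass n hj).2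
  exact h1.trans (by gcongr; exact Nat.cast_div_le)

theorem le_card_residueClass (n : ℕ) {s j : ℕ} (hj : j < s) :
    (n : ℝ) / s - 1 ≤ #(residueClass n s j) := by
  have h1 : ((n / s : ℕ) : ℝ) ≤ #(residueClass n s j) := by
    exact_mod_cast (card_residueClass n hj).1
  have h2 : (n : ℝ) / s < ((n / s : ℕ) : ℝ) + 1 := by
    rw [div_lt_iff₀ (by exact_mod_cast (by omega : 0 < s))]
    exact_mod_cast Nat.lt_mul_of_div_lt (Nat.lt_succ_self (n / s)) (by omega)
  linarith

theorem sum_card_residueClass (n : ℕ) {s : ℕ} (hs : 0 < s) :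
    ∑ j ∈ range s, #(residueClass n s j) = n := by
  have := card_eq_sum_card_fiberwise (s := (univ : Finset (Fin n))) (t := range s)
    (f := fun v : Fin n => (v : ℕ) % s) (fun v _ => by simpa using Nat.mod_lt _ hs)
  rw [card_univ, Fintype.card_fin] at this
  exact this.symm

theorem card_block {a b : ℕ} (hs : 0 < s) (hb : b * s ≤ n) :
    #(univ.filter fun v : Fin n => (v : ℕ) % s = 0 ∧ a ≤ (v : ℕ) / s ∧ (v : ℕ) / s < b) =
      b - a := by
  rw [← Nat.card_Ico]
  refine card_bij (fun v _ => (v : ℕ) / s) ?_ ?_ ?_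
  · intro v hv
    simpa using (mem_filter.1 hv).2.2
  · intro u hu v hv h
    have h1 := Nat.div_add_mod (u : ℕ) s
    have h2 := Nat.div_add_mod (v : ℕ) s
    rw [(mem_filter.1 hu).2.1] at h1
    rw [(mem_filter.1 hv).2.1] at h2
    refine Fin.ext ?_
    rw [← h1, ← h2, h]
  · intro i hi
    rw [mem_Ico] at hi
    have h1 : i * s < n := (Nat.mul_lt_mul_of_pos_right hi.2 hs).trans_le hb
    refine ⟨⟨i * s, h1⟩, ?_, by simp [hs]⟩
    simp [Nat.mul_div_cancel _ hs, hi]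

/-- Few pairs share their residue. -/
theorem card_same_residue_le (n : ℕ) {s : ℕ} (hs : 0 < s) :
    (#(univ.filter fun p : Fin n × Fin n => (p.1 : ℕ) % s = (p.2 : ℕ) % s) : ℝ) ≤
      (n : ℝ) ^ 2 / s + n := by
  have h1 : #(univ.filter fun p : Fin n × Fin n => (p.1 : ℕ) % s = (p.2 : ℕ) % s) =
      ∑ u : Fin n, #(residueClass n s ((u : ℕ) % s)) := by
    rw [← univ_product_univ, card_filter, sum_product]
    refine sum_congr rfl fun u _ => ?_
    rw [← card_filter, residueClass]
    congr 1
    ext v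
    simp [eq_comm]
  rw [h1]
  push_cast
  refine (sum_le_sum fun u _ => card_residueClass_le n (Nat.mod_lt _ hs)).trans ?_
  rw [sum_const, card_univ, Fintype.card_fin, nsmul_eq_mul]
  apply le_of_eq
  ring

theorem log_card_residueClass (p : Params q s K) {j : ℕ} (hj : j < s) :
    Real.log (#(residueClass q s j) : ℝ) =
      Real.log K + Real.log (1 + 1 / K) * (#(residueClass q s j) - K) := by
  have hK : q / s = K := by
    refine Nat.div_eq_of_lt_le p.mul_le ?_
    have := p.lt_mul
    simpa using this
  have hK0 := p.K_pos
  obtain ⟨h1, h2⟩ := card_residueClass q hj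
  rw [hK] at h1 h2
  rcases Nat.eq_or_lt_of_le h1 with h | h
  · rw [← h]; simp
  · have h3 : #(residueClass q s j) = K + 1 := by omega
    rw [h3]
    push_cast
    rw [add_sub_cancel_left, mul_one, ← Real.log_mul hK0.ne' (by positivity)]
    congr 1
    field_simp

theorem sum_log_card_residueClass (p : Params q s K) :
    ∑ j ∈ range s, Real.log (#(residueClass q s j) : ℝ) = s * balancedLog q s K := by
  rw [sum_congr rfl fun j hj => log_card_residueClass p (mem_range.1 hj)]
  have h := sum_card_residueClass q (s := s) (by have := p.two_le; omega)
  have h' : ∑ j ∈ range s, (#(residueClass q s j) : ℝ) = q := by exact_mod_cast h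
  rw [sum_add_distrib, ← mul_sum, sum_sub_distrib, h', balancedLog]
  have := p.s_pos
  simp only [sum_const, card_range, nsmul_eq_mul]
  field_simp

theorem residueClass_nonempty (p : Params q s K) {j : ℕ} (hj : j < s) :
    (residueClass q s j).Nonempty := by
  have h1 := (card_residueClass q hj).1
  have h2 : K ≤ q / s := (Nat.le_div_iff_mul_le (by omega)).2 p.mul_le
  have := p.large
  rw [← card_pos]
  omega

theorem sum_log_residue_ge (p : Params q s K) (n : ℕ) :
    ((n : ℝ) - s) * balancedLog q s K ≤
      ∑ v : Fin n, Real.log (#(residueClass q s ((v : ℕ) % s)) : ℝ) := by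
  have hs : 0 < s := by have := p.two_le; omega
  rw [← sum_fiberwise_of_maps_to (s := (univ : Finset (Fin n))) (t := range s)
    (g := fun v : Fin n => (v : ℕ) % s) (fun v _ => by simpa using Nat.mod_lt _ hs)]
  have h1 : ∀ j ∈ range s, ((n : ℝ) / s - 1) * Real.log (#(residueClass q s j) : ℝ) ≤
      ∑ v ∈ univ.filter (fun v : Fin n => (v : ℕ) % s = j), Real.log (#(residueClass q s ((v : ℕ) % s)) : ℝ) := by
    intro j hj
    rw [mem_range] at hj
    rw [sum_congr rfl (g := fun _ => Real.log (#(residueClass q s j) : ℝ))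
      (fun v hv => by rw [(mem_filter.1 hv).2]), sum_const, nsmul_eq_mul]
    exact mul_le_mul_of_nonneg_right (le_card_residueClass n hj) (Real.log_natCast_nonneg _)
  refine le_trans (le_of_eq ?_) (sum_le_sum h1)
  rw [← mul_sum, sum_log_card_residueClass p]
  have := p.s_pos
  field_simp

end Residues

section LowerBound

variable {n q s K : ℕ}

/-- Color lists which are constant on residue classes, except on two blocks of `w` vertices of
residue zero. -/
def blockLists (n q s w : ℕ) (a b : Fin q) (v : Fin n) : Finset (Fin q) :=
  if (v : ℕ) % s = 0 ∧ (v : ℕ) / s < w then {a}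
  else if (v : ℕ) % s = 0 ∧ (v : ℕ) / s < 2 * w then {b}
  else residueClass q s ((v : ℕ) % s)

/-- Lower bound for the maximum number of colorings, slightly above the Turán density. -/
theorem exists_graph_numColorings_ge (p : Params q s K) {n m w : ℕ} (hw : 2 * w * s ≤ n)
    (hm : 2 * (m : ℝ) + (n : ℝ) ^ 2 / s + n ≤ (n : ℝ) ^ 2 + (w : ℝ) ^ 2) :
    ∃ H : SimpleGraph (Fin n), numEdges H = m ∧
      Real.exp (((n : ℝ) - s) * balancedLog q s K - 2 * w * Real.log q) ≤ numColorings q H := by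
  classical
  have hs : 0 < s := by have := p.two_le; omega
  have hq := p.q_pos
  have hsq : s < q := by
    have h1 := p.mul_le
    have h2 := p.large
    have h3 := Nat.mul_le_mul_right s (show 2 ≤ K by omega)
    omega
  set a : Fin q := ⟨0, hq⟩ with ha
  set b : Fin q := ⟨s, hsq⟩ with hb
  have hab : a ≠ b := by
    intro h
    have := congrArg Fin.val h
    simp [ha, hb] at this
    omega
  set f := blockLists n q s w a b with hf
  have hne : ∀ v, (f v).Nonempty := by
    intro v
    simp only [hf, blockLists]
    split_ifs
    · exact singleton_nonempty _
    · exact singleton_nonempty _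
    · exact residueClass_nonempty p (Nat.mod_lt _ hs)
  have hsub : ∀ v, f v ⊆ residueClass q s ((v : ℕ) % s) := by
    intro v
    simp only [hf, blockLists]
    split_ifs with h1 h2
    · rw [singleton_subset_iff, mem_residueClass, h1.1]; simp [ha]
    · rw [singleton_subset_iff, mem_residueClass, h2.1]; simp [hb]
    · exact Subset.rfl
  set S : Finset (Fin n) := univ.filter fun v : Fin n =>
    (v : ℕ) % s = 0 ∧ 0 ≤ (v : ℕ) / s ∧ (v : ℕ) / s < w with hS
  set T : Finset (Fin n) := univ.filter fun v : Fin n =>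
    (v : ℕ) % s = 0 ∧ w ≤ (v : ℕ) / s ∧ (v : ℕ) / s < 2 * w with hT
  have hScard : #S = w := card_block hs (by nlinarith)
  have hTcard : #T = w := (card_block hs hw).trans (by omega)
  have hpairs : #(univ.filter fun p : Fin n × Fin n => ¬ Disjoint (f p.1) (f p.2)) + w * w ≤
      #(univ.filter fun p : Fin n × Fin n => (p.1 : ℕ) % s = (p.2 : ℕ) % s) := by
    have hd : Disjoint (univ.filter fun p : Fin n × Fin n => ¬ Disjoint (f p.1) (f p.2))
        (S ×ˢ T) := by
      refine disjoint_left.2 ?_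
      rintro ⟨u, v⟩ h1 h2
      obtain ⟨hu, hv⟩ := mem_product.1 h2
      have hu' := (mem_filter.1 hu).2
      have hv' := (mem_filter.1 hv).2
      refine (mem_filter.1 h1).2 ?_
      dsimp only at hu' hv' ⊢
      have h3 : f u = {a} := by simp [hf, blockLists, hu'.1, hu'.2.2]
      have h4 : f v = {b} := by
        simp only [hf, blockLists]
        rw [if_neg (by omega), if_pos ⟨hv'.1, hv'.2.2⟩]
      rw [h3, h4]
      simpa using hab
    have h1 := card_union_of_disjoint hd
    rw [card_product, hScard, hTcard] at h1
    rw [← h1]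
    refine card_le_card (union_subset ?_ ?_)
    · rintro ⟨u, v⟩ h
      obtain ⟨i, hi, hj⟩ := not_disjoint_iff.1 (mem_filter.1 h).2
      refine mem_filter.2 ⟨mem_univ _, ?_⟩
      exact (mem_residueClass.1 (hsub u hi)).symm.trans (mem_residueClass.1 (hsub v hj))
    · rintro ⟨u, v⟩ h
      obtain ⟨hu, hv⟩ := mem_product.1 h
      exact mem_filter.2 ⟨mem_univ _, (mem_filter.1 hu).2.1.trans (mem_filter.1 hv).2.1.symm⟩
  have hpairsR : (#(univ.filter fun p : Fin n × Fin n => ¬ Disjoint (f p.1) (f p.2)) : ℝ) +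
      w * w ≤ (n : ℝ) ^ 2 / s + n := by
    refine le_trans ?_ (card_same_residue_le n hs)
    exact_mod_cast hpairs
  obtain ⟨H, hH, hcol⟩ := exists_graph_prod_le f hne (m := m) (by
    have : 2 * (m : ℝ) + #(univ.filter fun p : Fin n × Fin n => ¬ Disjoint (f p.1) (f p.2)) ≤
        (n : ℝ) ^ 2 := by nlinarith
    exact_mod_cast this)
  refine ⟨H, hH, le_trans ?_ (Nat.cast_le.2 hcol)⟩
  have hcardpos : ∀ v, (0 : ℝ) < #(f v) := fun v => by exact_mod_cast card_pos.2 (hne v)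
  have hlog : ∀ v : Fin n, Real.log (#(residueClass q s ((v : ℕ) % s)) : ℝ) -
      (if v ∈ S ∪ T then Real.log q else 0) ≤ Real.log (#(f v) : ℝ) := by
    intro v
    split_ifs with h
    · have h1 : Real.log (#(residueClass q s ((v : ℕ) % s)) : ℝ) ≤ Real.log q := by
        refine Real.log_le_log ?_ ?_
        · exact_mod_cast card_pos.2 (residueClass_nonempty p (Nat.mod_lt _ hs))
        · exact_mod_cast (card_le_univ _).trans_eq (Fintype.card_fin q)
      have := Real.log_natCast_nonneg (#(f v))
      linarith
    · have h1 : f v = residueClass q s ((v : ℕ) % s) := by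
        simp only [mem_union, hS, hT, mem_filter, mem_univ, true_and, not_or] at h
        have h0 := Nat.zero_le ((v : ℕ) / s)
        simp only [hf, blockLists]
        rw [if_neg (by omega), if_neg (by omega)]
      rw [h1, sub_zero]
  push_cast
  rw [← Real.exp_log (prod_pos fun v _ => hcardpos v), Real.log_prod fun v _ => (hcardpos v).ne']
  refine Real.exp_le_exp.2 (le_trans ?_ (sum_le_sum fun v _ => hlog v))
  rw [sum_sub_distrib, ← sum_filter, sum_const, nsmul_eq_mul, filter_mem_eq_inter, univ_inter]
  have h1 := sum_log_residue_ge p n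
  have h2 : (#(S ∪ T) : ℝ) ≤ 2 * w := by
    have := card_union_le S T
    rw [hScard, hTcard] at this
    exact_mod_cast this.trans_eq (by ring)
  have h3 := mul_le_mul_of_nonneg_right h2 (Real.log_natCast_nonneg q)
  linarith

end LowerBound

section Arrangement

variable {n q s : ℕ}

/-- Nearly balanced disjoint classes can be nearly aligned with the residue classes. -/
theorem exists_perm_aligned (V : Fin s → Finset (Fin n))
    (hV : ∀ i j v, v ∈ V i → v ∈ V j → i = j) {t : ℝ} (ht : 0 ≤ t)
    (hcard : ∀ j, (#(V j) : ℝ) ≤ n / s + t) : ∃ π : Equiv.Perm (Fin n),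
      ∀ j : Fin s, (#((V j).filter fun v => ¬ (π v : ℕ) % s = j) : ℝ) ≤ t + 1 := by
  classical
  obtain ⟨π, -, hπ⟩ := exists_max_image (univ : Finset (Equiv.Perm (Fin n)))
    (fun π => #(univ.filter fun v => ∃ j, v ∈ V j ∧ (π v : ℕ) % s = j)) ⟨1, mem_univ _⟩
  refine ⟨π, fun j => ?_⟩
  by_cases hout : ∃ u, u ∉ V j ∧ (π u : ℕ) % s = j
  · obtain ⟨u, huV, hu⟩ := hout
    have hempty : (V j).filter (fun v => ¬ (π v : ℕ) % s = j) = ∅ := by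
      rw [filter_eq_empty_iff]
      intro v hvV hv
      refine absurd (hπ (π.trans (Equiv.swap (π v) (π u))) (mem_univ _)) (not_le.2 ?_)
      refine card_lt_card (Finset.ssubset_iff_subset_ne.2 ⟨?_, ?_⟩)
      · intro x hx
        obtain ⟨i, hxi, hxr⟩ := (mem_filter.1 hx).2
        have hxv : x ≠ v := by
          rintro rfl
          obtain rfl := hV _ _ _ hxi hvV
          exact hv hxr
        have hxu : x ≠ u := by
          rintro rfl
          have : i = j := Fin.ext (hxr.symm.trans hu)
          exact huV (this ▸ hxi)
        refine mem_filter.2 ⟨mem_univ _, i, hxi, ?_⟩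
        rw [Equiv.trans_apply, Equiv.swap_apply_of_ne_of_ne (π.injective.ne hxv)
          (π.injective.ne hxu)]
        exact hxr
      · intro h
        have hv' : v ∈ univ.filter fun v => ∃ j, v ∈ V j ∧ (π v : ℕ) % s = j := by
          rw [h]
          refine mem_filter.2 ⟨mem_univ _, j, hvV, ?_⟩
          rw [Equiv.trans_apply, Equiv.swap_apply_left]
          exact hu
        obtain ⟨i, hvi, hvr⟩ := (mem_filter.1 hv').2
        obtain rfl := hV _ _ _ hvi hvV
        exact hv hvr
    rw [hempty, card_empty, Nat.cast_zero]
    linarith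
  · push Not at hout
    have h1 : (n : ℝ) / s - 1 ≤ #((V j).filter fun v => (π v : ℕ) % s = j) := by
      refine (le_card_residueClass n j.2).trans ?_
      refine Nat.cast_le.2 ?_
      rw [← card_map π.symm.toEmbedding]
      refine card_le_card fun v hv => ?_
      obtain ⟨x, hx, rfl⟩ := mem_map.1 hv
      have hx' : (π (π.symm x) : ℕ) % s = j := by
        rw [Equiv.apply_symm_apply]; exact mem_residueClass.1 hx
      refine mem_filter.2 ⟨?_, hx'⟩
      by_contra hn
      exact hout _ hn hx'
    have h2 : (#((V j).filter fun v => (π v : ℕ) % s = j) : ℝ) +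
        #((V j).filter fun v => ¬ (π v : ℕ) % s = j) = #(V j) := by
      exact_mod_cast card_filter_add_card_filter_not _
    have := hcard j
    linarith

open Classical in
/-- The edit distance is at most the number of ordered pairs whose adjacency changes. -/
theorem card_symmDiff_edgeSet_le (G H : SimpleGraph (Fin n)) (π : Equiv.Perm (Fin n)) :
    Nat.card ↥(symmDiff (G.comap π.symm.toEmbedding).edgeSet H.edgeSet) ≤
      #(univ.filter fun p : Fin n × Fin n => ¬ (G.Adj p.1 p.2 ↔ H.Adj (π p.1) (π p.2))) := by
  rw [Nat.card_coe_set_eq]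
  refine le_trans ?_ (card_image_le (f := fun p : Fin n × Fin n => s(π p.1, π p.2)))
  rw [← Set.ncard_coe_finset]
  refine Set.ncard_le_ncard ?_ (finite_toSet _)
  intro e
  induction e with
  | h x y =>
    intro h
    rw [mem_coe, mem_image]
    refine ⟨(π.symm x, π.symm y), mem_filter.2 ⟨mem_univ _, ?_⟩, by simp⟩
    rw [Set.mem_symmDiff] at h
    simp only [mem_edgeSet, comap_adj, Equiv.coe_toEmbedding] at h
    simp only [Equiv.apply_symm_apply]
    tauto

open Classical in
/-- If the color lists of a graph of Turán density are mostly the members of a family of disjoint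
sets, equally often, then the graph is close to the Turán graph. -/
theorem editClose_turanGraph (G : SimpleGraph (Fin n)) (hs : 0 < s) (F : Fin n → Finset (Fin q))
    (C : Fin s → Finset (Fin q)) (hC : ∀ i j, i ≠ j → Disjoint (C i) (C j))
    (hne : ∀ j, (C j).Nonempty) {t β σ : ℝ} (ht : 0 ≤ t)
    (hcard : ∀ j, |(#(univ.filter fun v => F v = C j) : ℝ) - n / s| ≤ t)
    (hadj : (#(univ.filter fun p : Fin n × Fin n =>
      G.Adj p.1 p.2 ∧ ¬ Disjoint (F p.1) (F p.2)) : ℝ) ≤ β)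
    (hedges : (n : ℝ) ^ 2 - (n : ℝ) ^ 2 / s - σ ≤ 2 * numEdges G) :
    EditClose (2 * s * (2 * t + 1) * n + 2 * t * n + 2 * β + σ) G (turanGraph n s) := by
  have hs' : (0 : ℝ) < s := by exact_mod_cast hs
  set V : Fin s → Finset (Fin n) := fun j => univ.filter fun v => F v = C j with hVdef
  have hCinj : ∀ i j, C i = C j → i = j := by
    intro i j h
    by_contra hij
    have := hC i j hij
    rw [h, disjoint_self] at this
    exact (hne j).ne_empty this
  have hV : ∀ i j v, v ∈ V i → v ∈ V j → i = j := fun i j v hi hj =>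
    hCinj i j ((mem_filter.1 hi).2.symm.trans (mem_filter.1 hj).2)
  obtain ⟨π, hπ⟩ := exists_perm_aligned V hV ht fun j => by
    have := (abs_le.1 (hcard j)).2
    linarith
  refine ⟨G.comap π.symm.toEmbedding, ⟨(Iso.comap π.symm G).symm⟩, ?_⟩
  obtain ⟨T, hT⟩ : ∃ T, T = turanGraph n s := ⟨_, rfl⟩
  rw [← hT]
  refine (Nat.cast_le.2 (card_symmDiff_edgeSet_le G T π)).trans ?_
  set good : Finset (Fin n) := univ.filter fun v => ∃ j, v ∈ V j ∧ (π v : ℕ) % s = j with hgood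
  have hbad : (#(univ \ good) : ℝ) ≤ s * (2 * t + 1) := by
    have h1 : good = univ.biUnion fun j => (V j).filter fun v => (π v : ℕ) % s = j := by
      ext v
      simp [hgood]
    have h2 : #good = ∑ j, #((V j).filter fun v => (π v : ℕ) % s = j) := by
      rw [h1]
      refine card_biUnion fun i _ j _ hij => disjoint_left.2 fun v hi hj => ?_
      exact hij (hV i j v (mem_filter.1 hi).1 (mem_filter.1 hj).1)
    have h3 : (#(univ \ good) : ℝ) + #good = n := by
      have := card_sdiff_add_card_eq_card (subset_univ good)
      rw [card_univ, Fintype.card_fin] at this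
      exact_mod_cast this
    have h4 : ∑ _j : Fin s, ((n : ℝ) / s - 2 * t - 1) ≤ #good := by
      rw [h2]
      push_cast
      refine sum_le_sum fun j _ => ?_
      have h5 : (#((V j).filter fun v => (π v : ℕ) % s = j) : ℝ) +
          #((V j).filter fun v => ¬ (π v : ℕ) % s = j) = #(V j) := by
        exact_mod_cast card_filter_add_card_filter_not _
      have h6 := hπ j
      have h7 := (abs_le.1 (hcard j)).1
      linarith
    rw [sum_const, card_univ, Fintype.card_fin, nsmul_eq_mul] at h4
    have h5 : (s : ℝ) * ((n : ℝ) / s - 2 * t - 1) = n - s * (2 * t + 1) := by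
      field_simp
      ring
    linarith
  have hhit : (n : ℝ) ^ 2 / s - 2 * t * n ≤
      #(univ.filter fun p : Fin n × Fin n => ¬ Disjoint (F p.1) (F p.2)) := by
    have h1 : ∑ j, #(V j) * #(V j) ≤
        #(univ.filter fun p : Fin n × Fin n => ¬ Disjoint (F p.1) (F p.2)) := by
      simp only [← card_product]
      rw [← card_biUnion]
      · refine card_le_card fun p hp => ?_
        obtain ⟨j, -, hj⟩ := mem_biUnion.1 hp
        obtain ⟨hu, hv⟩ := mem_product.1 hj
        refine mem_filter.2 ⟨mem_univ _, ?_⟩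
        rw [(mem_filter.1 hu).2, (mem_filter.1 hv).2, disjoint_self]
        exact (hne j).ne_empty
      · intro i _ j _ hij
        refine disjoint_left.2 fun p hi hj => hij ?_
        exact hV i j p.1 (mem_product.1 hi).1 (mem_product.1 hj).1
    have h2 : ∑ _j : Fin s, (((n : ℝ) / s) ^ 2 - 2 * t * (n / s)) ≤
        ((∑ j, #(V j) * #(V j) : ℕ) : ℝ) := by
      push_cast
      refine sum_le_sum fun j _ => ?_
      have h3 := (abs_le.1 (hcard j)).1
      have h4 : (0 : ℝ) ≤ n / s := by positivity
      have h5 := mul_le_mul_of_nonneg_left h3 h4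
      nlinarith [sq_nonneg ((#(V j) : ℝ) - n / s)]
    rw [sum_const, card_univ, Fintype.card_fin, nsmul_eq_mul] at h2
    have h5 : (s : ℝ) * (((n : ℝ) / s) ^ 2 - 2 * t * (n / s)) = (n : ℝ) ^ 2 / s - 2 * t * n := by
      field_simp
    have h6 : ((∑ j, #(V j) * #(V j) : ℕ) : ℝ) ≤
      #(univ.filter fun p : Fin n × Fin n => ¬ Disjoint (F p.1) (F p.2)) := by exact_mod_cast h1
    linarith
  have hsplit : (univ.filter fun p : Fin n × Fin n =>
      ¬ (G.Adj p.1 p.2 ↔ T.Adj (π p.1) (π p.2))) ⊆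
      ((univ \ good) ×ˢ univ ∪ univ ×ˢ (univ \ good)) ∪
      ((univ.filter fun p : Fin n × Fin n => G.Adj p.1 p.2 ∧ ¬ Disjoint (F p.1) (F p.2)) ∪
      (univ.filter fun p : Fin n × Fin n => ¬ G.Adj p.1 p.2 ∧ Disjoint (F p.1) (F p.2))) := by
    rintro ⟨u, v⟩ h
    have h' := (mem_filter.1 h).2
    by_cases hu : u ∈ good
    swap
    · exact mem_union_left _ (mem_union_left _ (by simp [hu]))
    by_cases hv : v ∈ good
    swap
    · exact mem_union_left _ (mem_union_right _ (by simp [hv]))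
    refine mem_union_right _ ?_
    obtain ⟨i, hui, hur⟩ := (mem_filter.1 hu).2
    obtain ⟨j, hvj, hvr⟩ := (mem_filter.1 hv).2
    have hd : T.Adj (π u) (π v) ↔ Disjoint (F u) (F v) := by
      have : T.Adj (π u) (π v) ↔ (π u : ℕ) % s ≠ (π v : ℕ) % s := by rw [hT]; exact Iff.rfl
      rw [this, hur, hvr, (mem_filter.1 hui).2, (mem_filter.1 hvj).2]
      constructor
      · exact fun hij => hC i j fun h => hij (congrArg Fin.val h)
      · intro hdis hij
        rw [Fin.ext hij, disjoint_self] at hdis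
        exact (hne j).ne_empty hdis
    dsimp only at h'
    rw [hd] at h'
    simp only [mem_union, mem_filter, mem_univ, true_and]
    tauto
  have h1 := (card_le_card hsplit).trans ((card_union_le _ _).trans
    (add_le_add (card_union_le _ _) (card_union_le _ _)))
  rw [card_product, card_product, card_univ, Fintype.card_fin] at h1
  have h1R := Nat.cast_le (α := ℝ).2 h1
  push_cast at h1R
  have h2 := card_filter_add_card_filter_not (s := (univ : Finset (Fin n × Fin n)))
    (fun p => G.Adj p.1 p.2)
  rw [card_adj_pairs, card_univ, Fintype.card_prod, Fintype.card_fin] at h2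
  have h3 := card_filter_add_card_filter_not
    (s := univ.filter fun p : Fin n × Fin n => ¬ G.Adj p.1 p.2) (fun p => Disjoint (F p.1) (F p.2))
  have h4 := card_filter_add_card_filter_not
    (s := univ.filter fun p : Fin n × Fin n => ¬ Disjoint (F p.1) (F p.2))
    (fun p => G.Adj p.1 p.2)
  simp only [filter_filter] at h3 h4
  have h5 : #(univ.filter fun p : Fin n × Fin n => ¬ Disjoint (F p.1) (F p.2) ∧ G.Adj p.1 p.2) =
      #(univ.filter fun p : Fin n × Fin n => G.Adj p.1 p.2 ∧ ¬ Disjoint (F p.1) (F p.2)) := by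
    simp only [and_comm]
  have h6 : #(univ.filter fun p : Fin n × Fin n => ¬ Disjoint (F p.1) (F p.2) ∧ ¬ G.Adj p.1 p.2) =
      #(univ.filter fun p : Fin n × Fin n => ¬ G.Adj p.1 p.2 ∧ ¬ Disjoint (F p.1) (F p.2)) := by
    simp only [and_comm]
  rw [h5, h6] at h4
  have h2R : 2 * (numEdges G : ℝ) + #(univ.filter fun p : Fin n × Fin n => ¬ G.Adj p.1 p.2) =
    (n : ℝ) ^ 2 := by rw [pow_two]; exact_mod_cast h2
  have h3R := congrArg (Nat.cast (R := ℝ)) h3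
  have h4R := congrArg (Nat.cast (R := ℝ)) h4
  push_cast at h3R h4R
  have h7 : (#(univ \ good) : ℝ) * n ≤ s * (2 * t + 1) * n :=
    mul_le_mul_of_nonneg_right hbad (Nat.cast_nonneg n)
  linarith

end Arrangement

section ListWeight

variable {n q s K : ℕ}

/-- The distribution of a uniformly chosen list. -/
noncomputable def listWeight (F : Fin n → Finset (Fin q)) (A : Finset (Fin q)) : ℝ :=
  (#(univ.filter fun v => F v = A) : ℝ) / n

theorem sum_listWeight_mul (F : Fin n → Finset (Fin q)) (g : Finset (Fin q) → ℝ) :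
    ∑ A, listWeight F A * g A = (∑ v, g (F v)) / n := by
  rw [← sum_fiberwise univ F (fun v => g (F v)), sum_div]
  refine sum_congr rfl fun A _ => ?_
  rw [sum_congr rfl (g := fun _ => g A) (fun v hv => by rw [(mem_filter.1 hv).2]), sum_const,
    nsmul_eq_mul, listWeight]
  ring

theorem isWeight_listWeight (hn : 0 < n) (F : Fin n → Finset (Fin q))
    (hF : ∀ v, (F v).Nonempty) : IsWeight (listWeight F) where
  nonneg A := by unfold listWeight; positivity
  empty := by
    have : (univ.filter fun v => F v = ∅) = ∅ :=
      filter_eq_empty_iff.2 fun v _ => (hF v).ne_empty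
    simp [listWeight, this]
  sum_eq := by
    have := sum_listWeight_mul F fun _ => 1
    have hn' : (n : ℝ) ≠ 0 := by exact_mod_cast hn.ne'
    simpa [hn'] using this

theorem logMean_listWeight (F : Fin n → Finset (Fin q)) :
    logMean (listWeight F) = (∑ v, Real.log (#(F v) : ℝ)) / n :=
  sum_listWeight_mul F fun A => Real.log (#A : ℝ)

theorem selfMeet_listWeight (F : Fin n → Finset (Fin q)) :
    selfMeet (listWeight F) =
      (#(univ.filter fun p : Fin n × Fin n => ¬ Disjoint (F p.1) (F p.2)) : ℝ) / (n : ℝ) ^ 2 := by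
  have h : ∀ A, meetWeight (listWeight F) A = (∑ v, hit A (F v)) / n := fun A =>
    sum_listWeight_mul F fun B => hit A B
  rw [selfMeet, sum_listWeight_mul F]
  simp only [h]
  rw [← sum_div, div_div, ← pow_two, ← univ_product_univ, card_filter, sum_product]
  push_cast
  congr 1
  refine sum_congr rfl fun u _ => sum_congr rfl fun v _ => ?_
  simp only [hit]
  split_ifs <;> simp_all

end ListWeight

section Extremal

variable {q s K : ℕ}

open Classical in
/-- The lists of an extremal graph have large average logarithm and few meeting pairs. -/
theorem exists_lists_of_extremal (p : Params q s K) {n m w M : ℕ} (hw : 2 * w * s ≤ n)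
    (hm : 2 * (m : ℝ) + (n : ℝ) ^ 2 / s + n ≤ (n : ℝ) ^ 2 + (w : ℝ) ^ 2) {b : ℝ} (hb : 0 < b)
    (hM : 1 ≤ M * b) (G : SimpleGraph (Fin n)) (hG : numEdges G = m)
    (hext : ∀ H : SimpleGraph (Fin n), numEdges H = m → numColorings q H ≤ numColorings q G) :
    ∃ F : Fin n → Finset (Fin q), (∀ v, (F v).Nonempty) ∧
      ((n : ℝ) - s) * balancedLog q s K - 2 * w * Real.log q - M * q * Real.log (n + 1) ≤
        ∑ v, Real.log (#(F v) : ℝ) ∧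
      (#(univ.filter fun p : Fin n × Fin n =>
        G.Adj p.1 p.2 ∧ ¬ Disjoint (F p.1) (F p.2)) : ℝ) ≤ q * b * n ^ 2 ∧
      (#(univ.filter fun p : Fin n × Fin n => ¬ Disjoint (F p.1) (F p.2)) : ℝ) ≤
        (n : ℝ) ^ 2 - 2 * m + q * b * n ^ 2 := by
  obtain ⟨H, hH, hlow⟩ := exists_graph_numColorings_ge p hw hm
  obtain ⟨F, hF, hadj⟩ := exists_color_lists G q hb hM
  have h1 : Real.exp (((n : ℝ) - s) * balancedLog q s K - 2 * w * Real.log q) ≤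
      ((n : ℝ) + 1) ^ (M * q) * ∏ v, (#(F v) : ℝ) :=
    hlow.trans ((Nat.cast_le.2 (hext H hH)).trans hF)
  have hne : ∀ v, (F v).Nonempty := by
    intro v
    by_contra hv
    rw [not_nonempty_iff_eq_empty] at hv
    rw [prod_eq_zero (mem_univ v) (by simp [hv]), mul_zero] at h1
    exact absurd (Real.exp_pos _) (not_lt.2 h1)
  refine ⟨F, hne, ?_, hadj, ?_⟩
  · have hpos : ∀ v, (0 : ℝ) < #(F v) := fun v => by exact_mod_cast card_pos.2 (hne v)
    have h2 := (Real.le_log_iff_exp_le (by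
      have := prod_pos fun v (_ : v ∈ univ) => hpos v
      positivity)).2 h1
    rw [Real.log_mul (by positivity) (prod_pos fun v _ => hpos v).ne', Real.log_pow,
      Real.log_prod fun v _ => (hpos v).ne'] at h2
    push_cast at h2
    linarith
  · have h2 := card_filter_add_card_filter_not (s := (univ : Finset (Fin n × Fin n)))
      (fun p => G.Adj p.1 p.2)
    rw [card_adj_pairs, card_univ, Fintype.card_prod, Fintype.card_fin, hG] at h2
    have h3 : #(univ.filter fun p : Fin n × Fin n => ¬ Disjoint (F p.1) (F p.2)) ≤
        #(univ.filter fun p : Fin n × Fin n => ¬ G.Adj p.1 p.2) +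
        #(univ.filter fun p : Fin n × Fin n => G.Adj p.1 p.2 ∧ ¬ Disjoint (F p.1) (F p.2)) := by
      refine le_trans (card_le_card fun x hx => ?_) (card_union_le _ _)
      simp only [mem_union, mem_filter, mem_univ, true_and] at hx ⊢
      tauto
    have h2R : 2 * (m : ℝ) + #(univ.filter fun p : Fin n × Fin n => ¬ G.Adj p.1 p.2) =
      (n : ℝ) ^ 2 := by rw [pow_two]; exact_mod_cast h2
    have h3R := Nat.cast_le (α := ℝ).2 h3
    push_cast at h3R
    linarith

theorem eventually_log_le {c d : ℝ} (hc : 0 ≤ c) (hd : 0 < d) :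
    ∀ᶠ n : ℕ in Filter.atTop, c * Real.log (n + 1) ≤ d * n := by
  have h1 := Real.isLittleO_log_id_atTop.def (show 0 < d / (2 * (c + 1)) by positivity)
  have h2 : Filter.Tendsto (fun n : ℕ => (n : ℝ) + 1) Filter.atTop Filter.atTop :=
    Filter.tendsto_atTop_add_const_right _ _ tendsto_natCast_atTop_atTop
  filter_upwards [h2.eventually h1, Filter.eventually_ge_atTop 1] with n hn hn1
  have hn1' : (1 : ℝ) ≤ n := by exact_mod_cast hn1
  have h3 : 0 ≤ Real.log ((n : ℝ) + 1) := Real.log_nonneg (by linarith)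
  rw [Real.norm_of_nonneg h3, id, Real.norm_of_nonneg (by linarith)] at hn
  have h4 : (c + 1) * Real.log ((n : ℝ) + 1) ≤ (c + 1) * (d / (2 * (c + 1)) * (n + 1)) :=
    mul_le_mul_of_nonneg_left hn (by linarith)
  have h5 : (c + 1) * (d / (2 * (c + 1)) * ((n : ℝ) + 1)) = d * (n + 1) / 2 := by
    field_simp
  have h6 : d * ((n : ℝ) + 1) / 2 ≤ d * n := by nlinarith
  linarith

theorem eventually_le_mul (c : ℝ) {d : ℝ} (hd : 0 < d) :
    ∀ᶠ n : ℕ in Filter.atTop, c ≤ d * n :=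
  (tendsto_natCast_atTop_atTop.const_mul_atTop hd).eventually_ge_atTop c

/-- For fixed admissible parameters, extremal graphs are close to the Turán graph. -/
theorem Params.editClose_of_extremal (p : Params q s K) {ε : ℝ} (hε : 0 < ε) :
    ∃ δ : ℝ, 0 < δ ∧ ∃ N : ℕ, 0 < N ∧ ∀ n : ℕ, N ≤ n → ∀ m : ℕ,
      |(m : ℝ) - ((s : ℝ) - 1) / (2 * (s : ℝ)) * (n : ℝ) ^ 2| ≤ δ * (n : ℝ) ^ 2 →
      ∀ G : SimpleGraph (Fin n), numEdges G = m →
        (∀ H : SimpleGraph (Fin n), numEdges H = m → numColorings q H ≤ numColorings q G) →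
        EditClose (ε * (n : ℝ) ^ 2) G (turanGraph n s) := by
  classical
  have hs := p.s_pos
  have hs0 : 0 < s := by exact_mod_cast hs
  have hs1 : (1 : ℝ) ≤ s := by exact_mod_cast hs0
  have hq : (0 : ℝ) < q := by exact_mod_cast p.q_pos
  have hlogq := Real.log_natCast_nonneg q
  obtain ⟨γ, hγ, hstab⟩ := p.stability (show 0 < ε / (100 * s) by positivity)
  set b := min (γ / (4 * q)) (ε / (100 * q)) with hb_def
  have hb : 0 < b := lt_min (by positivity) (by positivity)
  have hqb1 : q * b ≤ γ / 4 := by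
    have := mul_le_mul_of_nonneg_left (min_le_left (γ / (4 * q)) (ε / (100 * q))) hq.le
    have h2 : (q : ℝ) * (γ / (4 * q)) = γ / 4 := by field_simp
    linarith
  have hqb2 : q * b ≤ ε / 100 := by
    have := mul_le_mul_of_nonneg_left (min_le_right (γ / (4 * q)) (ε / (100 * q))) hq.le
    have h2 : (q : ℝ) * (ε / (100 * q)) = ε / 100 := by field_simp
    linarith
  set M := ⌈1 / b⌉₊ with hM_def
  have hM : 1 ≤ M * b := by
    rw [← div_le_iff₀ hb]
    exact Nat.le_ceil _
  set ρ : ℝ := min (1 / (4 * (s : ℝ))) (min (γ / (16 * (Real.log q + 1))) (min 1 (min γ ε))) with hρ_def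
  have hρ : 0 < ρ := by
    refine lt_min (by positivity) (lt_min (by positivity) (lt_min one_pos (lt_min hγ hε)))
  have hρs : 4 * ρ * s ≤ 1 := by
    have h1 : ρ ≤ 1 / (4 * (s : ℝ)) := min_le_left _ _
    rw [le_div_iff₀ (by positivity)] at h1
    linarith
  have hρq : 4 * ρ * Real.log q ≤ γ / 4 := by
    have h1 : ρ ≤ γ / (16 * (Real.log q + 1)) := (min_le_right _ _).trans (min_le_left _ _)
    rw [le_div_iff₀ (by positivity)] at h1
    linarith
  have hρ1 : ρ ≤ 1 := (min_le_right _ _).trans ((min_le_right _ _).trans (min_le_left _ _))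
  have hργ : ρ ≤ γ := (min_le_right _ _).trans ((min_le_right _ _).trans
    ((min_le_right _ _).trans (min_le_left _ _)))
  have hρε : ρ ≤ ε := (min_le_right _ _).trans ((min_le_right _ _).trans
    ((min_le_right _ _).trans (min_le_right _ _)))
  have hρρ : ρ ^ 2 ≤ ρ := by nlinarith
  have hev := (eventually_le_mul 1 hρ).and ((eventually_le_mul 1
    (show 0 < ρ ^ 2 / 2 by positivity)).and ((eventually_le_mul (s * balancedLog q s K)
    (show 0 < γ / 4 by positivity)).and ((eventually_le_mul (2 * s : ℝ)
    (show 0 < ε / 10 by positivity)).and (eventually_log_le (show (0 : ℝ) ≤ M * q by positivity)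
    (show 0 < γ / 4 by positivity)))))
  obtain ⟨N, hN⟩ := Filter.eventually_atTop.1 hev
  refine ⟨ρ ^ 2 / 4, by positivity, N + 1, Nat.succ_pos _, ?_⟩
  intro n hn m hmn G hG hext
  obtain ⟨h1, h2, h3, h4, h5⟩ := hN n (by omega)
  have hn0 : 0 < n := by omega
  have hn' : (0 : ℝ) < n := by exact_mod_cast hn0
  have hturan : ((s : ℝ) - 1) / (2 * (s : ℝ)) * (n : ℝ) ^ 2 =
      ((n : ℝ) ^ 2 - (n : ℝ) ^ 2 / s) / 2 := by
    field_simp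
  rw [hturan, abs_le] at hmn
  obtain ⟨hm1, hm2⟩ := hmn
  set w := ⌈ρ * n⌉₊ with hw_def
  have hw1 : ρ * n ≤ w := Nat.le_ceil _
  have hw2 : (w : ℝ) ≤ 2 * ρ * n := by
    have := Nat.ceil_lt_add_one (show 0 ≤ ρ * n by positivity)
    linarith
  have hws : 2 * w * s ≤ n := by
    have h6 : (2 * w * s : ℝ) ≤ n := by
      have h7 : (2 * w * s : ℝ) ≤ 2 * (2 * ρ * n) * s := by gcongr
      have h8 := mul_le_mul_of_nonneg_right hρs hn'.le
      linarith
    exact_mod_cast h6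
  have hwm : 2 * (m : ℝ) + (n : ℝ) ^ 2 / s + n ≤ (n : ℝ) ^ 2 + (w : ℝ) ^ 2 := by
    have h6 : (ρ * n) ^ 2 ≤ (w : ℝ) ^ 2 := by gcongr
    have h7 := mul_le_mul_of_nonneg_right h2 hn'.le
    linarith
  obtain ⟨F, hne, hlog, hadj, hmeet⟩ := exists_lists_of_extremal p hws hwm hb hM G hG hext
  obtain ⟨C, hC, hCne, hCα⟩ := hstab (listWeight F) (isWeight_listWeight hn0 F hne) (by
    rw [selfMeet_listWeight, div_le_iff₀ (by positivity)]
    have h6 := mul_le_mul_of_nonneg_right hqb1 (sq_nonneg (n : ℝ))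
    have h7 := mul_le_mul_of_nonneg_right (hρρ.trans hργ) (sq_nonneg (n : ℝ))
    have h8 : (1 / s + γ) * (n : ℝ) ^ 2 = (n : ℝ) ^ 2 / s + γ * n ^ 2 := by ring
    have h9 : 0 ≤ γ * (n : ℝ) ^ 2 := by positivity
    refine le_trans (le_trans (le_of_eq ?_) hmeet) ?_
    · congr!
    · linarith) (by
    rw [logMean_listWeight, le_div_iff₀ hn']
    have h6 : 2 * w * Real.log q ≤ 2 * (2 * ρ * n) * Real.log q := by gcongr
    have h7 := mul_le_mul_of_nonneg_right hρq hn'.le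
    have h9 : 0 ≤ γ * (n : ℝ) := by positivity
    linarith)
  have hclose := editClose_turanGraph G hs0 F C hC hCne (t := ε / (100 * s) * n)
    (σ := ρ ^ 2 / 2 * (n : ℝ) ^ 2) (by positivity) (fun j => by
      have h6 : (#(univ.filter fun v => F v = C j) : ℝ) - n / s =
          (listWeight F (C j) - 1 / s) * n := by
        rw [listWeight]
        field_simp
      rw [h6, abs_mul, abs_of_pos hn']
      exact mul_le_mul_of_nonneg_right (hCα j) hn'.le) hadj (by rw [hG]; linarith)
  obtain ⟨G', hiso, hG'⟩ := hclose
  refine ⟨G', hiso, hG'.trans ?_⟩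
  have h6 := mul_le_mul_of_nonneg_right hqb2 (sq_nonneg (n : ℝ))
  have h7 := mul_le_mul_of_nonneg_right (hρρ.trans hρε) (sq_nonneg (n : ℝ))
  have h8 := mul_le_mul_of_nonneg_right h4 hn'.le
  have h9 : 2 * (s : ℝ) * (2 * (ε / (100 * s) * n) + 1) * n =
      4 / 100 * (ε * n ^ 2) + 2 * s * n := by
    field_simp
    ring
  have h10 : 2 * (ε / (100 * s) * n) * n ≤ 2 / 100 * (ε * (n : ℝ) ^ 2) := by
    have : ε / (100 * s) ≤ ε / 100 := by
      gcongr
      linarith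
    have := mul_le_mul_of_nonneg_right this (sq_nonneg (n : ℝ))
    linarith
  have h11 : 0 ≤ ε * (n : ℝ) ^ 2 := by positivity
  linarith

end Extremal

end TuranColoring

/-- For large `s` and `q ≥ 100 s² / log s`, every extremal graph for the number of
`q`-colorings with edge density close to `(s-1)/(2s)` is `ε n²`-close to the Turán
graph `T_s(n)`. -/
theorem turan_asymptotically_extremal :
    ∃ s₀ : ℕ, ∀ s : ℕ, s₀ ≤ s → ∀ q : ℕ,
      100 * (s : ℝ) ^ 2 / Real.log s ≤ (q : ℝ) →
      ∀ ε : ℝ, 0 < ε → ∃ δ : ℝ, 0 < δ ∧ ∃ N : ℕ, 0 < N ∧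
        ∀ n : ℕ, N ≤ n → ∀ m : ℕ,
          |(m : ℝ) - ((s : ℝ) - 1) / (2 * (s : ℝ)) * (n : ℝ) ^ 2| ≤ δ * (n : ℝ) ^ 2 →
          ∀ G : SimpleGraph (Fin n), numEdges G = m →
            (∀ H : SimpleGraph (Fin n), numEdges H = m →
              numColorings q H ≤ numColorings q G) →
            EditClose (ε * (n : ℝ) ^ 2) G (turanGraph n s) := by
  obtain ⟨s₀, h⟩ := TuranColoring.exists_params
  refine ⟨s₀, fun s hs q hq ε hε => ?_⟩
  obtain ⟨K, p⟩ := h s hs q hq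
  exact p.editClose_of_extremal hε
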